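/- arXiv:1705.04255 — 2 statements merged into one kernel-verified Lean document; each statement's English description precedes it below -/
import Mathlib

section
/- There exists a constant c > 0 such that for every prime p > 2, every quadratic polynomial f(x) ∈ F_p[x] of degree exactly 2, and every set A ⊆ F_p with |A| ≤ p^(5/8), the sumset f(A) + A = {f(a) + b : a,b ∈ A} has cardinality at least c·|A|^(6/5). -/
open Finset

namespace RQ
open Polynomial

/-- The resultant of a non-constant irreducible `f` and a `g` not divisible by it is nonzero. -/
lemma resultant_ne_zero_of_irreducible {R : Type*} [CommRing R] [IsDomain R]
    [UniqueFactorizationMonoid R] (f g : R[X]) (hf : Irreducible f) (hd : f.natDegree ≠ 0)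
    (hfg : ¬ f ∣ g) : resultant f g ≠ 0 := by
  classical
  have ⟨_⟩ := (inferInstance : Nonempty (NormalizedGCDMonoid R))
  have hp : f.IsPrimitive := hf.isPrimitive hd
  intro h
  let K := FractionRing R
  have hinj : Function.Injective (algebraMap R K) := IsFractionRing.injective R K
  have h1 : resultant (f.map (algebraMap R K)) (g.map (algebraMap R K)) = 0 := by
    rw [natDegree_map_eq_of_injective hinj, natDegree_map_eq_of_injective hinj,
      resultant_map_map, h, map_zero]
  rw [resultant_eq_zero_iff] at h1
  have hirr := (hp.irreducible_iff_irreducible_map_fraction_map (K := K)).1 hf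
  refine h1.2 ?_
  rcases (EuclideanDomain.dvd_or_coprime _ (g.map (algebraMap R K)) hirr).symm with h2 | h2
  · exact h2
  · exact absurd (hp.dvd_of_fraction_map_dvd_fraction_map h2) hfg

open MvPolynomial in
lemma totalDegree_det_le {n : ℕ} {σ R : Type*} [CommRing R] (A : Matrix (Fin n) (Fin n) (MvPolynomial σ R))
    (w : Fin n → ℕ) (h : ∀ i j, (A i j).totalDegree ≤ w j) : A.det.totalDegree ≤ ∑ j, w j := by
  rw [Matrix.det_apply]
  refine totalDegree_finsetSum_le fun s _ => ?_
  refine (totalDegree_smul_le _ _).trans ?_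
  refine (totalDegree_finsetProd _ _).trans ?_
  exact Finset.sum_le_sum fun i _ => h _ _

open MvPolynomial in
lemma totalDegree_resultant_le {σ R : Type*} [CommRing R] (f g : Polynomial (MvPolynomial σ R)) (a b : ℕ)
    (hf : ∀ i, (f.coeff i).totalDegree ≤ a) (hg : ∀ i, (g.coeff i).totalDegree ≤ b) :
    (resultant f g).totalDegree ≤ f.natDegree * b + g.natDegree * a := by
  unfold resultant
  refine (totalDegree_det_le _ (fun j => j.addCases (fun _ => b) (fun _ => a)) ?_).trans ?_
  · intro i j
    induction j using Fin.addCases with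
    | left j => simp only [sylvester, Matrix.of_apply, Fin.addCases_left]; split_ifs <;> simp [hg]
    | right j => simp only [sylvester, Matrix.of_apply, Fin.addCases_right]; split_ifs <;> simp [hf]
  · rw [Fin.sum_univ_add]; simp

/-- polynomials in variables `0 = Z`, `1 = X`, `2 = Y` -/
abbrev P3 (F : Type*) [Field F] := MvPolynomial (Fin 3) F

variable {F : Type*} [Field F]

/-- restriction to a horizontal line `Y = y, Z = a X + b`. -/
noncomputable def evL (y a b : F) : P3 F →ₐ[F] F[X] :=
  MvPolynomial.aeval ![C a * X + C b, X, C y]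

/-- restriction to a vertical line `X = x, Z = c Y + e`. -/
noncomputable def evM (x c e : F) : P3 F →ₐ[F] F[X] :=
  MvPolynomial.aeval ![C c * X + C e, C x, X]

lemma natDegree_evL_le (y a b : F) (Q : P3 F) : (evL y a b Q).natDegree ≤ Q.totalDegree := by
  have := MvPolynomial.aeval_natDegree_le (n := 1) Q le_rfl ![C a * X + C b, X, C y] (by
    intro i; fin_cases i
    · simpa using natDegree_linear_le (a := a) (b := b)
    · simp
    · simp)
  simpa [evL] using this

lemma natDegree_evM_le (y a b : F) (Q : P3 F) : (evM y a b Q).natDegree ≤ Q.totalDegree := by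
  have := MvPolynomial.aeval_natDegree_le (n := 1) Q le_rfl ![C a * X + C b, C y, X] (by
    intro i; fin_cases i
    · simpa using natDegree_linear_le (a := a) (b := b)
    · simp
    · simp)
  simpa [evM] using this

/-- value of restriction at a point is point evaluation -/
lemma eval_evL (y a b t : F) (Q : P3 F) :
    (evL y a b Q).eval t = MvPolynomial.aeval ![a * t + b, t, y] Q := by
  have : (Polynomial.aeval t).comp (evL y a b) = MvPolynomial.aeval ![a * t + b, t, y] :=
    MvPolynomial.algHom_ext (fun i => by fin_cases i <;> simp [evL])
  simpa [Polynomial.coe_aeval_eq_eval] using DFunLike.congr_fun this Q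

lemma eval_evM (x c e t : F) (Q : P3 F) :
    (evM x c e Q).eval t = MvPolynomial.aeval ![c * t + e, x, t] Q := by
  have : (Polynomial.aeval t).comp (evM x c e) = MvPolynomial.aeval ![c * t + e, x, t] :=
    MvPolynomial.algHom_ext (fun i => by fin_cases i <;> simp [evM])
  simpa [Polynomial.coe_aeval_eq_eval] using DFunLike.congr_fun this Q

end RQ

namespace RQ
open Polynomial
variable {F : Type*} [Field F]

lemma natDegree_aeval_le {σ S : Type*} [CommRing S] [Algebra F S] (Q : MvPolynomial σ F)
    (f : σ → S[X]) (hf : ∀ i, (f i).natDegree ≤ 1) :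
    (MvPolynomial.aeval f Q).natDegree ≤ Q.totalDegree := by
  rw [← MvPolynomial.aeval_map_algebraMap S f Q]
  have := MvPolynomial.aeval_natDegree_le (n := 1) (m := Q.totalDegree)
    (MvPolynomial.map (algebraMap F S) Q) (by
      unfold MvPolynomial.totalDegree
      exact Finset.sup_mono (MvPolynomial.support_map_subset _ _)) f hf
  simpa using this

lemma aeval_eq_eval₂ {S : Type*} [CommRing S] [Algebra F S] (f : Fin 3 → S) (Q : P3 F) :
    MvPolynomial.aeval f Q = (MvPolynomial.finSuccEquiv F 2 Q).eval₂
      (MvPolynomial.aeval (fun i : Fin 2 => f i.succ) : MvPolynomial (Fin 2) F →ₐ[F] S).toRingHom (f 0) := by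
  induction Q using MvPolynomial.induction_on with
  | C a => simp [MvPolynomial.finSuccEquiv_apply]
  | add p q hp hq => simp [hp, hq, eval₂_add]
  | mul_X p i hp =>
    rw [map_mul, map_mul, eval₂_mul, ← hp]
    congr 1
    refine Fin.cases ?_ (fun j => ?_) i
    · simp [MvPolynomial.finSuccEquiv_X_zero]
    · simp [MvPolynomial.finSuccEquiv_X_succ]

lemma card_le_of_two (R : MvPolynomial (Fin 2) F) (hR : R ≠ 0) {ι : Type*} (L : Finset ι)
    (y : ι → F) (hy : Set.InjOn y L)
    (h : ∀ i ∈ L, MvPolynomial.aeval ![X, C (y i)] R = (0 : F[X])) : L.card ≤ R.totalDegree := by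
  classical
  let r : F[X][X] := MvPolynomial.aeval ![C X, X] R
  have hr : r ≠ 0 := by
    intro h0
    apply hR
    let ψ : F[X][X] →+* MvPolynomial (Fin 2) F :=
      eval₂RingHom (Polynomial.aeval (MvPolynomial.X 0)).toRingHom (MvPolynomial.X 1)
    have : ψ.comp (MvPolynomial.aeval ![C X, X] : MvPolynomial (Fin 2) F →ₐ[F] F[X][X]).toRingHom
        = RingHom.id _ := by
      apply MvPolynomial.ringHom_ext
      · intro r
        simp [ψ, IsScalarTower.algebraMap_apply F F[X] F[X][X]]
      · intro i; fin_cases i <;> simp [ψ]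
    have h2 := DFunLike.congr_fun this R
    rw [RingHom.comp_apply] at h2
    change ψ r = R at h2
    rw [← h2, h0, map_zero]
  have hdeg : r.natDegree ≤ R.totalDegree := natDegree_aeval_le _ _ (by intro i; fin_cases i <;> simp)
  by_contra hlt
  push Not at hlt
  apply hr
  refine eq_zero_of_natDegree_lt_card_of_eval_eq_zero' r (L.image fun i => C (y i)) ?_ ?_
  · intro c hc
    obtain ⟨i, hi, rfl⟩ := Finset.mem_image.1 hc
    rw [← h i hi]
    have : ((Polynomial.aeval (C (y i))).restrictScalars F).comp
        (MvPolynomial.aeval ![C X, X] : MvPolynomial (Fin 2) F →ₐ[F] F[X][X])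
        = MvPolynomial.aeval ![X, C (y i)] :=
      MvPolynomial.algHom_ext (fun i => by fin_cases i <;> simp)
    rw [← this]
    simp [r, Polynomial.coe_aeval_eq_eval]
  · rw [Finset.card_image_of_injOn]
    · omega
    · intro i hi j hj hij
      exact hy hi hj (C_injective hij)

lemma bezout (Q H : P3 F) (hQ : Irreducible Q)
    (hz : (MvPolynomial.finSuccEquiv F 2 Q).natDegree ≠ 0) (hQH : ¬ Q ∣ H) {ι : Type*}
    (L : Finset ι) (y a b : ι → F) (hy : Set.InjOn y L)
    (h1 : ∀ i ∈ L, evL (y i) (a i) (b i) Q = 0) (h2 : ∀ i ∈ L, evL (y i) (a i) (b i) H = 0) :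
    L.card ≤ 2 * Q.totalDegree * H.totalDegree := by
  set e := MvPolynomial.finSuccEquiv F 2 with he
  have hirr : Irreducible (e Q) := (MulEquiv.irreducible_iff e).2 hQ
  have hdvd : ¬ e Q ∣ e H := by rwa [map_dvd_iff]
  have hR := resultant_ne_zero_of_irreducible (e Q) (e H) hirr hz hdvd
  obtain ⟨p, q, -, -, hpq⟩ := exists_mul_add_mul_eq_C_resultant (e Q) (e H) le_rfl le_rfl (Or.inl hz)
  have hco : ∀ (P : P3 F) i, ((e P).coeff i).totalDegree ≤ P.totalDegree := by
    intro P i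
    by_cases h0 : (e P).coeff i = 0
    · simp [h0]
    · have := MvPolynomial.totalDegree_coeff_finSuccEquiv_add_le P i h0
      exact le_trans (Nat.le_add_right _ _) this
  have hnd : ∀ (P : P3 F), (e P).natDegree ≤ P.totalDegree := by
    intro P
    by_cases h0 : P = 0
    · simp [h0]
    · have := MvPolynomial.totalDegree_coeff_finSuccEquiv_add_le P (e P).natDegree
        (by
          rw [coeff_natDegree, Ne, leadingCoeff_eq_zero]
          simpa [he] using h0)
      exact le_trans (Nat.le_add_left _ _) this
  have hdeg := totalDegree_resultant_le (e Q) (e H) _ _ (hco Q) (hco H)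
  have := card_le_of_two _ hR L y hy ?_
  · refine this.trans (hdeg.trans ?_)
    have e1 := Nat.mul_le_mul_right H.totalDegree (hnd Q)
    have e2 := Nat.mul_le_mul_right Q.totalDegree (hnd H)
    nlinarith
  · intro i hi
    have hf : (fun j : Fin 2 => ![C (a i) * X + C (b i), X, C (y i)] j.succ) = ![X, C (y i)] := by
      funext j; fin_cases j <;> rfl
    have k1 := h1 i hi
    have k2 := h2 i hi
    rw [evL, aeval_eq_eval₂, hf] at k1 k2
    have := congrArg (eval₂ (MvPolynomial.aeval ![X, C (y i)] :
      MvPolynomial (Fin 2) F →ₐ[F] F[X]).toRingHom (C (a i) * X + C (b i))) hpq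
    rw [eval₂_add, eval₂_mul, eval₂_mul] at this
    simp only [Matrix.cons_val_zero] at k1 k2
    rw [k1, k2, eval₂_C] at this
    simpa using this.symm

lemma derivative_aeval {S : Type*} [CommRing S] [Algebra F S] (f : Fin 3 → S[X]) (Q : P3 F) :
    derivative (MvPolynomial.aeval f Q) =
      ∑ i, MvPolynomial.aeval f (MvPolynomial.pderiv i Q) * derivative (f i) := by
  induction Q using MvPolynomial.induction_on with
  | C a => simp [IsScalarTower.algebraMap_apply F S S[X]]
  | add p q hp hq => simp [hp, hq, add_mul, Finset.sum_add_distrib]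
  | mul_X p i hp =>
    simp only [map_mul, MvPolynomial.aeval_X, derivative_mul, hp, MvPolynomial.pderiv_mul, map_add,
      MvPolynomial.pderiv_X]
    fin_cases i <;> simp [Fin.sum_univ_three, Pi.single_apply] <;> ring

lemma totalDegree_pderiv_le (i : Fin 3) (Q : P3 F) :
    (MvPolynomial.pderiv i Q).totalDegree ≤ Q.totalDegree := by
  conv_lhs => rw [← MvPolynomial.support_sum_monomial_coeff Q]
  rw [map_sum]
  refine MvPolynomial.totalDegree_finsetSum_le fun m hm => ?_
  rw [MvPolynomial.pderiv_monomial]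
  refine (MvPolynomial.totalDegree_monomial_le _ _).trans ?_
  refine le_trans ?_ (MvPolynomial.le_totalDegree hm)
  exact Finsupp.degree_mono (tsub_le_self : m - Finsupp.single i 1 ≤ m)

/-- the (numerator of the) curvature of the horizontal sections -/
noncomputable def hess (Q : P3 F) : P3 F :=
  MvPolynomial.pderiv 1 (MvPolynomial.pderiv 1 Q) * MvPolynomial.pderiv 0 Q ^ 2
  - (MvPolynomial.pderiv 1 (MvPolynomial.pderiv 0 Q) + MvPolynomial.pderiv 0 (MvPolynomial.pderiv 1 Q))
      * MvPolynomial.pderiv 1 Q * MvPolynomial.pderiv 0 Q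
  + MvPolynomial.pderiv 0 (MvPolynomial.pderiv 0 Q) * MvPolynomial.pderiv 1 Q ^ 2

lemma totalDegree_hess_le (Q : P3 F) : (hess Q).totalDegree ≤ 3 * Q.totalDegree := by
  have h := fun i => totalDegree_pderiv_le i Q
  have h2 := fun i j => (totalDegree_pderiv_le i (MvPolynomial.pderiv j Q)).trans (h j)
  have hs := fun i => (MvPolynomial.totalDegree_pow (MvPolynomial.pderiv i Q) 2)
  unfold hess
  refine (MvPolynomial.totalDegree_add _ _).trans (max_le ((MvPolynomial.totalDegree_sub _ _).trans (max_le ?_ ?_)) ?_)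
  · refine (MvPolynomial.totalDegree_mul _ _).trans ?_
    have := h2 1 1; have := hs 0; have := h 0; omega
  · refine (MvPolynomial.totalDegree_mul _ _).trans ?_
    refine (add_le_add_left (MvPolynomial.totalDegree_mul _ _) _).trans ?_
    have h3 : (MvPolynomial.pderiv 1 (MvPolynomial.pderiv 0 Q) +
      MvPolynomial.pderiv 0 (MvPolynomial.pderiv 1 Q)).totalDegree ≤ Q.totalDegree :=
      (MvPolynomial.totalDegree_add _ _).trans (max_le (h2 _ _) (h2 _ _))
    have := h 0; have := h 1; omega
  · refine (MvPolynomial.totalDegree_mul _ _).trans ?_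
    have := h2 0 0; have := hs 1; have := h 1; omega

lemma hess_vanish (y a b : F) (Q : P3 F) (h : evL y a b Q = 0) : evL y a b (hess Q) = 0 := by
  have hd : ∀ P : P3 F, derivative (evL y a b P) =
      evL y a b (MvPolynomial.pderiv 0 P) * C a + evL y a b (MvPolynomial.pderiv 1 P) := by
    intro P
    rw [evL, derivative_aeval]
    simp [Fin.sum_univ_three]
  have h1 := hd Q
  rw [h, derivative_zero] at h1
  have h2 := congrArg derivative h1
  rw [derivative_add, derivative_mul, hd, hd, derivative_C, derivative_zero] at h2
  have h3 : evL y a b (MvPolynomial.pderiv 1 Q) = - (evL y a b (MvPolynomial.pderiv 0 Q) * C a) := by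
    linear_combination -h1
  simp only [hess, map_add, map_sub, map_mul, map_pow, h3]
  linear_combination (-(evL y a b (MvPolynomial.pderiv 0 Q)) ^ 2) * h2

lemma taylor_line {K : Type*} [Field K] [Algebra F K] (Q : P3 F)
    (hchar : ∀ n : ℕ, 0 < n → n ≤ Q.totalDegree → (n : K) ≠ 0) (hd : Q ∣ hess Q) (x y z : K)
    (h0 : MvPolynomial.aeval ![z, x, y] Q = 0)
    (hz : MvPolynomial.aeval ![z, x, y] (MvPolynomial.pderiv 0 Q) ≠ 0) :
    ∃ s : K, MvPolynomial.aeval ![C s * X + C z, X + C x, C y] Q = (0 : K[X]) := by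
  classical
  obtain ⟨g, hg⟩ := hd
  set s : K := - MvPolynomial.aeval ![z, x, y] (MvPolynomial.pderiv 1 Q) /
    MvPolynomial.aeval ![z, x, y] (MvPolynomial.pderiv 0 Q) with hs
  refine ⟨s, ?_⟩
  set E : P3 F →ₐ[F] K[X] := MvPolynomial.aeval ![C s * X + C z, X + C x, C y] with hE
  have hev : ∀ P : P3 F, (E P).eval 0 = MvPolynomial.aeval ![z, x, y] P := by
    intro P
    have : ((Polynomial.aeval (0 : K)).restrictScalars F).comp E = MvPolynomial.aeval ![z, x, y] :=
      MvPolynomial.algHom_ext (fun i => by fin_cases i <;> simp [hE])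
    rw [← this]
    simp [Polynomial.coe_aeval_eq_eval]
  have hD : ∀ P : P3 F, derivative (E P) =
      E (MvPolynomial.pderiv 0 P) * C s + E (MvPolynomial.pderiv 1 P) := by
    intro P
    rw [hE, derivative_aeval]
    simp [Fin.sum_univ_three]
  have hdeg : (E Q).natDegree ≤ Q.totalDegree := by
    refine natDegree_aeval_le _ _ ?_
    intro i; fin_cases i
    · simpa using natDegree_linear_le (a := s) (b := z)
    · simp
    · simp
  have hH := congrArg E hg
  have hD1 := hD Q
  have hD2 : derivative (derivative (E Q)) = (E (MvPolynomial.pderiv 0 (MvPolynomial.pderiv 0 Q)) * C s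
      + E (MvPolynomial.pderiv 1 (MvPolynomial.pderiv 0 Q))) * C s
      + (E (MvPolynomial.pderiv 0 (MvPolynomial.pderiv 1 Q)) * C s
      + E (MvPolynomial.pderiv 1 (MvPolynomial.pderiv 1 Q))) := by
    rw [hD1, derivative_add, derivative_mul, hD, hD, derivative_C, mul_zero, add_zero]
  simp only [hess, map_add, map_sub, map_mul, map_pow] at hH
  have hq1 : E (MvPolynomial.pderiv 1 Q) = derivative (E Q) - E (MvPolynomial.pderiv 0 Q) * C s := by
    rw [hD1]; ring
  obtain ⟨T, hT⟩ : ∃ T, E (MvPolynomial.pderiv 0 Q) ^ 2 * derivative (derivative (E Q)) =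
      E Q * E g + derivative (E Q) * T := by
    rw [hq1] at hH
    rw [hD2, ← hH]
    refine ⟨(E (MvPolynomial.pderiv 1 (MvPolynomial.pderiv 0 Q)) +
      E (MvPolynomial.pderiv 0 (MvPolynomial.pderiv 1 Q))) * E (MvPolynomial.pderiv 0 Q)
      + 2 * E (MvPolynomial.pderiv 0 (MvPolynomial.pderiv 0 Q)) * E (MvPolynomial.pderiv 0 Q) * C s
      - E (MvPolynomial.pderiv 0 (MvPolynomial.pderiv 0 Q)) * derivative (E Q), ?_⟩
    ring
  have hφ0 : (E Q).eval 0 = 0 := by rw [hev, h0]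
  have hφ1 : (derivative (E Q)).eval 0 = 0 := by
    rw [hD1, eval_add, eval_mul, hev, hev, eval_C, hs]
    field_simp; ring
  have hqz : (E (MvPolynomial.pderiv 0 Q)).eval 0 ≠ 0 := by rw [hev]; exact hz
  generalize E (MvPolynomial.pderiv 0 Q) = QZ at *
  clear hH hD2 hD1 hq1
  by_contra hne
  obtain ⟨ψ, hψ, hnd⟩ := exists_eq_pow_rootMultiplicity_mul_and_not_dvd (E Q) hne 0
  have hle : (E Q).rootMultiplicity 0 ≤ Q.totalDegree :=
    by
    refine le_trans ?_ hdeg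
    refine le_trans ?_ (card_roots' (E Q))
    rw [← count_roots]; exact Multiset.count_le_card _ _
  rw [C_0, sub_zero] at hψ hnd
  have hψ0 : ψ.eval 0 ≠ 0 := by
    rw [X_dvd_iff, coeff_zero_eq_eval_zero] at hnd; exact hnd
  generalize (E Q).rootMultiplicity 0 = r at *
  generalize E Q = φ at *
  subst hψ
  rcases r with _ | _ | k
  · simp at hφ0; exact hψ0 hφ0
  · simp at hφ1; exact hψ0 hφ1
  · have e1 : derivative (X ^ (k + 2) * ψ) = X ^ (k + 1) * (C ((k + 2 : ℕ) : K) * ψ + X * derivative ψ) := by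
      rw [derivative_mul, derivative_X_pow]
      simp only [show k + 2 - 1 = k + 1 by omega]
      ring
    have e2 : derivative (X ^ (k + 1) * (C ((k + 2 : ℕ) : K) * ψ + X * derivative ψ)) =
        X ^ k * (C ((k + 1 : ℕ) : K) * (C ((k + 2 : ℕ) : K) * ψ + X * derivative ψ)
          + X * derivative (C ((k + 2 : ℕ) : K) * ψ + X * derivative ψ)) := by
      rw [derivative_mul, derivative_X_pow]
      simp only [Nat.add_sub_cancel]
      ring
    have e3 : X ^ k * (QZ ^ 2 * (C ((k + 1 : ℕ) : K) * (C ((k + 2 : ℕ) : K) * ψ + X * derivative ψ)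
          + X * derivative (C ((k + 2 : ℕ) : K) * ψ + X * derivative ψ))) =
        X ^ k * (X * (X * ψ * E g + (C ((k + 2 : ℕ) : K) * ψ + X * derivative ψ) * T)) := by
      have := hT
      rw [show k + 1 + 1 = k + 2 from rfl, e1, e2] at this
      linear_combination this
    have e4 := mul_left_cancel₀ (pow_ne_zero k (X_ne_zero (R := K))) e3
    have e5 := congrArg (eval 0) e4
    simp at e5
    rcases e5 with h | h | h | h
    · exact hqz h
    · exact hchar (k + 1) (by omega) (by omega) (by exact_mod_cast h)
    · exact hchar (k + 2) (by omega) (by omega) (by exact_mod_cast h)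
    · exact hψ0 h

end RQ

namespace RQ
open Polynomial
variable {F : Type*} [Field F]

lemma theta_injective : Function.Injective
    (MvPolynomial.aeval ![X, C (algebraMap F[X] (FractionRing F[X]) X)] :
      MvPolynomial (Fin 2) F →ₐ[F] (FractionRing F[X])[X]) := by
  let ψ : F[X][X] →+* MvPolynomial (Fin 2) F :=
      eval₂RingHom (Polynomial.aeval (MvPolynomial.X 1)).toRingHom (MvPolynomial.X 0)
  have h1 : ψ.comp (MvPolynomial.aeval ![X, C X] : MvPolynomial (Fin 2) F →ₐ[F] F[X][X]).toRingHom
        = RingHom.id _ := by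
    apply MvPolynomial.ringHom_ext
    · intro r
      simp [ψ, IsScalarTower.algebraMap_apply F F[X] F[X][X]]
    · intro i; fin_cases i <;> simp [ψ]
  have h2 : Function.Injective (MvPolynomial.aeval ![X, C X] : MvPolynomial (Fin 2) F →ₐ[F] F[X][X]) := by
    intro a b hab
    have ha := DFunLike.congr_fun h1 a
    have hb := DFunLike.congr_fun h1 b
    rw [RingHom.comp_apply] at ha hb
    change ψ (MvPolynomial.aeval ![X, C X] a) = a at ha
    change ψ (MvPolynomial.aeval ![X, C X] b) = b at hb
    rw [← ha, ← hb, hab]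
  have h3 : (MvPolynomial.aeval ![X, C (algebraMap F[X] (FractionRing F[X]) X)] :
      MvPolynomial (Fin 2) F →ₐ[F] (FractionRing F[X])[X]) =
      ((Polynomial.mapAlgHom (IsScalarTower.toAlgHom F F[X] (FractionRing F[X])))).comp
      (MvPolynomial.aeval ![X, C X] : MvPolynomial (Fin 2) F →ₐ[F] F[X][X]) := by
    apply MvPolynomial.algHom_ext
    intro i; fin_cases i <;> simp
  rw [h3]
  have h4 : Function.Injective (Polynomial.mapAlgHom (IsScalarTower.toAlgHom F F[X] (FractionRing F[X]))) := by
    have := Polynomial.map_injective (algebraMap F[X] (FractionRing F[X])) (IsFractionRing.injective _ _)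
    exact this
  exact h4.comp h2

/-- bilinear graph polynomial -/
noncomputable def bil (α β γ δ : F) : P3 F :=
  MvPolynomial.X 0 - (MvPolynomial.C α + MvPolynomial.C β * MvPolynomial.X 1
    + MvPolynomial.C γ * MvPolynomial.X 2 + MvPolynomial.C δ * MvPolynomial.X 1 * MvPolynomial.X 2)

lemma natDegree_finSucc_le (Q : P3 F) : (MvPolynomial.finSuccEquiv F 2 Q).natDegree ≤ Q.totalDegree := by
  by_cases h0 : Q = 0
  · simp [h0]
  · have := MvPolynomial.totalDegree_coeff_finSuccEquiv_add_le Q (MvPolynomial.finSuccEquiv F 2 Q).natDegree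
      (by
        rw [coeff_natDegree, Ne, leadingCoeff_eq_zero]
        simpa using h0)
    exact le_trans (Nat.le_add_left _ _) this

lemma exists_bil (Q : P3 F) (hQ : Irreducible Q)
    (hchar : ∀ n : ℕ, 0 < n → n ≤ Q.totalDegree → (n : F) ≠ 0) (hd : Q ∣ hess Q)
    {κ : Type*} (M : Finset κ) (x c e : κ → F) (hx : Set.InjOn x M)
    (h0 : ∀ j ∈ M, evM (x j) (c j) (e j) Q = 0)
    (h1 : ∀ j ∈ M, evM (x j) (c j) (e j) (MvPolynomial.pderiv 0 Q) ≠ 0)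
    (hM : Q.totalDegree < M.card) : ∃ α β γ δ : F, Q ∣ bil α β γ δ := by
  classical
  set K := FractionRing F[X] with hK
  set ι : F[X] →ₐ[F] K := IsScalarTower.toAlgHom F F[X] K with hι
  have hinj : Function.Injective ι := IsFractionRing.injective F[X] K
  have hιC : ∀ r : F, ι (C r) = algebraMap F K r := fun r => by
    simpa [Polynomial.C_eq_algebraMap] using ι.commutes r
  let z : κ → K := fun j => ι (C (c j) * X + C (e j))
  let xx : κ → K := fun j => algebraMap F K (x j)
  let Y : K := ι X
  have hev : ∀ j (P : P3 F), MvPolynomial.aeval ![z j, xx j, Y] P = ι (evM (x j) (c j) (e j) P) := by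
    intro j P
    have : MvPolynomial.aeval ![z j, xx j, Y] = ι.comp (evM (x j) (c j) (e j)) :=
      MvPolynomial.algHom_ext (fun i => by fin_cases i <;> simp [evM, z, xx, Y, hιC])
    rw [this]; rfl
  have hline : ∀ j ∈ M, ∃ s : K,
      MvPolynomial.aeval ![C s * (X - C (xx j)) + C (z j), X, C Y] Q = (0 : K[X]) := by
    intro j hj
    obtain ⟨s, hs⟩ := taylor_line (K := K) Q (by
        intro n hn hn'
        have := hchar n hn hn'
        have h2 := (map_ne_zero_iff (algebraMap F K) (algebraMap F K).injective).2 this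
        rwa [map_natCast] at h2) hd (xx j) Y (z j)
        (by rw [hev, h0 j hj, map_zero])
        (by rw [hev]; exact (map_ne_zero_iff _ hinj).2 (h1 j hj))
    refine ⟨s, ?_⟩
    have : MvPolynomial.aeval ![C s * (X - C (xx j)) + C (z j), X, C Y] =
        ((Polynomial.aeval (X - C (xx j) : K[X])).restrictScalars F).comp
        (MvPolynomial.aeval ![C s * X + C (z j), X + C (xx j), C Y] : P3 F →ₐ[F] K[X]) :=
      MvPolynomial.algHom_ext (fun i => by fin_cases i <;> simp [← Polynomial.C_eq_algebraMap])
    rw [this, AlgHom.comp_apply, hs, map_zero]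
  choose! s hs using hline
  let θ : MvPolynomial (Fin 2) F →ₐ[F] K[X] := MvPolynomial.aeval ![X, C Y]
  have hθ : Function.Injective θ := theta_injective
  let q : K[X][X] := (MvPolynomial.finSuccEquiv F 2 Q).map θ.toRingHom
  have hq0 : q ≠ 0 := by
    rw [Ne, Polynomial.map_eq_zero_iff hθ]
    simpa using hQ.ne_zero
  have hroot : ∀ r : K[X], q.eval r = MvPolynomial.aeval ![r, X, C Y] Q := by
    intro r
    rw [aeval_eq_eval₂, eval_map]
    have : (fun i : Fin 2 => ![r, X, C Y] i.succ) = ![X, C Y] := by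
      funext j; fin_cases j <;> rfl
    rw [this]; rfl
  let ρ : κ → K[X] := fun j => C (s j) * (X - C (xx j)) + C (z j)
  have hcard : q.roots.toFinset.card < M.card := by
    refine lt_of_le_of_lt ?_ hM
    refine (Multiset.toFinset_card_le _).trans ((card_roots' q).trans ?_)
    exact (natDegree_map_le).trans (natDegree_finSucc_le Q)
  obtain ⟨j, hj, j', hj', hne, hjj⟩ := Finset.exists_ne_map_eq_of_card_lt_of_maps_to hcard
    (f := ρ) (by
      intro j hj
      have hj := Finset.mem_coe.1 hj
      simp only [Finset.mem_coe, Multiset.mem_toFinset, mem_roots hq0, IsRoot.def]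
      rw [hroot]; exact hs j hj)
  have hxne : x j' - x j ≠ 0 := fun h => hne (hx hj hj' (sub_eq_zero.1 h).symm)
  have hxxne : xx j' - xx j ≠ 0 := by
    simp only [xx, ← map_sub]
    exact (map_ne_zero_iff (algebraMap F K) (algebraMap F K).injective).2 hxne
  have hsl : s j * (xx j' - xx j) = z j' - z j := by
    have := congrArg (eval (xx j')) hjj
    simp [ρ] at this
    linear_combination this
  set w : F := (x j' - x j)⁻¹ with hw
  have hww : algebraMap F K w * (xx j' - xx j) = 1 := by
    simp only [xx, ← map_sub, ← map_mul, hw]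
    rw [inv_mul_cancel₀ hxne, map_one]
  have hsj : s j = algebraMap F K w * (z j' - z j) := by
    linear_combination (-s j) * hww + algebraMap F K w * hsl
  set δ := w * (c j' - c j) with hδ
  set β := w * (e j' - e j) with hβ
  set γ := c j - δ * x j with hγ
  set α := e j - β * x j with hα
  refine ⟨α, β, γ, δ, ?_⟩
  let B : MvPolynomial (Fin 2) F := MvPolynomial.C α + MvPolynomial.C β * MvPolynomial.X 0
    + MvPolynomial.C γ * MvPolynomial.X 1 + MvPolynomial.C δ * MvPolynomial.X 0 * MvPolynomial.X 1
  have hθB : θ B = ρ j := by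
    have hC : ∀ r : F, algebraMap F K[X] r = C (algebraMap F K r) := fun r =>
      IsScalarTower.algebraMap_apply F K K[X] r
    simp only [B, ρ, hsj, z, xx, θ, map_add, map_mul, MvPolynomial.aeval_X, MvPolynomial.aeval_C,
      hC, hα, hγ, hβ, hδ, map_sub, hιC]
    simp [Y]
    ring
  have hroot2 : (MvPolynomial.finSuccEquiv F 2 Q).eval B = 0 := by
    apply hθ
    rw [map_zero]
    have h2 := hroot (ρ j)
    rw [hs j hj, ← hθB] at h2
    change eval (θ.toRingHom B) (Polynomial.map θ.toRingHom _) = 0 at h2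
    rw [eval_map_apply] at h2
    exact h2
  have hdv : MvPolynomial.finSuccEquiv F 2 (bil α β γ δ) ∣ MvPolynomial.finSuccEquiv F 2 Q := by
    have : MvPolynomial.finSuccEquiv F 2 (bil α β γ δ) = X - C B := by
      have e1 : (MvPolynomial.finSuccEquiv F 2) (MvPolynomial.X 1) = C (MvPolynomial.X 0) :=
        MvPolynomial.finSuccEquiv_X_succ (j := (0 : Fin 2))
      have e2 : (MvPolynomial.finSuccEquiv F 2) (MvPolynomial.X 2) = C (MvPolynomial.X 1) :=
        MvPolynomial.finSuccEquiv_X_succ (j := (1 : Fin 2))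
      have e3 : ∀ r : F, (MvPolynomial.finSuccEquiv F 2) (MvPolynomial.C r) = C (MvPolynomial.C r) := by
        intro r; simp [MvPolynomial.finSuccEquiv_apply]
      simp only [bil, B, map_sub, map_add, map_mul, e1, e2, e3, MvPolynomial.finSuccEquiv_X_zero]
    rw [this, dvd_iff_isRoot]
    exact hroot2
  rw [map_dvd_iff] at hdv
  obtain ⟨u, hu⟩ := hdv
  rcases hQ.isUnit_or_isUnit hu with h | h
  · exfalso
    have := h.map (evL 0 0 α)
    rw [bil] at this
    simp [evL, MvPolynomial.algHom_C] at this
    exact Polynomial.not_isUnit_X this.2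
  · exact (Associated.dvd (a := Q) ⟨h.unit⁻¹, by rw [hu]; simp [mul_assoc]⟩)

end RQ

namespace RQ
open Polynomial
variable {F : Type*} [Field F]

/-- two families of lines -/
structure Cfg (F ι κ : Type*) where
  y : ι → F
  a : ι → F
  b : ι → F
  x : κ → F
  c : κ → F
  e : κ → F

variable {ι κ : Type*} (G : Cfg F ι κ)

/-- incidence indicator -/
noncomputable def Cfg.w (i : ι) (j : κ) : ℕ :=
  open Classical in if G.a i * G.x j + G.b i = G.c j * G.y i + G.e j then 1 else 0

lemma Cfg.w_le (i : ι) (j : κ) : G.w i j ≤ 1 := by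
  unfold Cfg.w; split_ifs <;> simp

/-- number of incidences -/
noncomputable def Cfg.I (L : Finset ι) (M : Finset κ) : ℕ := ∑ i ∈ L, ∑ j ∈ M, G.w i j

/-- restriction to the i-th line of the first family -/
noncomputable def Cfg.rL (i : ι) : P3 F →ₐ[F] F[X] := evL (G.y i) (G.a i) (G.b i)
/-- restriction to the j-th line of the second family -/
noncomputable def Cfg.rM (j : κ) : P3 F →ₐ[F] F[X] := evM (G.x j) (G.c j) (G.e j)

/-- few lines of the first family lie in a bilinear graph -/
def Cfg.kL (L : Finset ι) (k : ℕ) : Prop :=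
  ∀ α β γ δ : F, ∀ S ⊆ L, (∀ i ∈ S, G.a i = β + δ * G.y i ∧ G.b i = α + γ * G.y i) → S.card ≤ k
/-- few lines of the second family lie in a bilinear graph -/
def Cfg.kM (M : Finset κ) (k : ℕ) : Prop :=
  ∀ α β γ δ : F, ∀ S ⊆ M, (∀ j ∈ S, G.c j = γ + δ * G.x j ∧ G.e j = α + β * G.x j) → S.card ≤ k

lemma Cfg.degL (Q : P3 F) (i : ι) (M : Finset κ) (hx : Set.InjOn G.x M)
    (hM : ∀ j ∈ M, G.rM j Q = 0) (h : G.rL i Q ≠ 0) : ∑ j ∈ M, G.w i j ≤ Q.totalDegree := by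
  classical
  unfold Cfg.w
  rw [← Finset.sum_filter, Finset.sum_const, smul_eq_mul, mul_one]
  set S := M.filter (fun j => G.a i * G.x j + G.b i = G.c j * G.y i + G.e j) with hS
  have hc : (S.image G.x).card = S.card :=
    Finset.card_image_of_injOn (hx.mono (Finset.coe_subset.2 (Finset.filter_subset _ _)))
  rw [← hc]
  refine le_trans ?_ (natDegree_evL_le (G.y i) (G.a i) (G.b i) Q)
  refine (Finset.card_le_card (t := (G.rL i Q).roots.toFinset) ?_).trans
    ((Multiset.toFinset_card_le _).trans (card_roots' _))
  intro t ht
  obtain ⟨j, hj, rfl⟩ := Finset.mem_image.1 ht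
  rw [hS, Finset.mem_filter] at hj
  rw [Multiset.mem_toFinset, mem_roots h, IsRoot.def, Cfg.rL, eval_evL, hj.2]
  have := congrArg (eval (G.y i)) (hM j hj.1)
  rwa [Cfg.rM, eval_evM, eval_zero] at this

lemma Cfg.degM (Q : P3 F) (j : κ) (L : Finset ι) (hy : Set.InjOn G.y L)
    (hL : ∀ i ∈ L, G.rL i Q = 0) (h : G.rM j Q ≠ 0) : ∑ i ∈ L, G.w i j ≤ Q.totalDegree := by
  classical
  unfold Cfg.w
  rw [← Finset.sum_filter, Finset.sum_const, smul_eq_mul, mul_one]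
  set S := L.filter (fun i => G.a i * G.x j + G.b i = G.c j * G.y i + G.e j) with hS
  have hc : (S.image G.y).card = S.card :=
    Finset.card_image_of_injOn (hy.mono (Finset.coe_subset.2 (Finset.filter_subset _ _)))
  rw [← hc]
  refine le_trans ?_ (natDegree_evM_le (G.x j) (G.c j) (G.e j) Q)
  refine (Finset.card_le_card (t := (G.rM j Q).roots.toFinset) ?_).trans
    ((Multiset.toFinset_card_le _).trans (card_roots' _))
  intro t ht
  obtain ⟨i, hi, rfl⟩ := Finset.mem_image.1 ht
  rw [hS, Finset.mem_filter] at hi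
  rw [Multiset.mem_toFinset, mem_roots h, IsRoot.def, Cfg.rM, eval_evM, ← hi.2]
  have := congrArg (eval (G.x j)) (hL i hi.1)
  rwa [Cfg.rL, eval_evL, eval_zero] at this

lemma Cfg.I_comm (L : Finset ι) (M : Finset κ) : G.I L M = ∑ j ∈ M, ∑ i ∈ L, G.w i j :=
  Finset.sum_comm

lemma Cfg.I_le_L (L : Finset ι) (M : Finset κ) (d : ℕ) (h : ∀ i ∈ L, ∑ j ∈ M, G.w i j ≤ d) :
    G.I L M ≤ d * L.card := by
  rw [mul_comm]; exact Finset.sum_le_card_nsmul L _ d h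

lemma Cfg.I_le_M (L : Finset ι) (M : Finset κ) (d : ℕ) (h : ∀ j ∈ M, ∑ i ∈ L, G.w i j ≤ d) :
    G.I L M ≤ d * M.card := by
  rw [G.I_comm, mul_comm]; exact Finset.sum_le_card_nsmul M _ d h

lemma Cfg.sum_le_card (i : ι) (M : Finset κ) : ∑ j ∈ M, G.w i j ≤ M.card := by
  simpa using Finset.sum_le_card_nsmul M _ 1 (fun j _ => G.w_le i j)

lemma Cfg.I_le_mul (L : Finset ι) (M : Finset κ) : G.I L M ≤ M.card * L.card :=
  G.I_le_L L M _ fun i _ => G.sum_le_card i M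

lemma Cfg.I_mono {L L' : Finset ι} {M M' : Finset κ} (hL : L ⊆ L') (hM : M ⊆ M') :
    G.I L M ≤ G.I L' M' :=
  (Finset.sum_le_sum fun _ _ => Finset.sum_le_sum_of_subset hM).trans (Finset.sum_le_sum_of_subset hL)

lemma Cfg.I_cover_L [DecidableEq ι] (L1 L2 : Finset ι) (M : Finset κ) :
    G.I (L1 ∪ L2) M ≤ G.I L1 M + G.I L2 M := by
  unfold Cfg.I
  rw [← Finset.sum_union_inter]; exact Nat.le_add_right _ _

lemma Cfg.I_cover_M [DecidableEq κ] (L : Finset ι) (M1 M2 : Finset κ) :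
    G.I L (M1 ∪ M2) ≤ G.I L M1 + G.I L M2 := by
  rw [I_comm, I_comm, I_comm]
  rw [← Finset.sum_union_inter]; exact Nat.le_add_right _ _

lemma rL_bil (i : ι) (α β γ δ : F) (h : G.rL i (bil α β γ δ) = 0) :
    G.a i = β + δ * G.y i ∧ G.b i = α + γ * G.y i := by
  unfold Cfg.rL at h
  have h0 := congrArg (eval 0) h
  have h1 := congrArg (eval 1) h
  rw [eval_evL] at h0 h1
  simp [bil] at h0 h1
  constructor
  · linear_combination h1 - h0
  · linear_combination h0

lemma rM_bil (j : κ) (α β γ δ : F) (h : G.rM j (bil α β γ δ) = 0) :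
    G.c j = γ + δ * G.x j ∧ G.e j = α + β * G.x j := by
  unfold Cfg.rM at h
  have h0 := congrArg (eval 0) h
  have h1 := congrArg (eval 1) h
  rw [eval_evM] at h0 h1
  simp [bil] at h0 h1
  constructor
  · linear_combination h1 - h0
  · linear_combination h0

lemma finSucc_pderiv (Q : P3 F) : MvPolynomial.finSuccEquiv F 2 (MvPolynomial.pderiv 0 Q) =
    derivative (MvPolynomial.finSuccEquiv F 2 Q) := by
  induction Q using MvPolynomial.induction_on with
  | C a => simp [MvPolynomial.finSuccEquiv_apply]
  | add p q hp hq => simp [hp, hq]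
  | mul_X p i hp =>
    refine Fin.cases ?_ (fun i => ?_) i
    · simp [MvPolynomial.pderiv_mul, hp, MvPolynomial.finSuccEquiv_X_zero, derivative_mul]; ring
    · simp [MvPolynomial.pderiv_mul, hp, MvPolynomial.finSuccEquiv_X_succ, derivative_mul, Fin.succ_ne_zero]; ring

lemma not_dvd_pderiv (Q : P3 F) 
    (hchar : ∀ n : ℕ, 0 < n → n ≤ Q.totalDegree → (n : F) ≠ 0)
    (hz : (MvPolynomial.finSuccEquiv F 2 Q).natDegree ≠ 0) : ¬ Q ∣ MvPolynomial.pderiv 0 Q := by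
  intro h
  rw [← map_dvd_iff (MvPolynomial.finSuccEquiv F 2), finSucc_pderiv] at h
  set q := MvPolynomial.finSuccEquiv F 2 Q with hq
  have hlt := natDegree_derivative_lt hz
  have h0 := eq_zero_of_dvd_of_natDegree_lt h hlt
  have := congrArg (fun r => r.coeff (q.natDegree - 1)) h0
  simp only [coeff_derivative, coeff_zero] at this
  have e : q.natDegree - 1 + 1 = q.natDegree := by omega
  rw [e, coeff_natDegree] at this
  have h2 : ((q.natDegree - 1 : ℕ) : MvPolynomial (Fin 2) F) + 1 = MvPolynomial.C (q.natDegree : F) := by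
    rw [map_natCast]
    exact_mod_cast congrArg (Nat.cast : ℕ → MvPolynomial (Fin 2) F) e
  rw [h2] at this
  rcases mul_eq_zero.1 this with h3 | h3
  · rw [leadingCoeff_eq_zero] at h3
    apply hz; rw [h3]; simp
  · rw [MvPolynomial.C_eq_zero] at h3
    exact hchar _ (Nat.pos_of_ne_zero hz) (natDegree_finSucc_le Q) h3

lemma zdeg_zero (Q : P3 F) (hQ : Q ≠ 0) (hz : (MvPolynomial.finSuccEquiv F 2 Q).natDegree = 0)
    (L : Finset ι) (hy : Set.InjOn G.y L) (h : ∀ i ∈ L, G.rL i Q = 0) :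
    L.card ≤ Q.totalDegree := by
  have hC := eq_C_of_natDegree_eq_zero hz
  set R := (MvPolynomial.finSuccEquiv F 2 Q).coeff 0 with hR
  have hR0 : R ≠ 0 := by
    intro h0
    rw [h0, C_0] at hC
    exact hQ (by simpa using hC)
  have hdeg := MvPolynomial.totalDegree_coeff_finSuccEquiv_add_le Q 0 hR0
  refine (card_le_of_two R hR0 L G.y hy ?_).trans (by simpa using hdeg)
  intro i hi
  have h1 := h i hi
  rw [Cfg.rL, evL, aeval_eq_eval₂, hC, eval₂_C] at h1
  have : (fun k : Fin 2 => (![C (G.a i) * X + C (G.b i), X, C (G.y i)] : Fin 3 → F[X]) k.succ)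
      = ![X, C (G.y i)] := by
    funext j; fin_cases j <;> rfl
  rw [this] at h1
  exact h1

lemma one_le_totalDegree (Q : P3 F) (hQ : Irreducible Q) : 1 ≤ Q.totalDegree := by
  by_contra h
  have h0 : Q.totalDegree = 0 := by omega
  rw [MvPolynomial.totalDegree_eq_zero_iff_eq_C] at h0
  have hne : MvPolynomial.coeff 0 Q ≠ 0 := by
    intro h1
    rw [h1, map_zero] at h0
    exact hQ.ne_zero h0
  apply hQ.not_isUnit
  rw [h0]
  exact (isUnit_iff_ne_zero.2 hne).map MvPolynomial.C

lemma irreducible_case (Q : P3 F) (hQ : Irreducible Q)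
    (hchar : ∀ n : ℕ, 0 < n → n ≤ Q.totalDegree → (n : F) ≠ 0)
    (L : Finset ι) (M : Finset κ) (hy : Set.InjOn G.y L) (hx : Set.InjOn G.x M)
    (k k' : ℕ) (hk : G.kL L k) (hk' : G.kM M k')
    (hL : ∀ i ∈ L, G.rL i Q = 0) (hM : ∀ j ∈ M, G.rM j Q = 0) :
    ∃ L' ⊆ L, L'.card ≤ 6 * Q.totalDegree ^ 2 ∧ ∀ L'' ⊆ L, Disjoint L'' L' →
      G.I L'' M ≤ 2 * Q.totalDegree * L.card + k * k' := by
  classical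
  have h1 := one_le_totalDegree Q hQ
  set D := Q.totalDegree with hD
  have triv : L.card ≤ 6 * D ^ 2 → ∃ L' ⊆ L, L'.card ≤ 6 * D ^ 2 ∧ ∀ L'' ⊆ L, Disjoint L'' L' →
      G.I L'' M ≤ 2 * D * L.card + k * k' := by
    intro h
    refine ⟨L, subset_rfl, h, ?_⟩
    intro L'' hs hd
    have : L'' = ∅ := by
      rw [← Finset.disjoint_self_iff_empty]
      exact hd.mono_right hs
    rw [this]; simp [Cfg.I]
  by_cases hz : (MvPolynomial.finSuccEquiv F 2 Q).natDegree = 0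
  · apply triv
    have := zdeg_zero G Q hQ.ne_zero hz L hy hL
    nlinarith
  by_cases hd : Q ∣ hess Q
  swap
  · apply triv
    have := bezout Q (hess Q) hQ hz hd L G.y G.a G.b hy hL (fun i hi => hess_vanish _ _ _ _ (hL i hi))
    have h3 := totalDegree_hess_le Q
    calc L.card ≤ 2 * D * (hess Q).totalDegree := this
      _ ≤ 2 * D * (3 * D) := Nat.mul_le_mul_left _ h3
      _ = 6 * D ^ 2 := by ring
  set Qz := MvPolynomial.pderiv 0 Q with hQz
  have hQzd : Qz.totalDegree ≤ D := totalDegree_pderiv_le 0 Q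
  set L' := L.filter (fun i => G.rL i Qz = 0) with hL'
  refine ⟨L', Finset.filter_subset _ _, ?_, ?_⟩
  · have := bezout Q Qz hQ hz (not_dvd_pderiv Q hchar hz) L' G.y G.a G.b
      (hy.mono (Finset.coe_subset.2 (Finset.filter_subset _ _))) (fun i hi => hL i (Finset.mem_filter.1 hi).1)
      (fun i hi => (Finset.mem_filter.1 hi).2)
    calc L'.card ≤ 2 * D * Qz.totalDegree := this
      _ ≤ 2 * D * D := Nat.mul_le_mul_left _ hQzd
      _ ≤ 6 * D ^ 2 := by nlinarith
  intro L'' hs hdis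
  set Ms := M.filter (fun j => G.rM j Qz = 0) with hMs
  set Mn := M.filter (fun j => ¬ G.rM j Qz = 0) with hMn
  have hcov : G.I L'' M ≤ G.I L'' Ms + G.I L'' Mn := by
    rw [← Finset.filter_union_filter_not_eq (fun j => G.rM j Qz = 0) M]
    exact G.I_cover_M _ _ _
  have hIs : G.I L'' Ms ≤ D * L.card := by
    refine (G.I_le_L L'' Ms D ?_).trans (Nat.mul_le_mul_left _ (Finset.card_le_card hs))
    intro i hi
    refine (G.degL Qz i Ms (hx.mono (Finset.coe_subset.2 (Finset.filter_subset _ _))) (fun j hj => (Finset.mem_filter.1 hj).2) ?_).trans hQzd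
    intro h0
    exact Finset.disjoint_left.1 hdis hi (Finset.mem_filter.2 ⟨hs hi, h0⟩)
  have hIn : G.I L'' Mn ≤ D * L.card + k * k' := by
    by_cases hc : Mn.card ≤ D
    · refine (G.I_le_mul _ _).trans ?_
      exact (Nat.mul_le_mul hc (Finset.card_le_card hs)).trans (Nat.le_add_right _ _)
    · obtain ⟨α, β, γ, δ, hb⟩ := exists_bil Q hQ hchar hd Mn G.x G.c G.e (hx.mono (Finset.coe_subset.2 (Finset.filter_subset _ _)))
        (fun j hj => hM j (Finset.mem_filter.1 hj).1) (fun j hj => (Finset.mem_filter.1 hj).2)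
        (not_le.1 hc)
      have hLk : L.card ≤ k := hk α β γ δ L subset_rfl (fun i hi => rL_bil G i _ _ _ _ (by
        obtain ⟨g, hg⟩ := hb
        rw [hg, map_mul, hL i hi, zero_mul]))
      have hMk : Mn.card ≤ k' := hk' α β γ δ Mn (Finset.filter_subset _ _) (fun j hj => rM_bil G j _ _ _ _ (by
        obtain ⟨g, hg⟩ := hb
        rw [hg, map_mul, hM j (Finset.mem_filter.1 hj).1, zero_mul]))
      refine (G.I_le_mul _ _).trans ?_
      have := Nat.mul_le_mul hMk ((Finset.card_le_card hs).trans hLk)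
      nlinarith
  nlinarith

end RQ

namespace RQ
open Polynomial
variable {F : Type*} [Field F]
variable {ι κ : Type*} (G : Cfg F ι κ)

lemma Cfg.kL_mono {L L' : Finset ι} {k : ℕ} (h : G.kL L k) (hs : L' ⊆ L) : G.kL L' k :=
  fun α β γ δ S hS => h α β γ δ S (hS.trans hs)

lemma Cfg.kM_mono {M M' : Finset κ} {k : ℕ} (h : G.kM M k) (hs : M' ⊆ M) : G.kM M' k :=
  fun α β γ δ S hS => h α β γ δ S (hS.trans hs)

lemma factor_case (k k' : ℕ) (Q : P3 F) : Q ≠ 0 → 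
    (∀ n : ℕ, 0 < n → n ≤ Q.totalDegree → (n : F) ≠ 0) →
    ∀ (L : Finset ι) (M : Finset κ), Set.InjOn G.y L → Set.InjOn G.x M →
    G.kL L k → G.kM M k' →
    (∀ i ∈ L, G.rL i Q = 0) → (∀ j ∈ M, G.rM j Q = 0) →
    ∃ L' ⊆ L, L'.card ≤ 6 * Q.totalDegree ^ 2 ∧ ∀ L'' ⊆ L, Disjoint L'' L' →
      G.I L'' M ≤ 3 * Q.totalDegree * (L.card + M.card) + Q.totalDegree * (k * k') := by
  classical
  induction Q using WfDvdMonoid.induction_on_irreducible with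
  | zero => intro h; exact absurd rfl h
  | unit u hu =>
    intro _ _ L M _ _ _ _ hL _
    refine ⟨∅, Finset.empty_subset _, by simp, ?_⟩
    have : L = ∅ := by
      rw [Finset.eq_empty_iff_forall_notMem]
      intro i hi
      exact (hu.map (G.rL i)).ne_zero (hL i hi)
    intro L'' hs _
    rw [this, Finset.subset_empty] at hs
    rw [hs]; simp [Cfg.I]
  | mul a q ha hq ih =>
    intro _ hchar L M hy hx hk hk' hL hM
    rw [MvPolynomial.totalDegree_mul_of_isDomain hq.ne_zero ha] at hchar ⊢
    have h1 := one_le_totalDegree q hq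
    set d := q.totalDegree with hd
    set D := a.totalDegree with hD
    set L1 := L.filter (fun i => G.rL i q = 0) with hL1
    set L2 := L.filter (fun i => ¬ G.rL i q = 0) with hL2
    set M1 := M.filter (fun j => G.rM j q = 0) with hM1
    set M2 := M.filter (fun j => ¬ G.rM j q = 0) with hM2
    have sL1 : L1 ⊆ L := Finset.filter_subset _ _
    have sL2 : L2 ⊆ L := Finset.filter_subset _ _
    have sM1 : M1 ⊆ M := Finset.filter_subset _ _
    have sM2 : M2 ⊆ M := Finset.filter_subset _ _
    have cL : L1.card + L2.card = L.card := Finset.card_filter_add_card_filter_not _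
    have cM : M1.card + M2.card = M.card := Finset.card_filter_add_card_filter_not _
    have uL : L1 ∪ L2 = L := Finset.filter_union_filter_not_eq _ L
    have uM : M1 ∪ M2 = M := Finset.filter_union_filter_not_eq _ M
    obtain ⟨L1', s1, c1, i1⟩ := irreducible_case G q hq (fun n hn hn' => hchar n hn (by omega)) L1 M1
      (hy.mono (Finset.coe_subset.2 sL1)) (hx.mono (Finset.coe_subset.2 sM1)) k k'
      (G.kL_mono hk sL1) (G.kM_mono hk' sM1) (fun i hi => (Finset.mem_filter.1 hi).2)
      (fun i hi => (Finset.mem_filter.1 hi).2)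
    obtain ⟨L2', s2, c2, i2⟩ := ih ha (fun n hn hn' => hchar n hn (by omega)) L2 M2
      (hy.mono (Finset.coe_subset.2 sL2)) (hx.mono (Finset.coe_subset.2 sM2))
      (G.kL_mono hk sL2) (G.kM_mono hk' sM2) (fun i hi => by
        have h := hL i (sL2 hi)
        rw [map_mul] at h
        exact (mul_eq_zero.1 h).resolve_left (Finset.mem_filter.1 hi).2)
      (fun i hi => by
        have h := hM i (sM2 hi)
        rw [map_mul] at h
        exact (mul_eq_zero.1 h).resolve_left (Finset.mem_filter.1 hi).2)
    refine ⟨L1' ∪ L2', Finset.union_subset (s1.trans sL1) (s2.trans sL2), ?_, ?_⟩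
    · refine (Finset.card_union_le _ _).trans ?_
      nlinarith [Nat.zero_le (d * D)]
    intro L'' hs hdis
    rw [Finset.disjoint_union_right] at hdis
    have e0 : L'' = (L'' ∩ L1) ∪ (L'' ∩ L2) := by
      rw [← Finset.inter_union_distrib_left, uL, Finset.inter_eq_left.2 hs]
    have hA := i1 (L'' ∩ L1) Finset.inter_subset_right (hdis.1.mono_left Finset.inter_subset_left)
    have hB := i2 (L'' ∩ L2) Finset.inter_subset_right (hdis.2.mono_left Finset.inter_subset_left)
    have hC : G.I (L'' ∩ L1) M2 ≤ d * M2.card := by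
      refine (G.I_mono Finset.inter_subset_right subset_rfl).trans (G.I_le_M L1 M2 d fun j hj => ?_)
      exact G.degM q j L1 (hy.mono (Finset.coe_subset.2 sL1)) (fun i hi => (Finset.mem_filter.1 hi).2)
        (Finset.mem_filter.1 hj).2
    have hE : G.I (L'' ∩ L2) M1 ≤ d * L2.card := by
      refine (G.I_mono Finset.inter_subset_right subset_rfl).trans (G.I_le_L L2 M1 d fun j hj => ?_)
      exact G.degL q j M1 (hx.mono (Finset.coe_subset.2 sM1)) (fun i hi => (Finset.mem_filter.1 hi).2)
        (Finset.mem_filter.1 hj).2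
    have hT : G.I L'' M ≤ (G.I (L'' ∩ L1) M1 + G.I (L'' ∩ L1) M2) + (G.I (L'' ∩ L2) M1 + G.I (L'' ∩ L2) M2) := by
      conv_lhs => rw [e0, ← uM]
      refine (G.I_cover_L _ _ _).trans (Nat.add_le_add (G.I_cover_M _ _ _) (G.I_cover_M _ _ _))
    refine hT.trans ((Nat.add_le_add (Nat.add_le_add hA hC) (Nat.add_le_add hE hB)).trans ?_)
    rw [← cL, ← cM]
    have h2 : 1 * (k * k') ≤ d * (k * k') := Nat.mul_le_mul_right _ h1
    ring_nf
    ring_nf at h2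
    have := Nat.zero_le (d * #L1)
    have := Nat.zero_le (d * #L2)
    have := Nat.zero_le (d * #M1)
    have := Nat.zero_le (d * #M2)
    have := Nat.zero_le (D * #L1)
    have := Nat.zero_le (D * #L2)
    have := Nat.zero_le (D * #M1)
    have := Nat.zero_le (D * #M2)
    linarith

lemma greedy (w : ι → κ → ℕ) (hw : ∀ i j, w i j ≤ 1) (L : Finset ι) (M : Finset κ) (N T u g d0 : ℕ)
    (hM : M.card ≤ N) (hd : ∀ i ∈ L, d0 + T ≤ ∑ j ∈ M, w i j) (hd0 : 0 < d0)
    (hg : N * g ≤ u * d0) (r : ℕ) : ∃ M0 ⊆ M, M0.card ≤ r ∧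
      ((L.filter (fun i => ∑ j ∈ M0, w i j < T)).card ≤ u ∨
        r * g ≤ ∑ i ∈ L, min T (∑ j ∈ M0, w i j)) := by
  classical
  induction r with
  | zero => exact ⟨∅, Finset.empty_subset _, by simp, Or.inr (by simp)⟩
  | succ r ih =>
    obtain ⟨M0, hs, hc, h⟩ := ih
    by_cases hu : (L.filter (fun i => ∑ j ∈ M0, w i j < T)).card ≤ u
    · exact ⟨M0, hs, by omega, Or.inl hu⟩
    have hres := h.resolve_left hu
    set U := L.filter (fun i => ∑ j ∈ M0, w i j < T) with hU
    have : ∃ j ∈ M \ M0, g ≤ ∑ i ∈ U, w i j := by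
      by_contra! hcon
      have h1 : ∑ j ∈ M \ M0, ∑ i ∈ U, w i j ≤ N * g := by
        refine (Finset.sum_le_card_nsmul _ _ g (fun j hj => (hcon j hj).le)).trans ?_
        rw [smul_eq_mul]
        exact Nat.mul_le_mul_right _ ((Finset.card_le_card Finset.sdiff_subset).trans hM)
      rw [Finset.sum_comm] at h1
      have h2 : U.card * d0 ≤ ∑ i ∈ U, ∑ j ∈ M \ M0, w i j := by
        rw [← smul_eq_mul]
        refine Finset.card_nsmul_le_sum _ _ _ (fun i hi => ?_)
        have ha := hd i (Finset.mem_filter.1 hi).1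
        have hb := (Finset.mem_filter.1 hi).2
        rw [← Finset.sum_sdiff hs] at ha
        omega
      have h3 : (u + 1) * d0 ≤ U.card * d0 := Nat.mul_le_mul_right _ (by omega)
      nlinarith
    obtain ⟨j, hj, hjg⟩ := this
    rw [Finset.mem_sdiff] at hj
    refine ⟨insert j M0, Finset.insert_subset hj.1 hs, ?_, Or.inr ?_⟩
    · rw [Finset.card_insert_of_notMem hj.2]; omega
    have hsum : ∑ i ∈ L, min T (∑ j ∈ M0, w i j) + ∑ i ∈ U, w i j ≤
        ∑ i ∈ L, min T (∑ j' ∈ insert j M0, w i j') := by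
      rw [hU, Finset.sum_filter, ← Finset.sum_add_distrib]
      refine Finset.sum_le_sum fun i _ => ?_
      rw [Finset.sum_insert hj.2]
      have := hw i j
      split_ifs <;> omega
    calc (r + 1) * g = r * g + g := by ring
      _ ≤ _ := (Nat.add_le_add hres hjg).trans hsum

lemma greedy' (w : ι → κ → ℕ) (hw : ∀ i j, w i j ≤ 1) (L : Finset ι) (M : Finset κ) (N T u g d0 r : ℕ)
    (hM : M.card ≤ N) (hd : ∀ i ∈ L, d0 + T ≤ ∑ j ∈ M, w i j) (hd0 : 0 < d0)
    (hg : N * g ≤ u * d0) (hr : T * L.card < r * g) : ∃ M0 ⊆ M, M0.card ≤ r ∧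
      (L.filter (fun i => ∑ j ∈ M0, w i j < T)).card ≤ u := by
  obtain ⟨M0, h1, h2, h3⟩ := greedy w hw L M N T u g d0 hM hd hd0 hg r
  refine ⟨M0, h1, h2, h3.resolve_right fun h => ?_⟩
  have := Finset.sum_le_card_nsmul L (fun i => min T (∑ j ∈ M0, w i j)) T (fun i _ => min_le_left _ _)
  rw [smul_eq_mul] at this
  nlinarith

lemma exists_poly (M : Finset κ) (e : ℕ) (h : 3 * M.card ≤ (e + 1) ^ 2) :
    ∃ Q : P3 F, Q ≠ 0 ∧ Q.totalDegree ≤ 3 * e ∧ ∀ j ∈ M, G.rM j Q = 0 := by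
  classical
  let S := Fin 3 → Fin (e + 1)
  let mo : S → (Fin 3 →₀ ℕ) := fun s => Finsupp.equivFunOnFinite.symm (fun i => (s i : ℕ))
  have hmo : Function.Injective mo := by
    intro s t hst
    funext i
    have := DFunLike.congr_fun hst i
    exact Fin.ext this
  let φ : (S → F) →ₗ[F] P3 F := Fintype.linearCombination F (fun s => MvPolynomial.monomial (mo s) (1 : F))
  have hφ : ∀ v, φ v = ∑ s, MvPolynomial.monomial (mo s) (v s) := by
    intro v
    simp [φ, Fintype.linearCombination_apply, MvPolynomial.smul_monomial]
  have hdeg : ∀ v, (φ v).totalDegree ≤ 3 * e := by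
    intro v
    rw [hφ]
    refine MvPolynomial.totalDegree_finsetSum_le fun s _ => ?_
    refine (MvPolynomial.totalDegree_monomial_le _ _).trans ?_
    rw [Finsupp.sum_fintype _ _ (by simp)]
    simp only [mo, Fin.sum_univ_three]
    have h0 := (s 0).is_lt
    have h1 := (s 1).is_lt
    have h2 := (s 2).is_lt
    simp
    omega
  have hcoeff : ∀ v s, MvPolynomial.coeff (mo s) (φ v) = v s := by
    intro v s
    rw [hφ, MvPolynomial.coeff_sum, Finset.sum_eq_single s]
    · simp
    · intro t _ hts
      rw [MvPolynomial.coeff_monomial, if_neg (fun h => hts (hmo h))]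
    · simp
  let ψ : (S → F) →ₗ[F] (M × Fin (3 * e + 1) → F) := LinearMap.pi fun t =>
    (Polynomial.lcoeff F (t.2 : ℕ)) ∘ₗ (G.rM t.1).toLinearMap ∘ₗ φ
  have hker : LinearMap.ker ψ ≠ ⊥ := by
    apply LinearMap.ker_ne_bot_of_finrank_lt
    rw [Module.finrank_fintype_fun_eq_card, Module.finrank_fintype_fun_eq_card]
    simp only [S, Fintype.card_prod, Fintype.card_coe, Fintype.card_fin, Fintype.card_fun]
    nlinarith
  obtain ⟨v, hv, hv0⟩ := Submodule.exists_mem_ne_zero_of_ne_bot hker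
  refine ⟨φ v, ?_, hdeg v, ?_⟩
  · intro h0
    apply hv0
    funext s
    rw [← hcoeff v s, h0]; simp
  · intro j hj
    ext n
    rw [coeff_zero]
    by_cases hn : n < 3 * e + 1
    · have := congrFun (LinearMap.mem_ker.1 hv) (⟨j, hj⟩, ⟨n, hn⟩)
      simpa [ψ] using this
    · apply coeff_eq_zero_of_natDegree_lt
      have := (natDegree_evM_le (G.x j) (G.c j) (G.e j) (φ v)).trans (hdeg v)
      have : (G.rM j (φ v)).natDegree ≤ 3 * e := this
      omega

end RQ

namespace RQ
open Polynomial
variable {F : Type*} [Field F]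
variable {ι κ : Type*} (G : Cfg F ι κ)

lemma step (N k k' e : ℕ) (he : 1 ≤ e) (L : Finset ι) (M : Finset κ)
    (hchar : ∀ n : ℕ, 0 < n → n ≤ 3 * e → (n : F) ≠ 0)
    (hy : Set.InjOn G.y L) (hx : Set.InjOn G.x M)
    (hk : G.kL L k) (hk' : G.kM M k') (hkk : k * k' ≤ N) (hLN : L.card ≤ N) (hMN : M.card ≤ N)
    (hL : L.card ≤ 4096 * e ^ 2) (heN : 256 * e ^ 2 ≤ N) :
    ∃ L3 ⊆ L, L3.card ≤ 256 * e ^ 2 ∧ G.I L M ≤ 1577064 * (e * N) + G.I L3 M := by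
  classical
  set d0 := 385 * N / e + 1 with hd0
  set T := 3 * e + 1 with hT
  set Lp := L.filter (fun i => ¬ d0 + T ≤ ∑ j ∈ M, G.w i j) with hLp
  set Lr := L.filter (fun i => d0 + T ≤ ∑ j ∈ M, G.w i j) with hLr
  have sLr : Lr ⊆ L := Finset.filter_subset _ _
  have hpoor : G.I Lp M ≤ 1577040 * (e * N) := by
    have h1 : G.I Lp M ≤ (d0 + T) * Lp.card := G.I_le_L _ _ _ (fun i hi => by
      have := (Finset.mem_filter.1 hi).2
      omega)
    have h2 : Lp.card ≤ 4096 * e ^ 2 := (Finset.card_le_card (Finset.filter_subset _ _)).trans hL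
    refine h1.trans ((Nat.mul_le_mul_left _ h2).trans ?_)
    have h3 : 385 * N / e * e ≤ 385 * N := Nat.div_mul_le_self _ _
    have h4 : (d0 + T) * e ≤ 385 * N + 5 * e ^ 2 := by
      rw [hd0, hT]; nlinarith
    calc (d0 + T) * (4096 * e ^ 2) = 4096 * e * ((d0 + T) * e) := by ring
      _ ≤ 4096 * e * (385 * N + 5 * e ^ 2) := Nat.mul_le_mul_left _ h4
      _ = 1576960 * (e * N) + 80 * e * (256 * e ^ 2) := by ring
      _ ≤ 1576960 * (e * N) + 80 * e * N := Nat.add_le_add_left (Nat.mul_le_mul_left _ heN) _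
      _ = _ := by ring
  have hr3 : e ^ 2 ≤ 3 * ((e + 1) ^ 2 / 3) := by
    have : (e + 1) ^ 2 = e ^ 2 + 2 * e + 1 := by ring
    omega
  obtain ⟨M0, sM0, cM0, hun⟩ := greedy' G.w G.w_le Lr M N T (128 * e ^ 2) (49153 * e) d0 ((e + 1) ^ 2 / 3)
    hMN (fun i hi => (Finset.mem_filter.1 hi).2) (Nat.succ_pos _) (by
      have h3 : 385 * N < e * d0 := by
        rw [hd0]; exact Nat.lt_mul_div_succ _ (by omega)
      calc N * (49153 * e) ≤ 128 * e * (385 * N) := by nlinarith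
        _ ≤ 128 * e * (e * d0) := Nat.mul_le_mul_left _ h3.le
        _ = _ := by ring) (by
      have h1 : Lr.card ≤ 4096 * e ^ 2 := (Finset.card_le_card sLr).trans hL
      have h2 : T * Lr.card ≤ 4 * e * (4096 * e ^ 2) := Nat.mul_le_mul (by omega) h1
      have h3 : e ^ 2 * (49153 * e) ≤ 3 * ((e + 1) ^ 2 / 3) * (49153 * e) := Nat.mul_le_mul_right _ hr3
      have h4 : 0 < e ^ 3 := by positivity
      have h5 : e ^ 2 * (49153 * e) = 49153 * e ^ 3 := by ring
      have h6 : 4 * e * (4096 * e ^ 2) = 16384 * e ^ 3 := by ring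
      have h7 : 3 * ((e + 1) ^ 2 / 3) * (49153 * e) = 3 * (((e + 1) ^ 2 / 3) * (49153 * e)) := by ring
      omega)
  obtain ⟨Q, hQ0, hQd, hQM⟩ := exists_poly G M0 e (by omega)
  set Lu := Lr.filter (fun i => ∑ j ∈ M0, G.w i j < T) with hLu
  set L1 := Lr.filter (fun i => ¬ ∑ j ∈ M0, G.w i j < T) with hL1
  have sL1 : L1 ⊆ L := (Finset.filter_subset _ _).trans sLr
  have hQL1 : ∀ i ∈ L1, G.rL i Q = 0 := by
    intro i hi
    by_contra hne
    have := G.degL Q i M0 (hx.mono (Finset.coe_subset.2 sM0)) hQM hne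
    have := (Finset.mem_filter.1 hi).2
    omega
  set M1 := M.filter (fun j => G.rM j Q = 0) with hM1
  set M2 := M.filter (fun j => ¬ G.rM j Q = 0) with hM2
  have sM1 : M1 ⊆ M := Finset.filter_subset _ _
  have sM2 : M2 ⊆ M := Finset.filter_subset _ _
  have uM : M1 ∪ M2 = M := Finset.filter_union_filter_not_eq _ M
  have uL : Lr ∪ Lp = L := Finset.filter_union_filter_not_eq _ L
  have uLr : Lu ∪ L1 = Lr := Finset.filter_union_filter_not_eq _ Lr
  obtain ⟨L', sL', cL', hI⟩ := factor_case G k k' Q hQ0 (fun n hn hn' => hchar n hn (hn'.trans hQd)) L1 M1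
    (hy.mono (Finset.coe_subset.2 sL1)) (hx.mono (Finset.coe_subset.2 sM1))
    (G.kL_mono hk sL1) (G.kM_mono hk' sM1) hQL1 (fun j hj => (Finset.mem_filter.1 hj).2)
  have h1 := hI (L1 \ L') Finset.sdiff_subset Finset.sdiff_disjoint
  have h2 : G.I (L1 \ L') M2 ≤ 3 * e * N := by
    refine (G.I_mono Finset.sdiff_subset subset_rfl).trans ?_
    refine (G.I_le_M L1 M2 (3 * e) fun j hj => ?_).trans
      (Nat.mul_le_mul_left _ ((Finset.card_le_card sM2).trans hMN))
    exact (G.degM Q j L1 (hy.mono (Finset.coe_subset.2 sL1)) hQL1 (Finset.mem_filter.1 hj).2).trans hQd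
  refine ⟨Lu ∪ L', Finset.union_subset ((Finset.filter_subset _ _).trans sLr) (sL'.trans sL1), ?_, ?_⟩
  · refine (Finset.card_union_le _ _).trans ?_
    have : Q.totalDegree ^ 2 ≤ (3 * e) ^ 2 := Nat.pow_le_pow_left hQd 2
    nlinarith
  · have h3 : G.I L M ≤ (G.I (L1 \ L') M1 + G.I (L1 \ L') M2) + G.I (Lu ∪ L') M + G.I Lp M := by
      have : L ⊆ ((L1 \ L') ∪ (Lu ∪ L')) ∪ Lp := by
        rw [← uL, ← uLr]
        intro i
        simp only [Finset.mem_union, Finset.mem_sdiff]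
        tauto
      refine (G.I_mono this subset_rfl).trans ((G.I_cover_L _ _ _).trans (Nat.add_le_add_right ?_ _))
      refine (G.I_cover_L _ _ _).trans (Nat.add_le_add_right ?_ _)
      conv_lhs => rw [← uM]
      exact G.I_cover_M _ _ _
    have h4 : G.I (L1 \ L') M1 ≤ 21 * (e * N) := by
      refine h1.trans ?_
      have a1 : L1.card + M1.card ≤ 2 * N := by
        have := Finset.card_le_card sL1
        have := Finset.card_le_card sM1
        omega
      calc 3 * Q.totalDegree * (L1.card + M1.card) + Q.totalDegree * (k * k')
          ≤ 3 * (3 * e) * (2 * N) + 3 * e * N := by gcongr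
        _ = _ := by ring
    have h5 : 3 * e * N = 3 * (e * N) := by ring
    omega

lemma recursion (N k k' : ℕ) (M : Finset κ) (hx : Set.InjOn G.x M)
    (hk' : G.kM M k') (hkk : k * k' ≤ N) (hMN : M.card ≤ N) (j : ℕ) :
    16 ^ j ≤ 16 * N → 
    (∀ n : ℕ, 0 < n → 64 * n ≤ 3 * 4 ^ j → (n : F) ≠ 0) →
    ∀ L : Finset ι, Set.InjOn G.y L → G.kL L k → L.card ≤ N → L.card ≤ 16 ^ j → 
    G.I L M ≤ 40000 * (N * 4 ^ j) := by
  induction j with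
  | zero =>
    intro _ _ L _ _ hL h1
    refine (G.I_le_mul L M).trans ?_
    have := Nat.mul_le_mul hMN h1
    simp at this ⊢
    omega
  | succ j ih =>
    intro hN hchar L hy hk hLN hLj
    by_cases hj : j < 2
    · refine (G.I_le_mul L M).trans ?_
      refine (Nat.mul_le_mul hMN hLj).trans ?_
      interval_cases j <;> omega
    obtain ⟨i, rfl⟩ : ∃ i, j = i + 2 := ⟨j - 2, by omega⟩
    have e1 : (4 : ℕ) ^ (i + 2 + 1) = 64 * 4 ^ i := by ring
    have e2 : (16 : ℕ) ^ (i + 2 + 1) = 4096 * (4 ^ i) ^ 2 := by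
      rw [← pow_mul, mul_comm i 2, pow_mul]; norm_num; ring
    have e3 : (16 : ℕ) ^ (i + 2) = 256 * (4 ^ i) ^ 2 := by
      rw [← pow_mul, mul_comm i 2, pow_mul]; norm_num; ring
    have e4 : (4 : ℕ) ^ (i + 2) = 16 * 4 ^ i := by ring
    rw [e2] at hN hLj
    rw [e1] at hchar ⊢
    rw [e3, e4] at ih
    obtain ⟨L3, s3, c3, h3⟩ := step G N k k' (4 ^ i) (Nat.one_le_pow _ _ (by norm_num)) L M
      (fun n hn hn' => hchar n hn (by omega)) hy hx hk hk' hkk hLN hMN hLj (by omega)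
    have := ih (by omega) (fun n hn hn' => hchar n hn (by omega)) L3 (hy.mono (Finset.coe_subset.2 s3))
      (G.kL_mono hk s3) ((Finset.card_le_card s3).trans hLN) c3
    refine h3.trans ((Nat.add_le_add_left this _).trans ?_)
    have f1 : N * (16 * 4 ^ i) = 16 * (4 ^ i * N) := by ring
    have f2 : N * (64 * 4 ^ i) = 64 * (4 ^ i * N) := by ring
    rw [f1, f2]
    omega

end RQ

namespace RQ
open Polynomial
variable {K : Type*} [Field K]

lemma exists_nonroot [Infinite K] {J : Type*} (S : Finset J) (P : J → K[X]) (h : ∀ j ∈ S, P j ≠ 0) :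
    ∃ t : K, ∀ j ∈ S, (P j).eval t ≠ 0 := by
  classical
  obtain ⟨t, ht⟩ := Infinite.exists_notMem_finset (S.biUnion fun j => (P j).roots.toFinset)
  refine ⟨t, fun j hj h0 => ht ?_⟩
  rw [Finset.mem_biUnion]
  exact ⟨j, hj, by rw [Multiset.mem_toFinset, mem_roots (h j hj)]; exact h0⟩

/-- generic normal form of point-plane incidences -/
noncomputable def gcfg (σ τ : K) : Cfg K (K × K × K) (K × K × K) where
  y := fun v => (v.2.2 + τ * v.2.1 + τ ^ 2 * v.1) / (1 - σ * v.1)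
  a := fun v => v.1 / (1 - σ * v.1)
  b := fun v => v.2.1 / (1 - σ * v.1)
  x := fun v => (v.1 - τ ^ 2 + σ * v.2.2) / (v.2.1 - τ)
  c := fun v => -1 / (v.2.1 - τ)
  e := fun v => - v.2.2 / (v.2.1 - τ)

lemma gcfg_inc (σ τ : K) (v w : K × K × K) (hv : 1 - σ * v.1 ≠ 0) (hw : w.2.1 - τ ≠ 0)
    (h : v.1 * w.1 + v.2.1 * w.2.1 + v.2.2 + w.2.2 = 0) : (gcfg σ τ).w v w = 1 := by
  unfold Cfg.w
  rw [if_pos]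
  simp only [gcfg]
  generalize hs : 1 - σ * v.1 = s at *
  generalize ht : w.2.1 - τ = t at *
  field_simp
  rw [← hs, ← ht]
  linear_combination h

lemma quad_ne_zero (a b c : K) (h : ¬ (a = 0 ∧ b = 0 ∧ c = 0)) :
    C a + C b * X + C c * X ^ 2 ≠ 0 := by
  intro h0
  apply h
  have h1 := congrArg (fun p => coeff p 0) h0
  have h2 := congrArg (fun p => coeff p 1) h0
  have h3 := congrArg (fun p => coeff p 2) h0
  simp [coeff_X, coeff_C, coeff_X_pow] at h1 h2 h3
  exact ⟨h1, h2, h3⟩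

lemma normalize [Infinite K] (P P' : Finset (K × K × K)) : ∃ σ τ : K,
    (∀ v ∈ P, 1 - σ * v.1 ≠ 0) ∧ (∀ v ∈ P', v.2.1 - τ ≠ 0) ∧
    Set.InjOn (gcfg σ τ).y P ∧ Set.InjOn (gcfg σ τ).x P' := by
  classical
  obtain ⟨t1, ht1⟩ : ∃ t : K, (∀ v ∈ P', v.2.1 - t ≠ 0) ∧
      (∀ v ∈ P, ∀ w ∈ P, v ≠ w →
        v.2.2 + t * v.2.1 + t ^ 2 * v.1 ≠ w.2.2 + t * w.2.1 + t ^ 2 * w.1) ∧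
      (∀ v ∈ P', ∀ w ∈ P', ¬ (v.1 = w.1 ∧ v.2.1 = w.2.1) →
        (v.1 - t ^ 2) * (w.2.1 - t) ≠ (w.1 - t ^ 2) * (v.2.1 - t)) := by
    let S : Finset ((K × K × K) ⊕ ((K × K × K) × (K × K × K)) ⊕ ((K × K × K) × (K × K × K))) := P'.disjSum (((P ×ˢ P).filter fun z => z.1 ≠ z.2).disjSum
      ((P' ×ˢ P').filter fun z => ¬ (z.1.1 = z.2.1 ∧ z.1.2.1 = z.2.2.1)))
    let Pf : ((K × K × K) ⊕ ((K × K × K) × (K × K × K)) ⊕ ((K × K × K) × (K × K × K))) → K[X] := Sum.elim (fun v => C v.2.1 + C (-1) * X + C 0 * X ^ 2)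
      (Sum.elim (fun z => C (z.1.2.2 - z.2.2.2) + C (z.1.2.1 - z.2.2.1) * X + C (z.1.1 - z.2.1) * X ^ 2)
        (fun z => C (z.1.1 * z.2.2.1 - z.2.1 * z.1.2.1) + C (z.2.1 - z.1.1) * X
          + C (z.1.2.1 - z.2.2.1) * X ^ 2))
    obtain ⟨t, ht⟩ := exists_nonroot S Pf (by
      intro j hj
      rcases j with v | z | z
      · exact quad_ne_zero _ _ _ (by simp)
      · simp only [S, Finset.inr_mem_disjSum, Finset.inl_mem_disjSum, Finset.mem_filter] at hj
        refine quad_ne_zero _ _ _ (fun h => hj.2 ?_)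
        simp only [sub_eq_zero] at h
        ext
        · exact h.2.2
        · exact h.2.1
        · exact h.1
      · simp only [S, Finset.inr_mem_disjSum, Finset.mem_filter] at hj
        refine quad_ne_zero _ _ _ (fun h => hj.2 ?_)
        simp only [sub_eq_zero] at h
        exact ⟨h.2.1.symm, h.2.2⟩)
    refine ⟨t, ?_, ?_, ?_⟩
    · intro v hv
      have := ht (Sum.inl v) (by simp [S, hv])
      intro h0; apply this; simp [Pf]; linear_combination h0
    · intro v hv w hw hne h0
      have := ht (Sum.inr (Sum.inl (v, w))) (by
        simp only [S, Finset.inr_mem_disjSum, Finset.inl_mem_disjSum, Finset.mem_filter, Finset.mem_product]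
        exact ⟨⟨hv, hw⟩, hne⟩)
      apply this; simp [Pf]; linear_combination h0
    · intro v hv w hw hne h0
      have := ht (Sum.inr (Sum.inr (v, w))) (by
        simp only [S, Finset.inr_mem_disjSum, Finset.mem_filter, Finset.mem_product]
        exact ⟨⟨hv, hw⟩, hne⟩)
      apply this; simp [Pf]; linear_combination h0
  obtain ⟨hA, hB, hC⟩ := ht1
  obtain ⟨s, hs1, hs2, hs3⟩ : ∃ s : K, (∀ v ∈ P, 1 - s * v.1 ≠ 0) ∧
      (∀ v ∈ P, ∀ w ∈ P, v ≠ w →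
        (v.2.2 + t1 * v.2.1 + t1 ^ 2 * v.1) * (1 - s * w.1)
          ≠ (w.2.2 + t1 * w.2.1 + t1 ^ 2 * w.1) * (1 - s * v.1)) ∧
      (∀ v ∈ P', ∀ w ∈ P', v ≠ w →
        (v.1 - t1 ^ 2 + s * v.2.2) * (w.2.1 - t1) ≠ (w.1 - t1 ^ 2 + s * w.2.2) * (v.2.1 - t1)) := by
    let S : Finset ((K × K × K) ⊕ ((K × K × K) × (K × K × K)) ⊕ ((K × K × K) × (K × K × K))) := P.disjSum (((P ×ˢ P).filter fun z => z.1 ≠ z.2).disjSum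
      ((P' ×ˢ P').filter fun z => z.1 ≠ z.2))
    let gg : K × K × K → K := fun v => v.2.2 + t1 * v.2.1 + t1 ^ 2 * v.1
    let Pf : ((K × K × K) ⊕ ((K × K × K) × (K × K × K)) ⊕ ((K × K × K) × (K × K × K))) → K[X] := Sum.elim (fun v => C 1 + C (-v.1) * X + C 0 * X ^ 2)
      (Sum.elim (fun z => C (gg z.1 - gg z.2) + C (gg z.2 * z.1.1 - gg z.1 * z.2.1) * X + C 0 * X ^ 2)
        (fun z => C ((z.1.1 - t1 ^ 2) * (z.2.2.1 - t1) - (z.2.1 - t1 ^ 2) * (z.1.2.1 - t1))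
          + C (z.1.2.2 * (z.2.2.1 - t1) - z.2.2.2 * (z.1.2.1 - t1)) * X + C 0 * X ^ 2))
    obtain ⟨t, ht⟩ := exists_nonroot S Pf (by
      intro j hj
      rcases j with v | z | z
      · exact quad_ne_zero _ _ _ (by simp)
      · simp only [S, Finset.inr_mem_disjSum, Finset.inl_mem_disjSum, Finset.mem_filter, Finset.mem_product] at hj
        refine quad_ne_zero _ _ _ (fun h => hB z.1 hj.1.1 z.2 hj.1.2 hj.2 ?_)
        simp only [sub_eq_zero] at h
        exact h.1
      · simp only [S, Finset.inr_mem_disjSum, Finset.mem_filter, Finset.mem_product] at hj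
        refine quad_ne_zero _ _ _ (fun h => ?_)
        simp only [sub_eq_zero] at h
        by_cases he : z.1.1 = z.2.1 ∧ z.1.2.1 = z.2.2.1
        · apply hj.2
          have h2 := h.2.1
          rw [he.2] at h2
          have h3 := mul_right_cancel₀ (hA z.2 hj.1.2) h2
          ext
          · exact he.1
          · exact he.2
          · exact h3
        · exact hC z.1 hj.1.1 z.2 hj.1.2 he h.1)
    refine ⟨t, ?_, ?_, ?_⟩
    · intro v hv
      have := ht (Sum.inl v) (by simp [S, hv])
      intro h0; apply this; simp [Pf]; linear_combination h0
    · intro v hv w hw hne h0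
      have := ht (Sum.inr (Sum.inl (v, w))) (by
        simp only [S, Finset.inr_mem_disjSum, Finset.inl_mem_disjSum, Finset.mem_filter, Finset.mem_product]
        exact ⟨⟨hv, hw⟩, hne⟩)
      apply this; simp [Pf, gg]; linear_combination h0
    · intro v hv w hw hne h0
      have := ht (Sum.inr (Sum.inr (v, w))) (by
        simp only [S, Finset.inr_mem_disjSum, Finset.mem_filter, Finset.mem_product]
        exact ⟨⟨hv, hw⟩, hne⟩)
      apply this; simp [Pf]; linear_combination h0
  refine ⟨s, t1, hs1, hA, ?_, ?_⟩
  · intro v hv w hw h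
    by_contra hne
    simp only [gcfg] at h
    rw [div_eq_div_iff (hs1 v hv) (hs1 w hw)] at h
    exact hs2 v hv w hw hne h
  · intro v hv w hw h
    by_contra hne
    simp only [gcfg] at h
    rw [div_eq_div_iff (hA v hv) (hA w hw)] at h
    exact hs3 v hv w hw hne h

lemma gcfg_kL (σ τ : K) (P : Finset (K × K × K)) (X1 X2 X3 : Finset K) (q : K → K → K) (k : ℕ)
    (h1 : X1.card ≤ k) (h2 : X2.card ≤ k) (h3 : X3.card ≤ k)
    (hP : ∀ v ∈ P, v.1 ∈ X1 ∧ v.2.1 ∈ X2 ∧ v.2.2 + q v.1 v.2.1 ∈ X3)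
    (hs : ∀ v ∈ P, 1 - σ * v.1 ≠ 0) : (gcfg σ τ).kL P k := by
  intro α β γ δ S hS hinc
  have H : ∀ v ∈ S, v.1 = β * (1 - σ * v.1) + δ * (v.2.2 + τ * v.2.1 + τ ^ 2 * v.1) ∧
      v.2.1 = α * (1 - σ * v.1) + γ * (v.2.2 + τ * v.2.1 + τ ^ 2 * v.1) := by
    intro v hv
    obtain ⟨i1, i2⟩ := hinc v hv
    have h0 := hs v (hS hv)
    simp only [gcfg] at i1 i2
    rw [div_eq_iff h0, add_mul, mul_assoc, div_mul_cancel₀ _ h0] at i1 i2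
    exact ⟨by linear_combination i1, by linear_combination i2⟩
  by_cases hδ : δ = 0
  · have hα : ∀ v ∈ S, ∀ w ∈ S, v.1 = w.1 := by
      intro v hv w hw
      have a1 := (H v hv).1
      have a2 := (H w hw).1
      rw [hδ] at a1 a2
      by_contra hne
      have hne : v.1 - w.1 ≠ 0 := sub_ne_zero.2 hne
      have a3 : (v.1 - w.1) * (1 + β * σ) = 0 := by linear_combination a1 - a2
      have a4 := (mul_eq_zero.1 a3).resolve_left hne
      have a5 : β = 0 := by linear_combination -a1 + v.1 * a4
      rw [a5] at a4
      simp at a4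
    by_cases hγ : γ = 0
    · refine (Finset.card_le_card_of_injOn (t := X3) (fun v => v.2.2 + q v.1 v.2.1)
        (fun v hv => (hP v (hS hv)).2.2) ?_).trans h3
      intro v hv w hw h
      have e1 := hα v hv w hw
      have e2 : v.2.1 = w.2.1 := by
        have a1 := (H v hv).2
        have a2 := (H w hw).2
        rw [hγ] at a1 a2
        rw [e1] at a1
        rw [a1, a2]; ring
      simp only [e1, e2, add_left_inj] at h
      ext
      · exact e1
      · exact e2
      · exact h
    · refine (Finset.card_le_card_of_injOn (t := X2) (fun v => v.2.1)
        (fun v hv => (hP v (hS hv)).2.1) ?_).trans h2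
      intro v hv w hw h
      have e1 := hα v hv w hw
      have e2 : v.2.1 = w.2.1 := h
      have a1 := (H v hv).2
      have a2 := (H w hw).2
      ext
      · exact e1
      · exact e2
      · apply mul_left_cancel₀ hγ
        rw [e1, e2] at a1
        linear_combination a2 - a1
  · refine (Finset.card_le_card_of_injOn (t := X1) (fun v => v.1)
        (fun v hv => (hP v (hS hv)).1) ?_).trans h1
    intro v hv w hw h
    have e1 : v.1 = w.1 := h
    have a1 := H v hv
    have a2 := H w hw
    rw [e1] at a1
    have e3 : v.2.2 + τ * v.2.1 + τ ^ 2 * w.1 = w.2.2 + τ * w.2.1 + τ ^ 2 * w.1 := by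
      apply mul_left_cancel₀ hδ
      linear_combination a2.1 - a1.1
    have e2 : v.2.1 = w.2.1 := by
      linear_combination a1.2 - a2.2 + γ * e3
    ext
    · exact e1
    · exact e2
    · linear_combination e3 - τ * e2

lemma gcfg_kM (σ τ : K) (P : Finset (K × K × K)) (X1 X2 X3 : Finset K) (q : K → K → K) (k : ℕ)
    (h1 : X1.card ≤ k) (h2 : X2.card ≤ k) (h3 : X3.card ≤ k)
    (hP : ∀ v ∈ P, v.1 ∈ X1 ∧ v.2.1 ∈ X2 ∧ v.2.2 + q v.1 v.2.1 ∈ X3)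
    (hs : ∀ v ∈ P, v.2.1 - τ ≠ 0) : (gcfg σ τ).kM P k := by
  intro α β γ δ S hS hinc
  have H : ∀ v ∈ S, -1 = γ * (v.2.1 - τ) + δ * (v.1 - τ ^ 2 + σ * v.2.2) ∧
      - v.2.2 = α * (v.2.1 - τ) + β * (v.1 - τ ^ 2 + σ * v.2.2) := by
    intro v hv
    obtain ⟨i1, i2⟩ := hinc v hv
    have h0 := hs v (hS hv)
    simp only [gcfg] at i1 i2
    rw [div_eq_iff h0, add_mul, mul_assoc, div_mul_cancel₀ _ h0] at i1 i2
    exact ⟨by linear_combination i1, by linear_combination i2⟩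
  by_cases hδ : δ = 0
  · have hα : ∀ v ∈ S, ∀ w ∈ S, v.2.1 = w.2.1 := by
      intro v hv w hw
      have a1 := (H v hv).1
      have a2 := (H w hw).1
      rw [hδ] at a1 a2
      have hγ : γ ≠ 0 := by
        intro h0
        rw [h0] at a1
        simp at a1
      apply mul_left_cancel₀ hγ
      linear_combination a2 - a1
    by_cases hγ : 1 + β * σ = 0
    · have hβ : β ≠ 0 := by
        intro h0
        rw [h0] at hγ
        simp at hγ
      refine (Finset.card_le_card_of_injOn (t := X3) (fun v => v.2.2 + q v.1 v.2.1)
        (fun v hv => (hP v (hS hv)).2.2) ?_).trans h3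
      intro v hv w hw h
      have e1 := hα v hv w hw
      have e2 : v.1 = w.1 := by
        have a1 := (H v hv).2
        have a2 := (H w hw).2
        rw [e1] at a1
        apply mul_left_cancel₀ hβ
        linear_combination a2 - a1 - (v.2.2 - w.2.2) * hγ
      simp only [e1, e2, add_left_inj] at h
      ext
      · exact e2
      · exact e1
      · exact h
    · refine (Finset.card_le_card_of_injOn (t := X1) (fun v => v.1)
        (fun v hv => (hP v (hS hv)).1) ?_).trans h1
      intro v hv w hw h
      have e1 := hα v hv w hw
      have e2 : v.1 = w.1 := h
      have a1 := (H v hv).2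
      have a2 := (H w hw).2
      ext
      · exact e2
      · exact e1
      · apply mul_left_cancel₀ hγ
        rw [e1, e2] at a1
        linear_combination a2 - a1
  · refine (Finset.card_le_card_of_injOn (t := X2) (fun v => v.2.1)
        (fun v hv => (hP v (hS hv)).2.1) ?_).trans h2
    intro v hv w hw h
    have e1 : v.2.1 = w.2.1 := h
    have a1 := H v hv
    have a2 := H w hw
    rw [e1] at a1
    have e3 : v.1 - τ ^ 2 + σ * v.2.2 = w.1 - τ ^ 2 + σ * w.2.2 := by
      apply mul_left_cancel₀ hδ
      linear_combination a2.1 - a1.1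
    have e2 : v.2.2 = w.2.2 := by
      linear_combination a2.2 - a1.2 - β * e3
    ext
    · linear_combination e3 - σ * e2
    · exact e1
    · exact e2

end RQ

namespace RQ
open Polynomial
variable {K : Type*} [Field K]

lemma energy_upper [Infinite K] [DecidableEq K] (D U A : Finset K) (k N : ℕ) (h2 : (2 : K) ≠ 0)
    (hD : D.card ≤ k) (hU : U.card ≤ k) (hA : A.card ≤ k) (hkN : k * k ≤ N) (hN1 : 1 ≤ N)
    (hN : D.card * (U.card * A.card) ≤ N)
    (hchar : ∀ n : ℕ, 0 < n → (64 * n) ^ 2 ≤ 144 * N → (n : K) ≠ 0) :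
    (((D ×ˢ (U ×ˢ A)) ×ˢ (D ×ˢ (U ×ˢ A))).filter (fun z : (K × K × K) × (K × K × K) =>
      (z.1.1 - z.2.2.1) ^ 2 + z.1.2.2 = (z.2.1 - z.1.2.1) ^ 2 + z.2.2.2)).card ^ 2
      ≤ 160000 ^ 2 * N ^ 3 := by
  classical
  set Z := D ×ˢ (U ×ˢ A) with hZ
  have cZ : Z.card ≤ N := by rw [hZ, Finset.card_product, Finset.card_product]; exact hN
  let pt : K × K × K → K × K × K := fun z => (z.1, z.2.1, z.1 ^ 2 - z.2.1 ^ 2 + z.2.2)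
  let pl : K × K × K → K × K × K := fun z => (-2 * z.2.1, 2 * z.1, z.2.1 ^ 2 - z.1 ^ 2 - z.2.2)
  have hpt : Function.Injective pt := by
    intro z w h
    simp only [pt, Prod.mk.injEq] at h
    obtain ⟨a1, a2, a3⟩ := h
    rw [a1, a2] at a3
    ext
    · exact a1
    · exact a2
    · exact add_left_cancel a3
  have hpl : Function.Injective pl := by
    intro z w h
    simp only [pl, Prod.mk.injEq] at h
    obtain ⟨a1, a2, a3⟩ := h
    have a1 := mul_left_cancel₀ (neg_ne_zero.2 h2) a1
    have a2 := mul_left_cancel₀ h2 a2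
    rw [a1, a2] at a3
    ext
    · exact a2
    · exact a1
    · linear_combination -a3
  set P := Z.image pt with hP
  set P' := Z.image pl with hP'
  have cP : P.card ≤ N := Finset.card_image_le.trans cZ
  have cP' : P'.card ≤ N := Finset.card_image_le.trans cZ
  obtain ⟨σ, τ, g1, g2, g3, g4⟩ := normalize P P'
  have kl : (gcfg σ τ).kL P k := by
    refine gcfg_kL σ τ P D U A (fun a b => - a ^ 2 + b ^ 2) k hD hU hA ?_ g1
    intro v hv
    obtain ⟨z, hz, rfl⟩ := Finset.mem_image.1 hv
    simp only [hZ, Finset.mem_product] at hz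
    refine ⟨hz.1, hz.2.1, ?_⟩
    convert hz.2.2 using 1
    simp only [pt]; ring
  have km : (gcfg σ τ).kM P' k := by
    refine gcfg_kM σ τ P' (U.image fun u => -2 * u) (D.image fun d => 2 * d) (A.image fun a => - a)
      (fun a b => - a ^ 2 / 4 + b ^ 2 / 4) k (Finset.card_image_le.trans hU)
      (Finset.card_image_le.trans hD) (Finset.card_image_le.trans hA) ?_ g2
    intro v hv
    obtain ⟨z, hz, rfl⟩ := Finset.mem_image.1 hv
    simp only [hZ, Finset.mem_product] at hz
    refine ⟨Finset.mem_image_of_mem _ hz.2.1, Finset.mem_image_of_mem _ hz.1, ?_⟩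
    rw [Finset.mem_image]
    refine ⟨_, hz.2.2, ?_⟩
    simp only [pl]
    have h4 : (4 : K) ≠ 0 := by
      have : (4 : K) = 2 * 2 := by norm_num
      rw [this]; exact mul_ne_zero h2 h2
    field_simp
    ring
  obtain ⟨j, hj1, hj2⟩ : ∃ j, N ≤ 16 ^ j ∧ 16 ^ j ≤ 16 * N := by
    refine ⟨Nat.clog 16 N, Nat.le_pow_clog (by norm_num) _, ?_⟩
    by_cases h : N = 1
    · simp [h]
    · have := Nat.pow_pred_clog_lt_self (b := 16) (by norm_num) (x := N) (by omega)
      have hc : 0 < Nat.clog 16 N := Nat.clog_pos (by norm_num) (by omega)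
      obtain ⟨m, hm⟩ : ∃ m, Nat.clog 16 N = m + 1 := ⟨Nat.clog 16 N - 1, by omega⟩
      rw [hm] at this ⊢
      simp only [Nat.pred_eq_sub_one, Nat.add_sub_cancel] at this
      rw [pow_succ]; omega
  have h16 : ((4 : ℕ) ^ j) ^ 2 = 16 ^ j := by
    rw [← pow_mul, mul_comm, pow_mul]; norm_num
  have hI := recursion (gcfg σ τ) N k k P' g4 km hkN cP' j hj2 (fun n hn hn' => hchar n hn (by
      calc (64 * n) ^ 2 ≤ (3 * 4 ^ j) ^ 2 := Nat.pow_le_pow_left hn' 2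
        _ = 9 * (4 ^ j) ^ 2 := by ring
        _ ≤ 144 * N := by rw [h16]; omega)) P g3 kl cP (cP.trans hj1)
  set E := ((Z ×ˢ Z).filter (fun z : (K × K × K) × (K × K × K) =>
      (z.1.1 - z.2.2.1) ^ 2 + z.1.2.2 = (z.2.1 - z.1.2.1) ^ 2 + z.2.2.2)).card with hE
  have hEI : E ≤ (gcfg σ τ).I P P' := by
    have : E ≤ ((P ×ˢ P').filter (fun q => (gcfg σ τ).w q.1 q.2 = 1)).card := by
      refine Finset.card_le_card_of_injOn (fun z => (pt z.1, pl z.2)) ?_ ?_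
      · intro z hz
        have hz := Finset.mem_coe.1 hz
        rw [Finset.mem_filter, Finset.mem_product] at hz
        have m1 : pt z.1 ∈ P := Finset.mem_image_of_mem _ hz.1.1
        have m2 : pl z.2 ∈ P' := Finset.mem_image_of_mem _ hz.1.2
        rw [Finset.mem_coe, Finset.mem_filter, Finset.mem_product]
        refine ⟨⟨m1, m2⟩, gcfg_inc σ τ _ _ (g1 _ m1) (g2 _ m2) ?_⟩
        simp only [pt, pl]
        linear_combination hz.2
      · intro z _ w _ h
        simp only [Prod.mk.injEq] at h
        exact Prod.ext (hpt h.1) (hpl h.2)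
    refine this.trans ?_
    rw [Finset.card_filter, Cfg.I, ← Finset.sum_product']
    refine Finset.sum_le_sum fun q _ => ?_
    split_ifs with h
    · exact h.ge
    · exact Nat.zero_le _
  calc E ^ 2 ≤ (40000 * (N * 4 ^ j)) ^ 2 := Nat.pow_le_pow_left (hEI.trans hI) 2
    _ = 40000 ^ 2 * N ^ 2 * (4 ^ j) ^ 2 := by ring
    _ ≤ 40000 ^ 2 * N ^ 2 * (16 * N) := by rw [h16]; exact Nat.mul_le_mul_left _ hj2
    _ = _ := by ring

lemma cauchy {α β : Type*} [DecidableEq β] (Z : Finset α) (V : Finset β) (φ : α → β)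
    (h : ∀ z ∈ Z, φ z ∈ V) :
    Z.card ^ 2 ≤ V.card * ((Z ×ˢ Z).filter (fun q => φ q.1 = φ q.2)).card := by
  classical
  have h1 : Z.card = ∑ v ∈ V, (Z.filter (fun z => φ z = v)).card :=
    Finset.card_eq_sum_card_fiberwise (fun z hz => h z hz)
  have h2 : ((Z ×ˢ Z).filter (fun q => φ q.1 = φ q.2)).card =
      ∑ v ∈ V, (Z.filter (fun z => φ z = v)).card ^ 2 := by
    rw [Finset.card_eq_sum_card_fiberwise (f := fun q => φ q.1) (t := V)
      (fun q hq => by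
        have hq := Finset.mem_coe.1 hq
        rw [Finset.mem_filter, Finset.mem_product] at hq
        exact h _ hq.1.1)]
    refine Finset.sum_congr rfl fun v _ => ?_
    rw [sq, ← Finset.card_product]
    congr 1
    ext q
    simp only [Finset.mem_filter, Finset.mem_product]
    constructor
    · rintro ⟨⟨⟨a, b⟩, c⟩, d⟩; exact ⟨⟨a, d⟩, b, by rw [← c, d]⟩
    · rintro ⟨⟨a, d⟩, b, c⟩; exact ⟨⟨⟨a, b⟩, by rw [c, d]⟩, d⟩
  rw [h2, h1]
  exact sq_sum_le_card_mul_sum_sq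

lemma main_large (p : ℕ) [Fact p.Prime] (hp : 2 < p) (α h γ : ZMod p) (hα : α ≠ 0)
    (f : ZMod p → ZMod p) (hf : ∀ a, f a = α * (a + h) ^ 2 + γ)
    (A : Finset (ZMod p)) (hA : A.Nonempty) 
    (hN : ((A ×ˢ A).image (fun q => f q.1 + q.2)).card * ((A.image f).card * A.card) ≤ p ^ 2) :
    A.card ^ 6 ≤ 2 * 160000 ^ 2 * ((A ×ˢ A).image (fun q => f q.1 + q.2)).card ^ 5 := by
  classical
  set D := (A ×ˢ A).image (fun q => f q.1 + q.2) with hD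
  set U := A.image f with hU
  have hDmem : ∀ u ∈ U, ∀ b ∈ A, u + b ∈ D := by
    intro u hu b hb
    obtain ⟨a, ha, rfl⟩ := Finset.mem_image.1 hu
    exact Finset.mem_image.2 ⟨(a, b), Finset.mem_product.2 ⟨ha, hb⟩, rfl⟩
  obtain ⟨a0, ha0⟩ := hA
  have hu0 : f a0 ∈ U := Finset.mem_image_of_mem _ ha0
  have cUD : U.card ≤ D.card :=
    Finset.card_le_card_of_injOn (fun u => u + a0) (fun u hu => hDmem u hu a0 ha0)
      (fun u _ v _ h => add_right_cancel h)
  have cAD : A.card ≤ D.card :=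
    Finset.card_le_card_of_injOn (fun b => f a0 + b) (fun b hb => hDmem _ hu0 b hb)
      (fun u _ v _ h => add_left_cancel h)
  have cDUA : D.card ≤ U.card * A.card := by
    have : D ⊆ (U ×ˢ A).image (fun q => q.1 + q.2) := by
      intro d hd
      obtain ⟨q, hq, rfl⟩ := Finset.mem_image.1 hd
      rw [Finset.mem_product] at hq
      exact Finset.mem_image.2 ⟨(f q.1, q.2), Finset.mem_product.2 ⟨Finset.mem_image_of_mem _ hq.1, hq.2⟩, rfl⟩
    exact (Finset.card_le_card this).trans (Finset.card_image_le.trans (Finset.card_product _ _).le)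
  have cAU : A.card ≤ 2 * U.card := by
    refine Finset.card_le_mul_card_image A 2 ?_
    intro v hv
    obtain ⟨a, ha, rfl⟩ := Finset.mem_image.1 hv
    refine (Finset.card_le_card (t := {a, -a - 2 * h}) ?_).trans Finset.card_le_two
    intro b hb
    have hb := (Finset.mem_filter.1 hb).2
    rw [hf, hf] at hb
    have h1 := mul_left_cancel₀ hα (add_right_cancel hb)
    have h2 : (b - a) * (b + a + 2 * h) = 0 := by linear_combination h1
    rw [Finset.mem_insert, Finset.mem_singleton]
    rcases mul_eq_zero.1 h2 with h3 | h3
    · left; exact sub_eq_zero.1 h3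
    · right; linear_combination h3
  have posA : 0 < A.card := Finset.card_pos.2 ⟨a0, ha0⟩
  have posU : 0 < U.card := Finset.card_pos.2 ⟨_, hu0⟩
  have posD : 0 < D.card := by omega
  let K := AlgebraicClosure (ZMod p)
  have : CharP K p := charP_of_injective_algebraMap (algebraMap (ZMod p) K).injective p
  have : Infinite K := IsAlgClosed.instInfinite
  let ι : ZMod p →+* K := algebraMap (ZMod p) K
  have hι : Function.Injective ι := ι.injective
  have hcast : ∀ n : ℕ, 0 < n → n < p → (n : K) ≠ 0 := by
    intro n h0 hn h
    rw [CharP.cast_eq_zero_iff K p] at h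
    exact absurd (Nat.le_of_dvd h0 h) (by omega)
  set N := D.card * (U.card * A.card) with hNdef
  let DK := D.image (fun d => ι (d + h))
  let UK := U.image ι
  let AK := A.image (fun a => ι (α⁻¹ * a))
  have cDK : DK.card ≤ D.card := Finset.card_image_le
  have cUK : UK.card ≤ U.card := Finset.card_image_le
  have cAK : AK.card ≤ A.card := Finset.card_image_le
  have hE := energy_upper (K := K) DK UK AK D.card N (by exact_mod_cast hcast 2 (by norm_num) hp)
    cDK (cUK.trans cUD) (cAK.trans cAD) (Nat.mul_le_mul_left _ cDUA)
    (Nat.mul_pos posD (Nat.mul_pos posU posA))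
    (Nat.mul_le_mul cDK (Nat.mul_le_mul cUK cAK))
    (fun n hn hn' => hcast n hn (by
      by_contra hle
      have : p ^ 2 ≤ n ^ 2 := Nat.pow_le_pow_left (not_lt.1 hle) 2
      nlinarith [Nat.pow_pos (n := 2) hn]))
  set Z := DK ×ˢ (UK ×ˢ AK) with hZ
  set E := ((Z ×ˢ Z).filter (fun z : (K × K × K) × (K × K × K) =>
      (z.1.1 - z.2.2.1) ^ 2 + z.1.2.2 = (z.2.1 - z.1.2.1) ^ 2 + z.2.2.2)).card with hEdef
  set Z0 := U ×ˢ (A ×ˢ A) with hZ0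
  have hCS := cauchy Z0 D (fun z => f z.2.1 + z.2.2) (by
    intro z hz
    simp only [hZ0, Finset.mem_product] at hz
    exact hDmem _ (Finset.mem_image_of_mem _ hz.2.1) _ hz.2.2)
  have hE0 : ((Z0 ×ˢ Z0).filter (fun q => f q.1.2.1 + q.1.2.2 = f q.2.2.1 + q.2.2.2)).card ≤ E := by
    refine Finset.card_le_card_of_injOn (fun q => 
      ((ι (q.1.1 + q.1.2.1 + h), ι q.2.1, ι (α⁻¹ * q.1.2.2)),
        (ι (q.2.1 + q.2.2.1 + h), ι q.1.1, ι (α⁻¹ * q.2.2.2)))) ?_ ?_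
    · intro q hq
      have hq := Finset.mem_coe.1 hq
      simp only [hZ0, Finset.mem_filter, Finset.mem_product] at hq
      obtain ⟨⟨⟨m1, m2, m3⟩, m4, m5, m6⟩, heq⟩ := hq
      rw [Finset.mem_coe, Finset.mem_filter]
      simp only [hZ, Finset.mem_product]
      refine ⟨⟨⟨?_, ?_, ?_⟩, ?_, ?_, ?_⟩, ?_⟩
      · exact Finset.mem_image_of_mem (fun d => ι (d + h)) (hDmem _ m1 _ m2)
      · exact Finset.mem_image_of_mem _ m4
      · exact Finset.mem_image_of_mem (fun a => ι (α⁻¹ * a)) m3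
      · exact Finset.mem_image_of_mem (fun d => ι (d + h)) (hDmem _ m4 _ m5)
      · exact Finset.mem_image_of_mem _ m1
      · exact Finset.mem_image_of_mem (fun a => ι (α⁻¹ * a)) m6
      · rw [← map_sub, ← map_sub, ← map_pow, ← map_pow, ← map_add, ← map_add]
        congr 1
        rw [hf, hf] at heq
        have hinv : α⁻¹ * α = 1 := inv_mul_cancel₀ hα
        linear_combination α⁻¹ * heq - ((q.1.2.1 + h) ^ 2 - (q.2.2.1 + h) ^ 2) * hinv
    · intro q _ r _ hqr
      simp only [Prod.mk.injEq] at hqr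
      obtain ⟨⟨b1, b2, b3⟩, b4, b5, b6⟩ := hqr
      have b1 := hι b1
      have b2 := hι b2
      have b3 := mul_left_cancel₀ (inv_ne_zero hα) (hι b3)
      have b4 := hι b4
      have b5 := hι b5
      have b6 := mul_left_cancel₀ (inv_ne_zero hα) (hι b6)
      rw [b5] at b1
      rw [b2] at b4
      have b1 := add_left_cancel (add_right_cancel b1)
      have b4 := add_left_cancel (add_right_cancel b4)
      exact Prod.ext (Prod.ext b5 (Prod.ext b1 b3)) (Prod.ext b2 (Prod.ext b4 b6))
  have cZ0 : Z0.card = U.card * (A.card * A.card) := by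
    rw [hZ0, Finset.card_product, Finset.card_product]
  rw [cZ0] at hCS
  have h1 := hCS.trans (Nat.mul_le_mul_left _ hE0)
  generalize D.card = d at *
  generalize U.card = u at *
  generalize A.card = a at *
  have h3 : (u * (a * a)) ^ 4 ≤ d ^ 2 * (160000 ^ 2 * N ^ 3) := by
    calc (u * (a * a)) ^ 4 = ((u * (a * a)) ^ 2) ^ 2 := by ring
      _ ≤ (d * E) ^ 2 := Nat.pow_le_pow_left h1 2
      _ = d ^ 2 * E ^ 2 := by ring
      _ ≤ _ := Nat.mul_le_mul_left _ hE
  have h4 : u * a ^ 5 ≤ 160000 ^ 2 * d ^ 5 := by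
    have hpos : 0 < u ^ 3 * a ^ 3 := by positivity
    refine Nat.le_of_mul_le_mul_left ?_ hpos
    calc u ^ 3 * a ^ 3 * (u * a ^ 5) = (u * (a * a)) ^ 4 := by ring
      _ ≤ d ^ 2 * (160000 ^ 2 * N ^ 3) := h3
      _ = _ := by rw [hNdef]; ring
  calc a ^ 6 = a * a ^ 5 := by ring
    _ ≤ 2 * u * a ^ 5 := Nat.mul_le_mul_right _ cAU
    _ = 2 * (u * a ^ 5) := by ring
    _ ≤ 2 * (160000 ^ 2 * d ^ 5) := Nat.mul_le_mul_left _ h4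
    _ = _ := by ring

end RQ

theorem stmt_6 :
    ∃ c : ℝ, 0 < c ∧ ∀ (p : ℕ), p.Prime → 2 < p →
      ∀ (f : Polynomial (ZMod p)), f.natDegree = 2 →
      ∀ A : Finset (ZMod p), (A.card : ℝ) ≤ (p : ℝ) ^ ((5 : ℝ) / 8) →
      c * (A.card : ℝ) ^ ((6 : ℝ) / 5) ≤
        (((A ×ˢ A).image (fun q => f.eval q.1 + q.2)).card : ℝ) := by
  refine ⟨1 / (2 * 160000 ^ 2), by norm_num, ?_⟩
  intro p hp hp2 f hf A hA
  have : Fact p.Prime := ⟨hp⟩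
  rcases A.eq_empty_or_nonempty with rfl | hne
  · simp
  set D := (A ×ˢ A).image (fun q => f.eval q.1 + q.2) with hD
  have key : A.card ^ 6 ≤ 2 * 160000 ^ 2 * D.card ^ 5 := by
    by_cases hN : D.card * ((A.image (fun a => f.eval a)).card * A.card) ≤ p ^ 2
    · have hlead : f.coeff 2 ≠ 0 := by
        rw [← hf, Polynomial.coeff_natDegree, Ne, Polynomial.leadingCoeff_eq_zero]
        rintro rfl
        simp at hf
      have h2 : (2 : ZMod p) ≠ 0 := by
        have h3 : ((2 : ℕ) : ZMod p) ≠ 0 := by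
          rw [Ne, ZMod.natCast_eq_zero_iff]
          exact fun h => absurd (Nat.le_of_dvd (by norm_num) h) (by omega)
        exact_mod_cast h3
      refine RQ.main_large p hp2 (f.coeff 2) (f.coeff 1 / (2 * f.coeff 2))
        (f.coeff 0 - f.coeff 1 ^ 2 / (4 * f.coeff 2)) hlead (fun a => f.eval a) ?_ A hne hN
      intro a
      change f.eval a = _
      rw [Polynomial.eval_eq_sum_range, hf]
      simp only [Finset.sum_range_succ, Finset.sum_range_zero]
      have h4 : (4 : ZMod p) = 2 * 2 := by norm_num
      rw [h4]
      field_simp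
      ring
    · have h1 : (A.image (fun a => f.eval a)).card ≤ A.card := Finset.card_image_le
      have h2 : p ^ 2 ≤ D.card * (A.card * A.card) :=
        (not_le.1 hN).le.trans (Nat.mul_le_mul_left _ (Nat.mul_le_mul_right _ h1))
      have h3 : A.card ^ 8 ≤ p ^ 5 := by
        have h4 : (A.card : ℝ) ^ 8 ≤ ((p : ℝ) ^ ((5 : ℝ) / 8)) ^ 8 :=
          pow_le_pow_left₀ (by positivity) hA 8
        have h5 : ((p : ℝ) ^ ((5 : ℝ) / 8)) ^ 8 = (p : ℝ) ^ 5 := by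
          rw [← Real.rpow_natCast ((p : ℝ) ^ ((5 : ℝ) / 8)), ← Real.rpow_mul (by positivity),
            ← Real.rpow_natCast]
          norm_num
        rw [h5] at h4
        exact_mod_cast h4
      have h5 : A.card ^ 16 ≤ A.card ^ 10 * D.card ^ 5 := by
        calc A.card ^ 16 = (A.card ^ 8) ^ 2 := by ring
          _ ≤ (p ^ 5) ^ 2 := Nat.pow_le_pow_left h3 2
          _ = (p ^ 2) ^ 5 := by ring
          _ ≤ (D.card * (A.card * A.card)) ^ 5 := Nat.pow_le_pow_left h2 5
          _ = _ := by ring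
      have hpos : 0 < A.card ^ 10 := Nat.pow_pos (Finset.card_pos.2 hne)
      have h6 : A.card ^ 6 ≤ D.card ^ 5 := by
        refine Nat.le_of_mul_le_mul_left ?_ hpos
        calc A.card ^ 10 * A.card ^ 6 = A.card ^ 16 := by ring
          _ ≤ _ := h5
      omega
  have key2 : (A.card : ℝ) ^ 6 ≤ (2 * 160000 ^ 2 * (D.card : ℝ)) ^ 5 := by
    have h1 : (A.card : ℝ) ^ 6 ≤ 2 * 160000 ^ 2 * (D.card : ℝ) ^ 5 := by exact_mod_cast key
    refine h1.trans ?_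
    rw [mul_pow]
    have : (0 : ℝ) ≤ (D.card : ℝ) ^ 5 := by positivity
    exact mul_le_mul_of_nonneg_right (by norm_num) this
  have key3 : (A.card : ℝ) ^ ((6 : ℝ) / 5) ≤ 2 * 160000 ^ 2 * (D.card : ℝ) := by
    have h1 : (A.card : ℝ) ^ ((6 : ℝ) / 5) = ((A.card : ℝ) ^ 6) ^ ((1 : ℝ) / 5) := by
      rw [← Real.rpow_natCast, ← Real.rpow_mul (by positivity)]
      norm_num
    rw [h1]
    refine (Real.rpow_le_rpow (by positivity) key2 (by norm_num)).trans ?_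
    rw [← Real.rpow_natCast, ← Real.rpow_mul (by positivity)]
    norm_num
  rw [one_div, inv_mul_le_iff₀ (by norm_num)]
  exact key3
end

section
/- There exists a constant c > 0 such that for every prime p > 2, every generator h of F_p^*, and every integer N with 1 ≤ N ≤ p^(2/3), the set {h^x + h^y : x,y ∈ ℤ, 1 ≤ x,y ≤ N} has cardinality at least c·N^(3/2). -/
open Finset
namespace SumPow
open MvPolynomial

/-- A (non-vertical) line `t ↦ (t, a + b t, c + e t)` is encoded by `(a, b, c, e)`. -/
noncomputable def res {K : Type*} [Field K] (l : K × K × K × K) :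
    MvPolynomial (Fin 3) K →ₐ[K] Polynomial K :=
  aeval ![Polynomial.X, Polynomial.C l.1 + Polynomial.C l.2.1 * Polynomial.X,
    Polynomial.C l.2.2.1 + Polynomial.C l.2.2.2 * Polynomial.X]

lemma res_natDegree {K : Type*} [Field K] (l : K × K × K × K) (F : MvPolynomial (Fin 3) K) :
    (res l F).natDegree ≤ F.totalDegree := by
  have := MvPolynomial.aeval_natDegree_le (m := F.totalDegree) (n := 1) F le_rfl
    (![Polynomial.X, Polynomial.C l.1 + Polynomial.C l.2.1 * Polynomial.X,
    Polynomial.C l.2.2.1 + Polynomial.C l.2.2.2 * Polynomial.X] : Fin 3 → Polynomial K) (by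
      intro i
      fin_cases i
      · simp
      · simp only [Fin.mk_one, Matrix.cons_val_one, Matrix.cons_val_zero]
        compute_degree
      · simp only [Fin.reduceFinMk, Matrix.cons_val]
        compute_degree)
  simpa [res] using this

lemma finrank_rtd (K : Type*) [Field K] (m : ℕ) :
    6 * Module.finrank K (restrictTotalDegree (Fin 3) K m) = (m + 1) * (m + 2) * (m + 3) := by
  have h1 : Module.finrank K (restrictTotalDegree (Fin 3) K m) =
      ∑ j ∈ Finset.range (m + 1), (j + 2).choose 2 := by
    have hs : {n : Fin 3 →₀ ℕ | Finsupp.degree n ≤ m} =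
        ((Finset.range (m + 1)).biUnion fun j => Finset.finsuppAntidiag (Finset.univ : Finset (Fin 3)) j : Finset _) := by
      ext n
      simp only [Set.mem_ofPred_eq, Finset.coe_biUnion, Set.mem_iUnion, Finset.mem_coe,
        Finset.mem_finsuppAntidiag, Finset.mem_range]
      constructor
      · intro h
        exact ⟨n.degree, by omega, by simp [Finsupp.degree_eq_sum], by simp⟩
      · rintro ⟨j, hj, h, -⟩
        rw [Finsupp.degree_eq_sum]
        change ∑ i, n i = j at h
        omega
    have h2 := Module.finrank_eq_nat_card_basis
      (basisRestrictSupport K {n : Fin 3 →₀ ℕ | Finsupp.degree n ≤ m})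
    have h3 : restrictTotalDegree (Fin 3) K m =
      restrictSupport K {n : Fin 3 →₀ ℕ | Finsupp.degree n ≤ m} := by
      rfl
    rw [h3, h2, hs]
    simp only [Nat.card_eq_fintype_card, Finset.coe_sort_coe, Fintype.card_coe]
    rw [Finset.card_biUnion]
    · refine Finset.sum_congr rfl fun j _ => ?_
      rw [Finset.card_finsuppAntidiag_nat_eq_choose]
      simp only [Finset.card_univ, Fintype.card_fin]
      rw [show 3 + j - 1 = j + 2 by omega, Nat.choose_symm_add]
    · intro i _ j _ hij
      rw [Function.onFun, Finset.disjoint_left]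
      intro n hn hn'
      rw [Finset.mem_finsuppAntidiag] at hn hn'
      exact hij (hn.1.symm.trans hn'.1)
  rw [h1]
  clear h1
  induction m with
  | zero => simp
  | succ m ih =>
    rw [Finset.sum_range_succ, mul_add, ih]
    have : 2 * (m + 1 + 2).choose 2 = (m + 3) * (m + 2) := by
      rw [Nat.choose_two_right, Nat.mul_div_cancel']
      · rfl
      · exact (Nat.even_mul_pred_self _).two_dvd
    nlinarith
    
lemma res_X0 {K : Type*} [Field K] (l : K × K × K × K) : res l (X 0) = Polynomial.X := by
  simp [res]

/-- a polynomial separating two lines -/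
lemma exists_sep {K : Type*} [Field K] (l l' : K × K × K × K) (h : l ≠ l') :
    ∃ B : MvPolynomial (Fin 3) K, B.totalDegree ≤ 1 ∧ res l' B = 0 ∧ res l B ≠ 0 := by
  have key : ∀ (i : Fin 3) (a b : K),
      (X i - C a - C b * X 0 : MvPolynomial (Fin 3) K).totalDegree ≤ 1 := by
    intro i a b
    refine (totalDegree_sub _ _).trans (max_le ((totalDegree_sub _ _).trans (max_le ?_ ?_)) ?_)
    · simp
    · simp
    · refine (totalDegree_mul _ _).trans ?_
      simp
  have pol : ∀ a b a' b' : K, (Polynomial.C a + Polynomial.C b * Polynomial.X - Polynomial.C a'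
      - Polynomial.C b' * Polynomial.X) = 0 → a = a' ∧ b = b' := by
    intro a b a' b' h
    have h0 := congrArg (fun q => Polynomial.coeff q 0) h
    have h1 := congrArg (fun q => Polynomial.coeff q 1) h
    simp [Polynomial.coeff_C] at h0 h1
    exact ⟨sub_eq_zero.mp h0, sub_eq_zero.mp h1⟩
  by_cases h1 : l.1 = l'.1 ∧ l.2.1 = l'.2.1
  · refine ⟨X 2 - C l'.2.2.1 - C l'.2.2.2 * X 0, key _ _ _, ?_, ?_⟩
    · simp [res]
    · intro h0
      simp [res] at h0
      have := pol _ _ _ _ h0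
      exact h (Prod.ext h1.1 (Prod.ext h1.2 (Prod.ext this.1 this.2)))
  · refine ⟨X 1 - C l'.1 - C l'.2.1 * X 0, key _ _ _, ?_, ?_⟩
    · simp [res]
    · intro h0
      simp [res] at h0
      exact h1 (pol _ _ _ _ h0)

lemma exists_sep_fin {K : Type*} [Field K] (L : Finset (K × K × K × K)) (l : K × K × K × K)
    (hl : l ∉ L) :
    ∃ B : MvPolynomial (Fin 3) K, B.totalDegree ≤ L.card ∧ (∀ l' ∈ L, res l' B = 0) ∧
      res l B ≠ 0 := by
  classical
  induction L using Finset.induction_on with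
  | empty => exact ⟨1, by simp, by simp, by simp⟩
  | insert a L ha ih =>
    rw [Finset.mem_insert, not_or] at hl
    obtain ⟨B, hB1, hB2, hB3⟩ := ih hl.2
    obtain ⟨B', h1, h2, h3⟩ := exists_sep l a hl.1
    refine ⟨B' * B, ?_, ?_, ?_⟩
    · rw [Finset.card_insert_of_notMem ha]
      exact (totalDegree_mul _ _).trans (by omega)
    · intro l' hl'
      rw [Finset.mem_insert] at hl'
      rcases hl' with rfl | hl'
      · simp [h2]
      · simp [hB2 l' hl']
    · rw [map_mul]
      exact mul_ne_zero h3 hB3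

lemma mul_mem_rtd {K : Type*} [Field K] {P A : MvPolynomial (Fin 3) K} {d m n : ℕ}
    (hP : P.totalDegree ≤ d) (hA : A ∈ restrictTotalDegree (Fin 3) K n) (hm : d + n ≤ m) :
    P * A ∈ restrictTotalDegree (Fin 3) K m := by
  rw [mem_restrictTotalDegree] at *
  exact (totalDegree_mul _ _).trans (by omega)

set_option maxHeartbeats 1600000 in
lemma dim_ineq {K : Type*} [Field K] {P Q : MvPolynomial (Fin 3) K} {d e : ℕ} (hP : Prime P)
    (hPQ : ¬ P ∣ Q) (hd : P.totalDegree = d) (he : Q.totalDegree = e)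
    (L : Finset (K × K × K × K)) (hL : ∀ l ∈ L, res l P = 0 ∧ res l Q = 0) (n s : ℕ)
    (hs : s + L.card ≤ n + d + e + 1) :
    L.card * s + Module.finrank K (restrictTotalDegree (Fin 3) K (n + e)) +
      Module.finrank K (restrictTotalDegree (Fin 3) K (n + d)) ≤
      Module.finrank K (restrictTotalDegree (Fin 3) K (n + d + e)) +
      Module.finrank K (restrictTotalDegree (Fin 3) K n) := by
  classical
  have hB : ∀ l : L, ∃ B : MvPolynomial (Fin 3) K, B.totalDegree ≤ (L.erase l).card ∧
      (∀ l' ∈ L.erase l, res l' B = 0) ∧ res (l : K × K × K × K) B ≠ 0 :=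
    fun l => exists_sep_fin _ _ (Finset.notMem_erase _ _)
  choose B hB1 hB2 hB3 using hB
  let toMv : Polynomial K →ₐ[K] MvPolynomial (Fin 3) K := Polynomial.aeval (X 0)
  have htoMv : ∀ (l) (g : Polynomial K), res l (toMv g) = g := by
    intro l g
    have : (res l).comp toMv = AlgHom.id K _ := by
      ext
      simp [toMv, res_X0]
    exact congrArg (fun f => f g) this
  have htd : ∀ (g : Polynomial K), (toMv g).totalDegree ≤ g.natDegree := by
    intro g
    have : toMv g = ∑ i ∈ Finset.range (g.natDegree + 1), C (g.coeff i) * X 0 ^ i := by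
      simp only [toMv]
      rw [Polynomial.aeval_eq_sum_range]
      simp [MvPolynomial.smul_eq_C_mul]
    rw [this]
    refine (totalDegree_finsetSum _ _).trans (Finset.sup_le fun i hi => ?_)
    refine (totalDegree_mul _ _).trans ?_
    simp only [totalDegree_C, totalDegree_X_pow, zero_add]
    rw [Finset.mem_range] at hi
    omega
  let Θ : ((L → Polynomial.degreeLT K s) × restrictTotalDegree (Fin 3) K (n + e) ×
      restrictTotalDegree (Fin 3) K (n + d)) →ₗ[K] MvPolynomial (Fin 3) K :=
    LinearMap.coprod
      (∑ l : L, (LinearMap.mulLeft K (B l)) ∘ₗ toMv.toLinearMap ∘ₗ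
        (Polynomial.degreeLT K s).subtype ∘ₗ LinearMap.proj l)
      (LinearMap.coprod ((LinearMap.mulLeft K P) ∘ₗ Submodule.subtype _)
        ((LinearMap.mulLeft K Q) ∘ₗ Submodule.subtype _))
  have hΘ : ∀ x, Θ x = ∑ l : L, B l * toMv (x.1 l) + (P * x.2.1 + Q * x.2.2) := by
    intro x
    simp [Θ]
  let Ξ : restrictTotalDegree (Fin 3) K n →ₗ[K] ((L → Polynomial.degreeLT K s) ×
      restrictTotalDegree (Fin 3) K (n + e) × restrictTotalDegree (Fin 3) K (n + d)) :=
    LinearMap.prod 0 (LinearMap.prod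
      (LinearMap.codRestrict _ (-((LinearMap.mulLeft K Q) ∘ₗ Submodule.subtype _)) (fun A => by
        exact Submodule.neg_mem _ (mul_mem_rtd he.le A.2 (by omega))))
      (LinearMap.codRestrict _ ((LinearMap.mulLeft K P) ∘ₗ Submodule.subtype _) (fun A => by
        exact mul_mem_rtd hd.le A.2 (by omega))))
  have hrange : LinearMap.range Θ ≤ restrictTotalDegree (Fin 3) K (n + d + e) := by
    rintro _ ⟨x, rfl⟩
    rw [hΘ]
    refine Submodule.add_mem _ (Submodule.sum_mem _ fun l _ => ?_) (Submodule.add_mem _ ?_ ?_)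
    · rw [mem_restrictTotalDegree]
      have h1 := hB1 l
      rw [Finset.card_erase_of_mem l.2] at h1
      have h2 : 0 < L.card := Finset.card_pos.mpr ⟨_, l.2⟩
      by_cases h0 : (x.1 l : Polynomial K) = 0
      · simp [h0]
      have h3 := (x.1 l).2
      rw [Polynomial.mem_degreeLT, Polynomial.degree_eq_natDegree h0] at h3
      have h3 : (x.1 l : Polynomial K).natDegree < s := by exact_mod_cast h3
      have h4 := htd (x.1 l)
      exact (totalDegree_mul _ _).trans (by omega)
    · exact mul_mem_rtd hd.le x.2.1.2 (by omega)
    · exact mul_mem_rtd he.le x.2.2.2 (by omega)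
  have hker : LinearMap.ker Θ ≤ LinearMap.range Ξ := by
    intro x hx
    rw [LinearMap.mem_ker, hΘ] at hx
    have hx1 : ∀ l : L, (x.1 l : Polynomial K) = 0 := by
      intro l
      have := congrArg (res (l : K × K × K × K)) hx
      rw [map_add, map_add, map_mul, map_mul, (hL l l.2).1, (hL l l.2).2, map_sum,
        Finset.sum_eq_single l] at this
      · simp [htoMv] at this
        have h9 := this.resolve_left (hB3 l)
        rw [h9]
        rfl
      · intro l' _ hl'
        rw [map_mul, hB2 l' l, zero_mul]
        rw [Finset.mem_erase]
        exact ⟨fun h => hl' (Subtype.ext h.symm), l.2⟩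
      · simp
    have hx2 : P * (x.2.1 : MvPolynomial (Fin 3) K) + Q * (x.2.2 : MvPolynomial (Fin 3) K) = 0 := by
      simpa [hx1] using hx
    have hdv : P ∣ (x.2.2 : MvPolynomial (Fin 3) K) := by
      have : P ∣ Q * (x.2.2 : MvPolynomial (Fin 3) K) :=
        ⟨-(x.2.1 : MvPolynomial (Fin 3) K), by linear_combination hx2⟩
      exact (hP.dvd_or_dvd this).resolve_left hPQ
    obtain ⟨A, hA⟩ := hdv
    have hA1 : (x.2.1 : MvPolynomial (Fin 3) K) = -(Q * A) := by
      apply mul_left_cancel₀ hP.ne_zero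
      rw [hA] at hx2
      linear_combination hx2
    have hAm : A ∈ restrictTotalDegree (Fin 3) K n := by
      rw [mem_restrictTotalDegree]
      by_cases h0 : A = 0
      · simp [h0]
      have h1 := x.2.2.2
      rw [mem_restrictTotalDegree, hA, totalDegree_mul_of_isDomain hP.ne_zero h0] at h1
      omega
    refine ⟨⟨A, hAm⟩, ?_⟩
    refine Prod.ext ?_ (Prod.ext ?_ ?_)
    · funext l
      exact Subtype.ext (hx1 l).symm
    · exact Subtype.ext hA1.symm
    · exact Subtype.ext hA.symm
  have : Module.Finite K (Polynomial.degreeLT K s) := 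
    Module.Finite.equiv (Polynomial.degreeLTEquiv K s).symm
  have hfin : Module.finrank K (Polynomial.degreeLT K s) = s := by
    rw [(Polynomial.degreeLTEquiv K s).finrank_eq]; simp
  have r1 := LinearMap.finrank_range_add_finrank_ker Θ
  have r2 := Submodule.finrank_mono hrange
  have r3 := Submodule.finrank_mono hker
  have r4 := LinearMap.finrank_range_le Ξ
  rw [Module.finrank_prod, Module.finrank_prod, Module.finrank_pi_fintype] at r1
  simp only [hfin, Finset.sum_const, Finset.card_univ, Fintype.card_coe, smul_eq_mul] at r1
  omega

theorem bezout {K : Type*} [Field K] {P Q : MvPolynomial (Fin 3) K} (hP : Prime P)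
    (hPQ : ¬ P ∣ Q) (L : Finset (K × K × K × K)) (hL : ∀ l ∈ L, res l P = 0 ∧ res l Q = 0) :
    L.card ≤ P.totalDegree * Q.totalDegree := by
  obtain ⟨d, hd⟩ : ∃ d, P.totalDegree = d := ⟨_, rfl⟩
  obtain ⟨e, he⟩ : ∃ e, Q.totalDegree = e := ⟨_, rfl⟩
  rw [hd, he]
  by_contra! hlt
  obtain ⟨k, hk⟩ : ∃ k, L.card = k := ⟨_, rfl⟩
  rw [hk] at hlt
  obtain ⟨n, hn⟩ : ∃ n, n = k ^ 2 + d * e * (d + e + 4) + 1 := ⟨_, rfl⟩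
  have hkn : k ≤ n := by
    have : 0 ≤ d * e * (d + e + 4) := Nat.zero_le _
    nlinarith
  obtain ⟨s, hs⟩ : ∃ s, s + k = n + d + e + 1 := ⟨n + d + e + 1 - k, by omega⟩
  have key := dim_ineq hP hPQ hd he L hL n s (by omega)
  rw [hk] at key
  have f1 := finrank_rtd K (n + e)
  have f2 := finrank_rtd K (n + d)
  have f3 := finrank_rtd K (n + d + e)
  have f4 := finrank_rtd K n
  have k2 : 6 * (k * s) + (n + e + 1) * (n + e + 2) * (n + e + 3) +
      (n + d + 1) * (n + d + 2) * (n + d + 3) ≤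
      (n + d + e + 1) * (n + d + e + 2) * (n + d + e + 3) + (n + 1) * (n + 2) * (n + 3) := by
    omega
  have k3 : 2 * (k * s) ≤ d * e * (2 * n + d + e + 4) := by
    nlinarith
  zify at *
  have hs' : (s : ℤ) = n + d + e + 1 - k := by linarith
  rw [hs'] at k3
  have : (1 : ℤ) ≤ k - d * e := by linarith
  have hde : (0 : ℤ) ≤ d * e := by positivity
  have h5 : 2 * (n : ℤ) * 1 ≤ 2 * n * (k - d * e) := by
    apply mul_le_mul_of_nonneg_left this; positivity
  have h6 : (0 : ℤ) ≤ k * (d + e) := by positivity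
  have h7 : (0 : ℤ) ≤ d * e * (d + e + 4) := by positivity
  nlinarith

end SumPow

namespace SumPow
open MvPolynomial

lemma component {K ι : Type*} [Field K] (Q : Finset ι) (ℓ : ι → K × K × K × K) (A : ℕ)
    [∀ H : MvPolynomial (Fin 3) K, DecidablePred fun q => res (ℓ q) H = 0]
    (hA : ∀ H : MvPolynomial (Fin 3) K, Prime H →
      (Q.filter fun q => res (ℓ q) H = 0).card ≤ A * H.totalDegree)
    (F : MvPolynomial (Fin 3) K) (hF : F ≠ 0) :
    (Q.filter fun q => res (ℓ q) F = 0).card ≤ A * F.totalDegree := by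
  classical
  revert hF
  refine UniqueFactorizationMonoid.induction_on_prime F (fun h => absurd rfl h) ?_ ?_
  · intro x hx _
    rw [Finset.card_eq_zero.mpr]
    · omega
    · rw [Finset.filter_eq_empty_iff]
      intro q _ h0
      have := hx.map (res (ℓ q))
      rw [h0] at this
      exact not_isUnit_zero this
  · intro a H ha hH ih _
    rw [totalDegree_mul_of_isDomain hH.ne_zero ha, mul_add]
    refine le_trans ?_ (add_le_add (hA H hH) (ih ha))
    refine le_trans (Finset.card_le_card ?_) (Finset.card_union_le _ _)
    intro q hq
    simp only [Finset.mem_filter, Finset.mem_union, map_mul, mul_eq_zero] at hq ⊢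
    tauto

/-- rescaling of variables -/
noncomputable def sc {K : Type*} [Field K] (v : Fin 3 → K) :
    MvPolynomial (Fin 3) K →ₐ[K] MvPolynomial (Fin 3) K := aeval (fun i => C (v i) * X i)

lemma coeff_sc {K : Type*} [Field K] (v : Fin 3 → K) (F : MvPolynomial (Fin 3) K)
    (e : Fin 3 →₀ ℕ) : coeff e (sc v F) = (∏ i, v i ^ e i) * coeff e F := by
  induction F using MvPolynomial.induction_on' with
  | monomial u a =>
    have : sc v (monomial u a) = monomial u ((∏ i, v i ^ u i) * a) := by
      rw [sc, aeval_monomial, Finsupp.prod_fintype _ _ (by simp)]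
      rw [monomial_eq, Finsupp.prod_fintype _ _ (by simp)]
      simp only [mul_pow, Finset.prod_mul_distrib, algebraMap_eq, map_mul, map_prod, map_pow]
      ring
    rw [this, coeff_monomial, coeff_monomial]
    split_ifs with h
    · rw [h]
    · simp
  | add p q hp hq => simp [hp, hq, mul_add]

lemma sc_sc {K : Type*} [Field K] (v w : Fin 3 → K) (F : MvPolynomial (Fin 3) K) :
    sc v (sc w F) = sc (fun i => v i * w i) F := by
  ext e
  simp only [coeff_sc, mul_pow, Finset.prod_mul_distrib]
  ring

lemma sc_one {K : Type*} [Field K] (F : MvPolynomial (Fin 3) K) :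
    sc (fun _ => 1) F = F := by
  ext e
  simp [coeff_sc]

lemma sc_totalDegree {K : Type*} [Field K] (v : Fin 3 → K) (hv : ∀ i, v i ≠ 0)
    (F : MvPolynomial (Fin 3) K) : (sc v F).totalDegree = F.totalDegree := by
  have : (sc v F).support = F.support := by
    ext e
    rw [mem_support_iff, mem_support_iff, coeff_sc]
    have : (∏ i, v i ^ e i) ≠ 0 := Finset.prod_ne_zero_iff.mpr fun i _ => pow_ne_zero _ (hv i)
    simp [this]
  rw [totalDegree, totalDegree, this]

lemma sc_prime {K : Type*} [Field K] (v : Fin 3 → K) (hv : ∀ i, v i ≠ 0)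
    (F : MvPolynomial (Fin 3) K) (hF : Prime F) : Prime (sc v F) := by
  let E : MvPolynomial (Fin 3) K ≃ₐ[K] MvPolynomial (Fin 3) K :=
    AlgEquiv.ofAlgHom (sc v) (sc fun i => (v i)⁻¹)
      (by
        apply AlgHom.ext
        intro F
        simp only [AlgHom.comp_apply, sc_sc, AlgHom.id_apply]
        simp only [mul_inv_cancel₀ (hv _)]
        exact sc_one F)
      (by
        apply AlgHom.ext
        intro F
        simp only [AlgHom.comp_apply, sc_sc, AlgHom.id_apply]
        simp only [inv_mul_cancel₀ (hv _)]
        exact sc_one F)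
  have := (MulEquiv.prime_iff E.toMulEquiv (p := F)).mpr hF
  exact this

lemma sc_dvd {K : Type*} [Field K] (v : Fin 3 → K)
    (F : MvPolynomial (Fin 3) K) (hF : F ≠ 0) (hd : F ∣ sc v F) (hv : ∀ i, v i ≠ 0)
    (e e' : Fin 3 →₀ ℕ) (he : e ∈ F.support) (he' : e' ∈ F.support) :
    (∏ i, v i ^ e i) = ∏ i, v i ^ e' i := by
  obtain ⟨c, hc⟩ := hd
  have hc0 : c ≠ 0 := by
    rintro rfl
    have h1 := congrArg (coeff e) hc
    rw [coeff_sc, mul_zero, coeff_zero] at h1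
    have : (∏ i, v i ^ e i) ≠ 0 := Finset.prod_ne_zero_iff.mpr fun i _ => pow_ne_zero _ (hv i)
    rw [mem_support_iff] at he
    exact mul_ne_zero this he h1
  have h1 := congrArg totalDegree hc
  rw [sc_totalDegree v hv, totalDegree_mul_of_isDomain hF hc0] at h1
  have h2 : c.totalDegree = 0 := by omega
  rw [totalDegree_eq_zero_iff_eq_C] at h2
  have key : ∀ e ∈ F.support, (∏ i, v i ^ e i) = coeff 0 c := by
    intro e he
    have h3 := congrArg (coeff e) hc
    rw [coeff_sc, h2, mul_comm F, coeff_C_mul] at h3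
    rw [mem_support_iff] at he
    exact mul_right_cancel₀ he h3
  rw [key e he, key e' he']


def l1 {K : Type*} [Field K] (g ν : K) (q : ℤ × ℤ × ℤ) : K × K × K × K :=
  (g ^ q.1, -g ^ q.2.1, g ^ q.2.2, -ν * g ^ (-q.2.1))

lemma l1_inj {K : Type*} [Field K] {g ν : K} {T : ℤ}
    (hT : ∀ n : ℤ, g ^ n = 1 → |n| < T → n = 0) (hg : g ≠ 0) (q q' : ℤ × ℤ × ℤ)
    (h1 : |q.1 - q'.1| < T) (h2 : |q.2.1 - q'.2.1| < T) (h3 : |q.2.2 - q'.2.2| < T)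
    (h : l1 g ν q = l1 g ν q') : q = q' := by
  have key : ∀ a b : ℤ, g ^ a = g ^ b → |a - b| < T → a = b := by
    intro a b hab h
    have := hT (a - b) (by rw [zpow_sub₀ hg, hab, div_self (zpow_ne_zero _ hg)]) h
    omega
  simp only [l1, Prod.mk.injEq, neg_inj] at h
  exact Prod.ext (key _ _ h.1 h1) (Prod.ext (key _ _ h.2.1 h2) (key _ _ h.2.2.1 h3))

lemma res_sc {K : Type*} [Field K] (l l' : K × K × K × K) (v : Fin 3 → K)
    (h1 : l'.1 = v 1 * l.1) (h2 : v 0 * l'.2.1 = v 1 * l.2.1)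
    (h3 : l'.2.2.1 = v 2 * l.2.2.1) (h4 : v 0 * l'.2.2.2 = v 2 * l.2.2.2)
    (F : MvPolynomial (Fin 3) K) :
    res l (sc v F) = (res l' F).comp (Polynomial.C (v 0) * Polynomial.X) := by
  have : (res l).comp (sc v) =
      (Polynomial.aeval (Polynomial.C (v 0) * Polynomial.X)).comp (res l') := by
    apply MvPolynomial.algHom_ext
    intro i
    fin_cases i
    · simp [res, sc]
    · have hh := congrArg (Polynomial.C (R := K)) h2
      simp only [map_mul] at hh
      simp [res, sc, h1]
      linear_combination -Polynomial.X * hh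
    · have hh := congrArg (Polynomial.C (R := K)) h4
      simp only [map_mul] at hh
      simp [res, sc, h3]
      linear_combination -Polynomial.X * hh
  have := congrArg (fun f => f F) this
  simpa [Polynomial.aeval_def, Polynomial.comp] using this

lemma shift_vanish {K : Type*} [Field K] {g ν : K} (hg : g ≠ 0) (τ : Fin 3 → ℤ)
    (hτ : τ 1 + τ 2 = 2 * τ 0) (u : ℤ) (q : ℤ × ℤ × ℤ) (F : MvPolynomial (Fin 3) K)
    (h : res (l1 g ν q) F = 0) :
    res (l1 g ν (q.1 + u * τ 1, q.2.1 + u * (τ 1 - τ 0), q.2.2 + u * τ 2))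
      (sc (fun i => g ^ (-u * τ i)) F) = 0 := by
  rw [res_sc _ (l1 g ν q), h, Polynomial.zero_comp]
  · simp only [l1]
    rw [← zpow_add₀ hg]; congr 1; ring
  · simp only [l1, mul_neg]
    rw [← zpow_add₀ hg, ← zpow_add₀ hg]; congr 2; ring
  · simp only [l1]
    rw [← zpow_add₀ hg]; congr 1; ring
  · simp only [l1]
    rw [mul_left_comm, mul_left_comm (g ^ (-u * τ 2)), ← zpow_add₀ hg, ← zpow_add₀ hg]; congr 2
    rw [show τ 2 = 2 * τ 0 - τ 1 by linarith]; ring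

lemma union_count {α : Type*} [DecidableEq α] (Z : ℕ → Finset α) (a δ m : ℕ)
    (h1 : ∀ u < m, a ≤ (Z u).card)
    (h2 : ∀ u < m, ∀ v < m, u ≠ v → (Z u ∩ Z v).card ≤ δ) :
    m * a ≤ ((Finset.range m).biUnion Z).card + m ^ 2 * δ := by
  induction m with
  | zero => simp
  | succ m ih =>
    have ih' := ih (fun u hu => h1 u (by omega)) (fun u hu v hv => h2 u (by omega) v (by omega))
    rw [Finset.range_add_one, Finset.biUnion_insert]
    have h3 := Finset.card_union_add_card_inter (Z m) ((Finset.range m).biUnion Z)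
    have h4 : (Z m ∩ (Finset.range m).biUnion Z).card ≤ m * δ := by
      rw [Finset.inter_biUnion]
      refine Finset.card_biUnion_le.trans ?_
      refine (Finset.sum_le_card_nsmul _ _ δ ?_).trans (by simp)
      intro u hu
      rw [Finset.mem_range] at hu
      exact h2 m (by omega) u (by omega) (by omega)
    have h5 := h1 m (by omega)
    nlinarith

end SumPow

namespace SumPow
open MvPolynomial

lemma exists_mon {K : Type*} [Field K] (H : MvPolynomial (Fin 3) K) (h : ¬ X 0 ∣ H) :
    ∃ e ∈ H.support, e 0 = 0 := by
  by_contra! hc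
  apply h
  rw [X_dvd_iff_modMonomial_eq_zero]
  ext e
  rw [coeff_zero]
  by_cases he : Finsupp.single 0 1 ≤ e
  · exact coeff_modMonomial_of_le _ he
  · rw [coeff_modMonomial_of_not_le _ he]
    by_contra h0
    have := hc e (mem_support_iff.mpr h0)
    rw [Finsupp.single_le_iff] at he
    omega

lemma not_X_dvd {K : Type*} [Field K] (H : MvPolynomial (Fin 3) K) (hH : Prime H)
    (l : K × K × K × K) (hl : res l H = 0) : ¬ X 0 ∣ H := by
  intro hd
  have hX : Irreducible (X 0 : MvPolynomial (Fin 3) K) := (MvPolynomial.X_prime (i := 0)).irreducible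
  obtain ⟨c, hc⟩ := (hX.associated_of_dvd hH.irreducible hd).symm.dvd
  have := congrArg (res l) hc
  rw [map_mul, hl, zero_mul, res_X0] at this
  exact Polynomial.X_ne_zero this

lemma res_eval0 {K : Type*} [Field K] (H : MvPolynomial (Fin 3) K) 
    (l : K × K × K × K) : (res l H).eval 0 = eval ![0, l.1, l.2.2.1] H := by
  have : (Polynomial.aeval (0 : K)).comp (res l) = aeval ![0, l.1, l.2.2.1] := by
    apply MvPolynomial.algHom_ext
    intro i
    fin_cases i <;> simp [res]
  have := congrArg (fun f => f H) this
  simpa [Polynomial.coe_aeval_eq_eval, MvPolynomial.coe_aeval_eq_eval] using this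

/-- Schwartz–Zippel on the plane `Y = 0`. -/
lemma sz_plane {K : Type*} [Field K] [DecidableEq K] (H : MvPolynomial (Fin 3) K) (h : ¬ X 0 ∣ H) 
    (S : Finset K) :
    ((S ×ˢ S).filter fun q => eval ![0, q.1, q.2] H = 0).card ≤ H.totalDegree * S.card := by
  obtain ⟨e, he, he0⟩ := exists_mon H h
  set H0 := (finSuccEquiv K 2 H).coeff 0 with hH0
  have hne : H0 ≠ 0 := by
    intro h0
    have h1 := congrArg (coeff e.tail) h0
    rw [hH0, finSuccEquiv_coeff_coeff, coeff_zero] at h1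
    rw [← he0, Finsupp.cons_tail] at h1
    exact mem_support_iff.mp he h1
  have hdeg := totalDegree_coeff_finSuccEquiv_add_le H 0 hne
  have hev : ∀ s : Fin 2 → K, eval s H0 = eval ![0, s 0, s 1] H := by
    intro s
    have h1 := eval_eq_eval_mv_eval' s 0 H
    have h2 : (Fin.cons 0 s : Fin 3 → K) = ![0, s 0, s 1] := by
      ext i; fin_cases i <;> rfl
    rw [h2] at h1
    rw [h1, ← Polynomial.coeff_zero_eq_eval_zero, Polynomial.coeff_map]
  have hsz := schwartz_zippel_totalDegree hne S
  have hcard : ((S ×ˢ S).filter fun q => eval ![0, q.1, q.2] H = 0).card ≤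
      ((Fintype.piFinset fun _ : Fin 2 => S).filter fun f => eval f H0 = 0).card := by
    refine Finset.card_le_card_of_injOn (fun q => ![q.1, q.2]) ?_ ?_
    · intro q hq
      simp only [Finset.coe_filter, Finset.mem_product, Set.mem_ofPred_eq, Fintype.mem_piFinset] at hq ⊢
      refine ⟨fun i => ?_, ?_⟩
      · fin_cases i
        · exact hq.1.1
        · exact hq.1.2
      · rw [hev]; exact hq.2
    · intro q _ q' _ hqq
      have h0 := congrFun hqq 0
      have h1 := congrFun hqq 1
      exact Prod.ext h0 h1
  refine hcard.trans ?_
  rcases Nat.eq_zero_or_pos S.card with h0 | h0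
  · rw [Finset.card_eq_zero] at h0
    subst h0
    simp
  · have h0' : (0 : ℚ≥0) < S.card := by exact_mod_cast h0
    rw [div_le_div_iff₀ (by positivity) h0'] at hsz
    have hsz' : (((Fintype.piFinset fun _ : Fin 2 => S).filter fun f => eval f H0 = 0).card : ℚ≥0) ≤ H0.totalDegree * S.card := by
      have : (((Fintype.piFinset fun _ : Fin 2 => S).filter fun f => eval f H0 = 0).card : ℚ≥0) * S.card ≤ (H0.totalDegree * S.card) * S.card := by
        calc _ ≤ _ := hsz
          _ = _ := by ring
      exact le_of_mul_le_mul_right this h0'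
    have h3 : ((Fintype.piFinset fun _ : Fin 2 => S).filter fun f => eval f H0 = 0).card ≤ H0.totalDegree * S.card := by
      exact_mod_cast hsz'
    exact h3.trans (Nat.mul_le_mul_right _ (by omega))

/-- the quadric cone -/
noncomputable def cone {K : Type*} [Field K] (ν x z : K) : MvPolynomial (Fin 3) K :=
  (X 1 - C x) * (X 2 - C z) - C ν * X 0 ^ 2

lemma cone_deg {K : Type*} [Field K] (ν x z : K) : (cone ν x z).totalDegree ≤ 2 := by
  unfold cone
  have h : ∀ (i : Fin 3) (a : K), (X i - C a : MvPolynomial (Fin 3) K).totalDegree ≤ 1 := by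
    intro i a
    exact (totalDegree_sub _ _).trans (by simp)
  refine (totalDegree_sub _ _).trans (max_le ?_ ?_)
  · refine (totalDegree_mul _ _).trans ?_
    have h1 := h 1 x
    have h2 := h 2 z
    omega
  · refine (totalDegree_mul _ _).trans ?_
    simp

lemma cone_res {K : Type*} [Field K] {g ν : K} (hg : g ≠ 0) (q : ℤ × ℤ × ℤ) :
    res (l1 g ν q) (cone ν (g ^ q.1) (g ^ q.2.2)) = 0 := by
  have : Polynomial.C (g ^ q.2.1) * Polynomial.C (g ^ q.2.1)⁻¹ = 1 := by
    rw [← map_mul, mul_inv_cancel₀ (zpow_ne_zero _ hg), map_one]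
  simp [cone, res, l1]
  linear_combination Polynomial.C ν * Polynomial.X ^ 2 * this

lemma cone_res' {K : Type*} [Field K] {g ν x z : K} (hg : g ≠ 0) (hν : ν ≠ 0) (q : ℤ × ℤ × ℤ)
    (h : res (l1 g ν q) (cone ν x z) = 0) : g ^ q.1 = x ∧ g ^ q.2.2 = z := by
  have hs : g ^ q.2.1 ≠ 0 := zpow_ne_zero _ hg
  obtain ⟨s, hs'⟩ : ∃ s, s = g ^ q.2.1 := ⟨_, rfl⟩
  have h0 := congrArg (fun r => Polynomial.eval 0 r) h
  have h1 := congrArg (fun r => Polynomial.eval 1 r) h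
  have h2 := congrArg (fun r => Polynomial.coeff (Polynomial.derivative r) 0) h
  simp [cone, res, l1, Polynomial.coeff_zero_eq_eval_zero] at h0 h1 h2
  rw [← hs'] at h2 hs
  have h3 : s * s * (g ^ q.2.2 - z) + (g ^ q.1 - x) * ν = 0 := by
    have h4 : s * s⁻¹ = 1 := mul_inv_cancel₀ hs
    linear_combination (-s) * h2 - (g ^ q.1 - x) * ν * h4
  rcases h0 with h0 | h0
  · rw [h0, zero_mul, add_zero] at h3
    have h4 := (mul_eq_zero.mp h3).resolve_left (mul_ne_zero hs hs)
    exact ⟨sub_eq_zero.mp h0, sub_eq_zero.mp h4⟩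
  · rw [h0, mul_zero, zero_add] at h3
    have h4 := (mul_eq_zero.mp h3).resolve_right hν
    exact ⟨sub_eq_zero.mp h4, sub_eq_zero.mp h0⟩

/-- box of exponents -/
noncomputable def B0 (M : ℕ) : Finset (ℤ × ℤ × ℤ) :=
  Finset.Ico 0 (M : ℤ) ×ˢ Finset.Ico (-3 * (M : ℤ)) (3 * M) ×ˢ Finset.Ico 0 (M : ℤ)

/-- bigger box of exponents -/
noncomputable def B1 (M : ℕ) : Finset (ℤ × ℤ × ℤ) :=
  Finset.Ico (-(M : ℤ)) (2 * M) ×ˢ Finset.Ico (-4 * (M : ℤ)) (4 * M) ×ˢ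
    Finset.Ico (-(M : ℤ)) (2 * M)

lemma mem_B0 {M : ℕ} {q : ℤ × ℤ × ℤ} : q ∈ B0 M ↔ (0 ≤ q.1 ∧ q.1 < M) ∧
    (-3 * (M : ℤ) ≤ q.2.1 ∧ q.2.1 < 3 * M) ∧ (0 ≤ q.2.2 ∧ q.2.2 < M) := by
  simp [B0, Finset.mem_product]

lemma mem_B1 {M : ℕ} {q : ℤ × ℤ × ℤ} : q ∈ B1 M ↔ (-(M : ℤ) ≤ q.1 ∧ q.1 < 2 * M) ∧
    (-4 * (M : ℤ) ≤ q.2.1 ∧ q.2.1 < 4 * M) ∧ (-(M : ℤ) ≤ q.2.2 ∧ q.2.2 < 2 * M) := by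
  simp [B1, Finset.mem_product]

lemma card_B1 (M : ℕ) : (B1 M).card = 72 * M ^ 3 := by
  simp only [B1, Finset.card_product, Int.card_Ico]
  rw [show (2 * (M : ℤ) - -(M : ℤ)).toNat = 3 * M by omega,
    show (4 * (M : ℤ) - -4 * (M : ℤ)).toNat = 8 * M by omega]
  ring

lemma l1_injOn {K : Type*} [Field K] {g ν : K} {T : ℤ}
    (hT : ∀ n : ℤ, g ^ n = 1 → |n| < T → n = 0) (hg : g ≠ 0) (M : ℕ) (hM : 8 * (M : ℤ) ≤ T) :
    Set.InjOn (l1 g ν) (B1 M) := by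
  intro q hq q' hq' h
  rw [Finset.mem_coe, mem_B1] at hq hq'
  refine l1_inj hT hg q q' ?_ ?_ ?_ h <;> rw [abs_lt] <;> constructor <;> omega

lemma B0_sub (M : ℕ) : B0 M ⊆ B1 M := by
  intro q hq
  rw [mem_B0] at hq
  rw [mem_B1]
  omega

lemma count_box {K : Type*} [Field K] [DecidableEq K] {g ν : K} {T : ℤ}
    (hT : ∀ n : ℤ, g ^ n = 1 → |n| < T → n = 0) (hg : g ≠ 0) (hν : ν ≠ 0) (M : ℕ)
    (hM : 8 * (M : ℤ) ≤ T) (H : MvPolynomial (Fin 3) K) (hH : Prime H)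
    [DecidablePred fun q => res (l1 g ν q) H = 0] :
    ((B0 M).filter fun q => res (l1 g ν q) H = 0).card ≤ 6 * M ∨
    ((B0 M).filter fun q => res (l1 g ν q) H = 0).card ≤ 2 * H.totalDegree ^ 2 * M := by
  set V := (B0 M).filter fun q => res (l1 g ν q) H = 0 with hV
  have key : ∀ a b : ℤ, g ^ a = g ^ b → |a - b| < T → a = b := by
    intro a b hab h
    have := hT (a - b) (by rw [zpow_sub₀ hg, hab, div_self (zpow_ne_zero _ hg)]) h
    omega
  rcases V.eq_empty_or_nonempty with h0 | ⟨q0, hq0⟩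
  · left; simp [h0]
  have hX := not_X_dvd H hH _ (Finset.mem_filter.mp hq0).2
  by_cases hc : ∃ x z, H ∣ cone ν x z
  · left
    obtain ⟨x, z, c, hc⟩ := hc
    have hq : ∀ q ∈ V, g ^ q.1 = x ∧ g ^ q.2.2 = z := by
      intro q hq
      apply cone_res' hg hν
      rw [hc, map_mul, (Finset.mem_filter.mp hq).2, zero_mul]
    have : V.card ≤ (Finset.Ico (-3 * (M : ℤ)) (3 * M)).card := by
      refine Finset.card_le_card_of_injOn (fun q => q.2.1) ?_ ?_
      · intro q hq
        have := mem_B0.mp (Finset.mem_filter.mp hq).1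
        simp only [Finset.coe_Ico, Set.mem_Ico]
        exact this.2.1
      · intro q h1 q' h1' hqq
        have a := hq q h1
        have a' := hq q' h1'
        have b := mem_B0.mp (Finset.mem_filter.mp h1).1
        have b' := mem_B0.mp (Finset.mem_filter.mp h1').1
        refine Prod.ext (key _ _ (a.1.trans a'.1.symm) ?_) (Prod.ext hqq
          (key _ _ (a.2.trans a'.2.symm) ?_))
        all_goals rw [abs_lt]; constructor <;> omega
    rw [Int.card_Ico] at this
    omega
  · right
    push Not at hc
    have h1 := Finset.card_le_mul_card_image (f := fun q : ℤ × ℤ × ℤ => (g ^ q.1, g ^ q.2.2)) V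
      (H.totalDegree * 2) (by
        intro a ha
        have hinj : Set.InjOn (l1 g ν) (V.filter fun q => (g ^ q.1, g ^ q.2.2) = a : Finset _) := by
          refine (l1_injOn hT hg M hM).mono ?_
          intro q hq
          exact B0_sub M (Finset.mem_filter.mp (Finset.mem_filter.mp hq).1).1
        rw [← Finset.card_image_of_injOn hinj]
        refine (bezout hH (hc a.1 a.2) _ ?_).trans (Nat.mul_le_mul_left _ (cone_deg _ _ _))
        intro l hl
        rw [Finset.mem_image] at hl
        obtain ⟨q, hq, rfl⟩ := hl
        rw [Finset.mem_filter] at hq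
        refine ⟨(Finset.mem_filter.mp hq.1).2, ?_⟩
        rw [← hq.2]
        exact cone_res hg q)
    set S := (Finset.Ico 0 (M : ℤ)).image fun i => g ^ i with hS
    have hSc : S.card ≤ M := by
      refine Finset.card_image_le.trans ?_
      simp
    have h2 : (V.image fun q : ℤ × ℤ × ℤ => (g ^ q.1, g ^ q.2.2)).card ≤ H.totalDegree * S.card := by
      refine (Finset.card_le_card ?_).trans (sz_plane H hX S)
      intro a ha
      rw [Finset.mem_image] at ha
      obtain ⟨q, hq, rfl⟩ := ha
      have b := mem_B0.mp (Finset.mem_filter.mp hq).1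
      rw [Finset.mem_filter, Finset.mem_product]
      refine ⟨⟨Finset.mem_image_of_mem _ (Finset.mem_Ico.mpr b.1),
        Finset.mem_image_of_mem _ (Finset.mem_Ico.mpr b.2.2)⟩, ?_⟩
      have := res_eval0 H (l1 g ν q)
      rw [(Finset.mem_filter.mp hq).2, Polynomial.eval_zero] at this
      exact this.symm
    calc V.card ≤ _ := h1
      _ ≤ H.totalDegree * 2 * (H.totalDegree * M) :=
        Nat.mul_le_mul_left _ (h2.trans (Nat.mul_le_mul_left _ hSc))
      _ = _ := by ring

lemma shift_dvd {K : Type*} [Field K] [DecidableEq K] {g ν : K} {T : ℤ}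
    (hT : ∀ n : ℤ, g ^ n = 1 → |n| < T → n = 0) (hg : g ≠ 0) (M m A : ℕ)
    (hM : 8 * (M : ℤ) ≤ T) (hmM : m ≤ M) (H : MvPolynomial (Fin 3) K) (hH : Prime H)
    [DecidablePred fun q => res (l1 g ν q) H = 0]
    (hA : A ≤ ((B0 M).filter fun q => res (l1 g ν q) H = 0).card)
    (hbig : 72 * M ^ 3 + m ^ 2 * H.totalDegree ^ 2 < m * A)
    (τ : Fin 3 → ℤ) (hτ : τ 1 + τ 2 = 2 * τ 0) (hτ1 : |τ 1| ≤ 1) (hτ2 : |τ 2| ≤ 1)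
    (hτ3 : |τ 1 - τ 0| ≤ 1) :
    ∃ n : ℤ, n ≠ 0 ∧ |n| < m ∧ H ∣ sc (fun i => g ^ (n * τ i)) H := by
  classical
  by_contra! hcon
  have hne : ∀ (u : ℤ) (i : Fin 3), g ^ (u * τ i) ≠ 0 := fun u i => zpow_ne_zero _ hg
  let Z : ℕ → Finset (ℤ × ℤ × ℤ) := fun u =>
    (B1 M).filter fun q => res (l1 g ν q) (sc (fun i => g ^ (-(u : ℤ) * τ i)) H) = 0
  have h1 := union_count Z A (H.totalDegree ^ 2) m ?_ ?_
  · have h2 : ((Finset.range m).biUnion Z).card ≤ (B1 M).card := by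
      apply Finset.card_le_card
      intro q hq
      rw [Finset.mem_biUnion] at hq
      obtain ⟨u, _, hq⟩ := hq
      exact (Finset.mem_filter.mp hq).1
    rw [card_B1] at h2
    omega
  · intro u hu
    refine hA.trans ?_
    refine Finset.card_le_card_of_injOn
      (fun q => (q.1 + u * τ 1, q.2.1 + u * (τ 1 - τ 0), q.2.2 + u * τ 2)) ?_ ?_
    · intro q hq
      have b := mem_B0.mp (Finset.mem_filter.mp hq).1
      have hb : ∀ t : ℤ, |t| ≤ 1 → -(M : ℤ) ≤ u * t ∧ u * t ≤ M := by
        intro t ht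
        rw [abs_le] at ht
        have : (u : ℤ) ≤ M := by omega
        constructor <;> nlinarith
      have c1 := hb _ hτ1
      have c2 := hb _ hτ2
      have c3 := hb _ hτ3
      rw [Finset.mem_coe, Finset.mem_filter, mem_B1]
      refine ⟨⟨⟨?_, ?_⟩, ⟨?_, ?_⟩, ⟨?_, ?_⟩⟩, shift_vanish hg τ hτ u q H (Finset.mem_filter.mp hq).2⟩
      all_goals simp only []; linarith [b.1.1, b.1.2, b.2.1.1, b.2.1.2, b.2.2.1, b.2.2.2]
    · intro q _ q' _ h
      simp only [Prod.mk.injEq, add_left_inj] at h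
      exact Prod.ext h.1 (Prod.ext h.2.1 h.2.2)
  · intro u hu v hv huv
    have hinj : Set.InjOn (l1 g ν) (Z u ∩ Z v : Finset _) := by
      refine (l1_injOn hT hg M hM).mono ?_
      intro q hq
      exact (Finset.mem_filter.mp (Finset.mem_inter.mp hq).1).1
    rw [← Finset.card_image_of_injOn hinj]
    refine (bezout (sc_prime _ (hne (-(u : ℤ))) H hH)
      (Q := sc (fun i => g ^ (-(v : ℤ) * τ i)) H) ?_ _ ?_).trans ?_
    · intro hd
      refine hcon (u - v) (by omega) (by rw [abs_lt]; omega) ?_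
      have h3 := map_dvd (sc fun i => g ^ ((u : ℤ) * τ i)) hd
      rw [sc_sc, sc_sc] at h3
      simp only [← zpow_add₀ hg] at h3
      rw [show (fun i => g ^ ((u : ℤ) * τ i + -(u : ℤ) * τ i)) = fun _ => 1 by
        funext i; rw [show (u : ℤ) * τ i + -(u : ℤ) * τ i = 0 by ring, zpow_zero], sc_one] at h3
      convert h3 using 4
      ring_nf
    · intro l hl
      rw [Finset.mem_image] at hl
      obtain ⟨q, hq, rfl⟩ := hl
      rw [Finset.mem_inter] at hq
      exact ⟨(Finset.mem_filter.mp hq.1).2, (Finset.mem_filter.mp hq.2).2⟩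
    · rw [sc_totalDegree _ (hne _), sc_totalDegree _ (hne _), sq]

lemma weights {K : Type*} [Field K] [DecidableEq K] {g ν : K} {T : ℤ}
    (hT : ∀ n : ℤ, g ^ n = 1 → |n| < T → n = 0) (hg : g ≠ 0) (M m A : ℕ)
    (hM : 8 * (M : ℤ) ≤ T) (hmM : m ≤ M) (H : MvPolynomial (Fin 3) K) (hH : Prime H)
    [DecidablePred fun q => res (l1 g ν q) H = 0]
    (hA : A ≤ ((B0 M).filter fun q => res (l1 g ν q) H = 0).card)
    (hbig : 72 * M ^ 3 + m ^ 2 * H.totalDegree ^ 2 < m * A)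
    (hmT : 2 * (m : ℤ) * H.totalDegree < T)
    (τ : Fin 3 → ℤ) (hτ : τ 1 + τ 2 = 2 * τ 0) (hτi : ∀ i, |τ i| ≤ 1)
    (hτ3 : |τ 1 - τ 0| ≤ 1) (e e' : Fin 3 →₀ ℕ) (he : e ∈ H.support) (he' : e' ∈ H.support) :
    ∑ i, τ i * e i = ∑ i, τ i * e' i := by
  obtain ⟨n, hn0, hnm, hd⟩ := shift_dvd hT hg M m A hM hmM H hH hA hbig τ hτ (hτi 1) (hτi 2) hτ3
  have h1 := sc_dvd _ H hH.ne_zero hd (fun i => zpow_ne_zero _ hg) e e' he he'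
  have h2 : ∀ e : Fin 3 →₀ ℕ, (∏ i, (g ^ (n * τ i)) ^ e i) = g ^ (n * ∑ i, τ i * e i) := by
    intro e
    rw [Fin.sum_univ_three, Fin.prod_univ_three, mul_add, mul_add, zpow_add₀ hg, zpow_add₀ hg]
    simp only [← zpow_natCast, ← zpow_mul, mul_assoc]
  rw [h2, h2] at h1
  have hw : ∀ e ∈ H.support, |∑ i, τ i * e i| ≤ H.totalDegree := by
    intro e he
    have h3 := le_totalDegree he
    rw [Finsupp.sum_fintype _ _ (by simp)] at h3
    refine (Finset.abs_sum_le_sum_abs _ _).trans ?_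
    refine le_trans (b := ∑ i, (e i : ℤ)) (Finset.sum_le_sum fun i _ => ?_) (by exact_mod_cast h3)
    rw [abs_mul, Nat.abs_cast]
    have := hτi i
    nlinarith
  have ha := hw e he
  have ha' := hw e' he'
  generalize ∑ i, τ i * (e i : ℤ) = a at *
  generalize ∑ i, τ i * (e' i : ℤ) = b at *
  have h5 := hT (n * (a - b)) (by
    rw [mul_sub, zpow_sub₀ hg, h1, div_self (zpow_ne_zero _ hg)]) (by
    rw [abs_mul]
    have h6 : |a - b| ≤ 2 * H.totalDegree := by
      rw [abs_le] at *; omega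
    calc |n| * |a - b| ≤ m * (2 * H.totalDegree) :=
          mul_le_mul hnm.le h6 (abs_nonneg _) (by positivity)
      _ < T := by linarith)
  have := (mul_eq_zero.mp h5).resolve_left hn0
  omega

lemma no_component {K : Type*} [Field K] [DecidableEq K] {g ν : K} {T : ℤ}
    (hT : ∀ n : ℤ, g ^ n = 1 → |n| < T → n = 0) (hg : g ≠ 0) (M m A : ℕ)
    (hM : 8 * (M : ℤ) ≤ T) (hmM : m ≤ M) (H : MvPolynomial (Fin 3) K) (hH : Prime H)
    [DecidablePred fun q => res (l1 g ν q) H = 0]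
    (hA : A ≤ ((B0 M).filter fun q => res (l1 g ν q) H = 0).card)
    (hbig : 72 * M ^ 3 + m ^ 2 * H.totalDegree ^ 2 < m * A)
    (hmT : 2 * (m : ℤ) * H.totalDegree < T) : False := by
  have hpos : 0 < ((B0 M).filter fun q => res (l1 g ν q) H = 0).card := by
    rcases Nat.eq_zero_or_pos A with h | h
    · rw [h] at hbig; omega
    · omega
  obtain ⟨q, hq⟩ := Finset.card_pos.mp hpos
  have hres := (Finset.mem_filter.mp hq).2
  have hX := not_X_dvd H hH _ hres
  obtain ⟨e, he, he0⟩ := exists_mon H hX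
  have hev := res_eval0 H (l1 g ν q)
  rw [hres, Polynomial.eval_zero, eval_eq', Finset.sum_eq_single e] at hev
  · rw [Fin.prod_univ_three] at hev
    simp only [l1, he0, Matrix.cons_val] at hev
    simp only [pow_zero, one_mul] at hev
    exact mul_ne_zero (mem_support_iff.mp he) (mul_ne_zero (pow_ne_zero _ (zpow_ne_zero _ hg))
      (pow_ne_zero _ (zpow_ne_zero _ hg))) hev.symm
  · intro e' he' hne
    by_cases h0 : e' 0 = 0
    · exfalso
      apply hne
      have w1 := weights hT hg M m A hM hmM H hH hA hbig hmT ![1, 1, 1] (by simp)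
        (by intro i; fin_cases i <;> simp) (by simp) e' e he' he
      have w2 := weights hT hg M m A hM hmM H hH hA hbig hmT ![0, 1, -1] (by simp)
        (by intro i; fin_cases i <;> simp) (by simp) e' e he' he
      simp only [Fin.sum_univ_three, Matrix.cons_val] at w1 w2
      ext i
      fin_cases i
      · simp [h0, he0]
      · simp only [Fin.mk_one]; omega
      · simp only [Fin.reduceFinMk]; omega
    · rw [Fin.prod_univ_three]
      simp [h0]
  · intro h
    exact absurd he h

end SumPow

namespace SumPow
open MvPolynomial

lemma kernel {K : Type*} [Field K] {g ν : K} {T : ℤ}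
    (hT : ∀ n : ℤ, g ^ n = 1 → |n| < T → n = 0) (hg : g ≠ 0) (hν : ν ≠ 0) (M w D : ℕ)
    (hM : 8 * (M : ℤ) ≤ T) (hw : M ^ 3 < w ^ 2) (hwD : 96 * w * D < M ^ 3)
    (hwT : 24 * (w : ℤ) < T) (Q : Finset (ℤ × ℤ × ℤ)) (hQ : Q ⊆ B0 M) (hQc : M ^ 3 ≤ 4 * Q.card)
    (F : MvPolynomial (Fin 3) K) (hF : F ≠ 0) (hFD : F.totalDegree ≤ D)
    (hFQ : ∀ q ∈ Q, res (l1 g ν q) F = 0) : False := by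
  classical
  have h1 : ∃ H : MvPolynomial (Fin 3) K, Prime H ∧
      24 * w * H.totalDegree < (Q.filter fun q => res (l1 g ν q) H = 0).card := by
    by_contra! hcon
    have := component Q (l1 g ν) (24 * w) hcon F hF
    rw [Finset.filter_true_of_mem hFQ] at this
    have h2 : 24 * w * F.totalDegree ≤ 24 * w * D := Nat.mul_le_mul_left _ hFD
    have h3 : 96 * w * D = 4 * (24 * w * D) := by ring
    omega
  obtain ⟨H, hH, hlt⟩ := h1
  have hcard : 24 * w * H.totalDegree < ((B0 M).filter fun q => res (l1 g ν q) H = 0).card :=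
    hlt.trans_le (Finset.card_le_card (Finset.filter_subset_filter _ hQ))
  have hd : 1 ≤ H.totalDegree := by
    by_contra h0
    have h0 : H.totalDegree = 0 := by omega
    rw [totalDegree_eq_zero_iff_eq_C] at h0
    have hne : coeff 0 H ≠ 0 := by
      intro h
      rw [h, C_0] at h0
      exact hH.ne_zero h0
    apply hH.not_isUnit
    rw [h0]
    exact (IsUnit.mk0 _ hne).map C
  have hM1 : 1 ≤ M := by
    by_contra h0
    have : M = 0 := by omega
    subst this
    simp at hwD
  have hwM : M ≤ w := by
    have : M ^ 2 ≤ M ^ 3 := Nat.pow_le_pow_right hM1 (by norm_num)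
    by_contra! hc
    have : w ^ 2 < M ^ 2 := Nat.pow_lt_pow_left hc (by norm_num)
    omega
  obtain ⟨d, hdd⟩ : ∃ d, H.totalDegree = d := ⟨_, rfl⟩
  have hcb := count_box hT hg hν M hM H hH
  have hB : ((B0 M).filter fun q => res (l1 g ν q) H = 0).card ≤ 72 * M ^ 3 := by
    rw [← card_B1]
    exact (Finset.card_le_card (Finset.filter_subset _ _)).trans (Finset.card_le_card (B0_sub M))
  have key := fun m hmM => no_component hT hg M m (24 * w * H.totalDegree) hM hmM H hH hcard.le
  rw [hdd] at hcard hd hcb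
  simp only [hdd] at key
  have hdw : d < 3 * w := by
    by_contra! hc
    have : 24 * w * (3 * w) ≤ 24 * w * d := Nat.mul_le_mul_left _ hc
    nlinarith
  have hdM : 12 * w < d * M := by
    rcases hcb with hcb | hcb
    · nlinarith
    · have : 2 * d * (12 * w) < 2 * d * (d * M) := by nlinarith
      exact lt_of_mul_lt_mul_left this (by positivity)
  obtain ⟨m, hm1, hm2⟩ : ∃ m, 6 * w ≤ m * d ∧ m * d < 6 * w + d := by
    refine ⟨(6 * w + d - 1) / d, ?_, ?_⟩
    · have h1 := Nat.div_add_mod (6 * w + d - 1) d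
      have h2 := Nat.mod_lt (6 * w + d - 1) (show 0 < d by omega)
      rw [mul_comm] at h1
      omega
    · have h1 := Nat.div_mul_le_self (6 * w + d - 1) d
      omega
  have hmM : m ≤ M := by
    by_contra! hc
    have : (M + 1) * d ≤ m * d := Nat.mul_le_mul_right _ hc
    nlinarith
  refine key m hmM ?_ ?_
  · rw [show m ^ 2 * d ^ 2 = (m * d) ^ 2 by ring, show m * (24 * w * d) = 24 * w * (m * d) by ring]
    generalize m * d = y at *
    have hy : y ≤ 9 * w := by omega
    nlinarith
  · have : 2 * (m : ℤ) * d = 2 * ((m * d : ℕ) : ℤ) := by push_cast; ring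
    rw [this]
    omega

lemma exists_poly {K : Type*} [Field K] (Λ : Finset (K × K × K × K)) (D : ℕ)
    (hD : 6 * Λ.card < (D + 2) * (D + 3)) :
    ∃ F : MvPolynomial (Fin 3) K, F ≠ 0 ∧ F.totalDegree ≤ D ∧ ∀ l ∈ Λ, res l F = 0 := by
  let Φ : restrictTotalDegree (Fin 3) K D →ₗ[K] (Λ → Polynomial.degreeLT K (D + 1)) :=
    LinearMap.pi fun l => LinearMap.codRestrict _ ((res (l : K × K × K × K)).toLinearMap ∘ₗ
      Submodule.subtype _) (fun A => by
        rw [Polynomial.mem_degreeLT]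
        have h1 := A.2
        rw [mem_restrictTotalDegree] at h1
        have h2 := (res_natDegree (l : K × K × K × K) A).trans h1
        exact (Polynomial.degree_le_of_natDegree_le h2).trans_lt (by exact_mod_cast Nat.lt_succ_self D))
  have : Module.Finite K (Polynomial.degreeLT K (D + 1)) :=
    Module.Finite.equiv (Polynomial.degreeLTEquiv K (D + 1)).symm
  have hfin : Module.finrank K (Polynomial.degreeLT K (D + 1)) = D + 1 := by
    rw [(Polynomial.degreeLTEquiv K (D + 1)).finrank_eq]; simp
  have hlt : Module.finrank K (Λ → Polynomial.degreeLT K (D + 1)) <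
      Module.finrank K (restrictTotalDegree (Fin 3) K D) := by
    rw [Module.finrank_pi_fintype]
    simp only [hfin, Finset.sum_const, Finset.card_univ, Fintype.card_coe, smul_eq_mul]
    have := finrank_rtd K D
    nlinarith
  have hk := LinearMap.ker_ne_bot_of_finrank_lt (f := Φ) hlt
  obtain ⟨A, hA, hA0⟩ := Submodule.exists_mem_ne_zero_of_ne_bot hk
  refine ⟨A, fun h => hA0 (Subtype.ext h), (mem_restrictTotalDegree _ _ _).mp A.2, ?_⟩
  intro l hl
  rw [LinearMap.mem_ker] at hA
  have := congrFun hA ⟨l, hl⟩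
  exact congrArg Subtype.val this

/-- Second family of lines. -/
def l2 {K : Type*} [Field K] (g ν : K) (q : ℤ × ℤ × ℤ) : K × K × K × K :=
  (g ^ q.1, -ν * g ^ q.2.1, g ^ q.2.2, -g ^ (-q.2.1))

lemma res_eval {K : Type*} [Field K] (H : MvPolynomial (Fin 3) K) 
    (l : K × K × K × K) (t : K) : (res l H).eval t =
      eval ![t, l.1 + l.2.1 * t, l.2.2.1 + l.2.2.2 * t] H := by
  have : (Polynomial.aeval (t : K)).comp (res l) =
      aeval ![t, l.1 + l.2.1 * t, l.2.2.1 + l.2.2.2 * t] := by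
    apply MvPolynomial.algHom_ext
    intro i
    fin_cases i <;> simp [res]
  have := congrArg (fun f => f H) this
  simpa [Polynomial.coe_aeval_eq_eval, MvPolynomial.coe_aeval_eq_eval] using this

lemma indep {k K : Type*} [Field k] [Field K] (φ : k →+* K) {ν : K} (hν : ∀ a, φ a ≠ ν)
    (a b : k) (h : φ a + ν * φ b = 0) : a = 0 ∧ b = 0 := by
  by_cases hb : b = 0
  · subst hb
    simp at h
    exact ⟨h, rfl⟩
  · exfalso
    have hb' : φ b ≠ 0 := by simpa using hb
    apply hν (-a / b)
    rw [map_div₀, map_neg, div_eq_iff hb']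
    linear_combination -h

lemma vanish {k K : Type*} [Field k] [Field K] (φ : k →+* K) {h : k} {ν : K} (hν : ∀ a, φ a ≠ ν)
    (hh : h ≠ 0) {T : ℤ} (hT : ∀ n : ℤ, h ^ n = 1 → |n| < T → n = 0) (M D : ℕ)
    (hM : 8 * (M : ℤ) ≤ T) (q : ℤ × ℤ × ℤ) (x0 : ℕ) (W : Finset (ℕ × ℕ × ℕ))
    (hW : ∀ r ∈ W, r.1 ≤ M ∧ r.2.1 ≤ M ∧ r.2.2 ≤ M ∧ x0 ≤ M ∧
      h ^ x0 + h ^ r.1 = h ^ r.2.1 + h ^ r.2.2 ∧ r.2.1 ≠ x0)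
    (hD : D < W.card)
    (F : MvPolynomial (Fin 3) K) (hF : F.totalDegree ≤ D)
    (hv : ∀ r ∈ W, res (l2 (φ h) ν (r.2.1 + q.1 - x0, r.1 + q.1 - x0 - q.2.1 - q.2.2,
      r.2.2 - r.1 + q.2.2)) F = 0) : res (l1 (φ h) ν q) F = 0 := by
  classical
  have key : ∀ a b : ℤ, h ^ a = h ^ b → |a - b| < T → a = b := by
    intro a b hab hlt
    have := hT (a - b) (by rw [zpow_sub₀ hh, hab, div_self (zpow_ne_zero _ hh)]) hlt
    omega
  obtain ⟨i, j, k'⟩ := q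
  simp only at hv
  by_cases hM0 : M = 0
  · have hWs : W ⊆ {(0, 0, 0)} := by
      intro r hr
      have := hW r hr
      rw [Finset.mem_singleton]
      refine Prod.ext ?_ (Prod.ext ?_ ?_) <;> simp only [] <;> omega
    obtain ⟨r, hr⟩ := Finset.card_pos.mp (show 0 < W.card by omega)
    have := hW r hr
    omega
  -- the parameter of the intersection point
  let X' : ℕ × ℕ × ℕ → k := fun r => h ^ ((r.2.1 : ℤ) + i - x0)
  let S' : ℕ × ℕ × ℕ → k := fun r => h ^ ((r.1 : ℤ) + i - x0 - j - k')
  let t : ℕ × ℕ × ℕ → K := fun r => φ (h ^ i - X' r) / (φ (h ^ j) - ν * φ (S' r))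
  have hden : ∀ r, φ (h ^ j) - ν * φ (S' r) ≠ 0 := by
    intro r h0
    have := indep φ hν (h ^ j) (-S' r) (by rw [map_neg]; linear_combination h0)
    exact zpow_ne_zero _ hh this.1
  have hXne : ∀ r ∈ W, h ^ i - X' r ≠ 0 := by
    intro r hr h0
    have h1 := key _ _ (sub_eq_zero.mp h0) (by
      have := hW r hr
      rw [abs_lt]; omega)
    have := hW r hr
    omega
  have hinj : Set.InjOn t W := by
    intro r hr r' hr' htt
    have h1 : φ (h ^ i - X' r) * (φ (h ^ j) - ν * φ (S' r')) =
        φ (h ^ i - X' r') * (φ (h ^ j) - ν * φ (S' r)) :=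
      (div_eq_div_iff (hden r) (hden r')).mp htt
    have h2 := indep φ hν ((h ^ i - X' r) * h ^ j - (h ^ i - X' r') * h ^ j)
      ((h ^ i - X' r') * S' r - (h ^ i - X' r) * S' r') (by
        simp only [map_sub, map_mul] at h1 ⊢
        linear_combination h1)
    have h3 : X' r = X' r' := by
      have h4 := mul_right_cancel₀ (zpow_ne_zero j hh) (sub_eq_zero.mp h2.1)
      linear_combination -h4
    have h5 : S' r = S' r' := by
      have h4 := sub_eq_zero.mp h2.2
      rw [h3] at h4
      exact mul_left_cancel₀ (hXne r' hr') h4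
    have a := hW r hr
    have a' := hW r' hr'
    have h6 := key _ _ h3 (by rw [abs_lt]; omega)
    have h7 := key _ _ h5 (by rw [abs_lt]; omega)
    have h8 : r.1 = r'.1 := by omega
    have h9 : r.2.1 = r'.2.1 := by omega
    have h10 : h ^ (r.2.2 : ℤ) = h ^ (r'.2.2 : ℤ) := by
      rw [zpow_natCast, zpow_natCast]
      have b := a.2.2.2.2.1
      have b' := a'.2.2.2.2.1
      rw [h8, h9] at b
      linear_combination b' - b
    have h11 := key _ _ h10 (by rw [abs_lt]; omega)
    exact Prod.ext h8 (Prod.ext h9 (by exact_mod_cast h11))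
  refine Polynomial.eq_zero_of_natDegree_lt_card_of_eval_eq_zero' _ (W.image t) ?_ ?_
  · intro u hu
    rw [Finset.mem_image] at hu
    obtain ⟨r, hr, rfl⟩ := hu
    have h1 := congrArg (fun P => Polynomial.eval (t r) P) (hv r hr)
    simp only [Polynomial.eval_zero] at h1
    rw [res_eval] at h1 ⊢
    rw [← h1]
    have hg : φ h ≠ 0 := by simpa using hh
    have ht : t r * (φ h ^ j - ν * φ h ^ ((r.1 : ℤ) + i - x0 - j - k')) =
        φ h ^ i - φ h ^ ((r.2.1 : ℤ) + i - x0) := by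
      have := div_mul_cancel₀ (φ (h ^ i - X' r)) (hden r)
      simpa [t, X', S', map_zpow₀] using this
    have a := congrArg φ (hW r hr).2.2.2.2.1
    simp only [map_add, map_pow] at a
    congr 2
    have e1 : φ h ^ i + -φ h ^ j * t r =
      φ h ^ ((r.2.1 : ℤ) + i - x0) + -ν * φ h ^ ((r.1 : ℤ) + i - x0 - j - k') * t r := by
      linear_combination -ht
    have e2 : φ h ^ k' + -ν * φ h ^ (-j) * t r =
      φ h ^ ((r.2.2 : ℤ) - r.1 + k') + -φ h ^ (-((r.1 : ℤ) + i - x0 - j - k')) * t r := by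
      set s := φ h ^ j with hs
      set s' := φ h ^ ((r.1 : ℤ) + i - x0 - j - k') with hs'
      have hs0 : s ≠ 0 := zpow_ne_zero _ hg
      have hs0' : s' ≠ 0 := zpow_ne_zero _ hg
      rw [zpow_neg, zpow_neg, ← hs, ← hs']
      have c1 : s * s' * φ h ^ k' = φ h ^ (i - x0) * φ h ^ r.1 := by
        rw [hs, hs', ← zpow_natCast, ← zpow_add₀ hg, ← zpow_add₀ hg, ← zpow_add₀ hg]
        congr 1; ring
      have c2 : s * s' * φ h ^ ((r.2.2 : ℤ) - r.1 + k') = φ h ^ (i - x0) * φ h ^ r.2.2 := by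
        rw [hs, hs', ← zpow_natCast, ← zpow_add₀ hg, ← zpow_add₀ hg, ← zpow_add₀ hg]
        congr 1; ring
      have c3 : φ h ^ i = φ h ^ (i - x0) * φ h ^ x0 := by
        rw [← zpow_natCast, ← zpow_add₀ hg]
        congr 1; ring
      have c4 : φ h ^ ((r.2.1 : ℤ) + i - x0) = φ h ^ (i - x0) * φ h ^ r.2.1 := by
        rw [← zpow_natCast, ← zpow_add₀ hg]
        congr 1; ring
      rw [c3, c4] at ht
      have i1 : s * s⁻¹ = 1 := mul_inv_cancel₀ hs0
      have i2 : s' * s'⁻¹ = 1 := mul_inv_cancel₀ hs0'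
      apply mul_left_cancel₀ (mul_ne_zero hs0 hs0')
      linear_combination c1 - c2 - ν * t r * s' * i1 + s * t r * i2 + ht + φ h ^ (i - x0) * a
    simp only [l1, l2]
    rw [e1, e2]
  · rw [Finset.card_image_of_injOn hinj]
    exact ((res_natDegree _ _).trans hF).trans_lt hD

end SumPow

namespace SumPow
open MvPolynomial

lemma popular {β : Type*} [DecidableEq β] (M R : ℕ) (f : ℕ × ℕ → β) (hM : 1 ≤ M)
    (hR : 2 * R * ((Finset.Icc 1 M ×ˢ Finset.Icc 1 M).image f).card ≤ M ^ 2) :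
    ∃ x0 ∈ Finset.Icc 1 M, ∃ Y ⊆ Finset.Icc 1 M, M ≤ 2 * Y.card ∧ ∀ y ∈ Y,
      R ≤ ((Finset.Icc 1 M ×ˢ Finset.Icc 1 M).filter fun q => f q = f (x0, y)).card := by
  classical
  set P := Finset.Icc 1 M ×ˢ Finset.Icc 1 M with hP
  by_contra! hcon
  set good : ℕ × ℕ → Prop := fun r => R ≤ (P.filter fun q => f q = f r).card with hgood
  have h1 : ∀ x0 ∈ Finset.Icc 1 M, 2 * ((Finset.Icc 1 M).filter fun y => good (x0, y)).card < M := by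
    intro x0 hx0
    by_contra! hc
    obtain ⟨y, hy, hlt⟩ := hcon x0 hx0 _ (Finset.filter_subset _ _) hc
    have := (Finset.mem_filter.mp hy).2
    simp only [hgood] at this
    omega
  have h2 : (P.filter good).card = ∑ x0 ∈ Finset.Icc 1 M,
      ((Finset.Icc 1 M).filter fun y => good (x0, y)).card := by
    simp only [Finset.card_filter, hP, Finset.sum_product]
  have h3 : 2 * (P.filter good).card < M ^ 2 := by
    rw [h2, Finset.mul_sum]
    calc _ < ∑ x0 ∈ Finset.Icc 1 M, M := Finset.sum_lt_sum_of_nonempty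
            ⟨1, Finset.mem_Icc.mpr ⟨le_rfl, hM⟩⟩ h1
      _ = M ^ 2 := by simp [sq]
  have h4 : (P.filter fun r => ¬ good r).card ≤ R * (P.image f).card := by
    refine (Finset.card_le_mul_card_image (f := f) _ R ?_).trans (Nat.mul_le_mul_left _
      (Finset.card_le_card (Finset.image_subset_image (Finset.filter_subset _ _))))
    intro a ha
    rw [Finset.mem_image] at ha
    obtain ⟨r, hr, rfl⟩ := ha
    have hr' := (Finset.mem_filter.mp hr).2
    simp only [hgood, not_le] at hr'
    refine le_trans (Finset.card_le_card ?_) hr'.le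
    intro q hq
    rw [Finset.mem_filter] at hq ⊢
    exact ⟨(Finset.mem_filter.mp hq.1).1, hq.2⟩
  have h5 := Finset.card_filter_add_card_filter_not (s := P) good
  have h6 : P.card = M ^ 2 := by simp [hP, sq]
  have h7 : 2 * (R * (P.image f).card) = 2 * R * (P.image f).card := by ring
  omega

/-- admissible `y` for a given `q`. -/
noncomputable def adm (Y : Finset ℕ) (x0 n : ℕ) (q : ℤ × ℤ × ℤ) : Finset ℕ :=
  Y.filter fun y => 0 ≤ (y : ℤ) + q.1 - x0 - q.2.1 - q.2.2 ∧
    (y : ℤ) + q.1 - x0 - q.2.1 - q.2.2 < n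

lemma adm_card_le (Y : Finset ℕ) (x0 n : ℕ) (q : ℤ × ℤ × ℤ) : (adm Y x0 n q).card ≤ n := by
  have : (adm Y x0 n q).card ≤ (Finset.Ico 0 (n : ℤ)).card := by
    refine Finset.card_le_card_of_injOn (fun y => (y : ℤ) + q.1 - x0 - q.2.1 - q.2.2) ?_ ?_
    · intro y hy
      rw [Finset.coe_Ico]
      exact (Finset.mem_filter.mp hy).2
    · intro y _ y' _ h
      simp only at h
      omega
  simpa using this

lemma fiber_count (Y : Finset ℕ) (x0 n M : ℕ) (hn : 1 ≤ n) (hnM : n ≤ M) (hx0 : x0 ∈ Finset.Icc 1 M)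
    (hY : Y ⊆ Finset.Icc 1 M) (hYc : M ≤ 2 * Y.card) (i k : ℤ) (hi : 0 ≤ i ∧ i < M)
    (hk : 0 ≤ k ∧ k < M) :
    M ≤ 4 * ((Finset.Ico (-3 * (M : ℤ)) (3 * M)).filter
      fun j => n ≤ 24 * (adm Y x0 n (i, j, k)).card).card := by
  classical
  set J := Finset.Ico (-3 * (M : ℤ)) (3 * M) with hJ
  rw [Finset.mem_Icc] at hx0
  have h1 : ∑ j ∈ J, (adm Y x0 n (i, j, k)).card = Y.card * n := by
    simp only [adm, Finset.card_filter]
    rw [Finset.sum_comm, Finset.sum_const_nat]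
    intro y hy
    have hy' := Finset.mem_Icc.mp (hY hy)
    rw [← Finset.card_filter]
    have : (J.filter fun j => 0 ≤ (y : ℤ) + i - x0 - j - k ∧ (y : ℤ) + i - x0 - j - k < n) =
        Finset.Ico ((y : ℤ) + i - x0 - k - n + 1) ((y : ℤ) + i - x0 - k + 1) := by
      ext j
      simp only [hJ, Finset.mem_filter, Finset.mem_Ico]
      omega
    rw [this, Int.card_Ico]
    omega
  have hJc : J.card = 6 * M := by rw [hJ, Int.card_Ico]; omega
  set G := J.filter fun j => n ≤ 24 * (adm Y x0 n (i, j, k)).card with hG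
  have h2 := Finset.sum_filter_add_sum_filter_not J (fun j => n ≤ 24 * (adm Y x0 n (i, j, k)).card)
    (fun j => (adm Y x0 n (i, j, k)).card)
  have h3 : ∑ j ∈ G, (adm Y x0 n (i, j, k)).card ≤ G.card * n := by
    refine Finset.sum_le_card_nsmul _ _ n fun j _ => adm_card_le _ _ _ _
  have h4 : 24 * ∑ j ∈ J.filter (fun j => ¬ n ≤ 24 * (adm Y x0 n (i, j, k)).card),
      (adm Y x0 n (i, j, k)).card ≤ 6 * M * n := by
    rw [Finset.mul_sum]
    refine (Finset.sum_le_card_nsmul _ _ n fun j hj => ?_).trans ?_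
    · have := (Finset.mem_filter.mp hj).2
      omega
    · rw [smul_eq_mul]
      refine Nat.mul_le_mul_right _ ?_
      rw [← hJc]
      exact Finset.card_le_card (Finset.filter_subset _ _)
  rw [h1, ← hG] at h2
  have h5 : M * n ≤ 2 * (Y.card * n) := by nlinarith
  have h6 : 6 * M * n = 6 * (M * n) := by ring
  have h7 : M * n ≤ (4 * G.card) * n := by
    have : 4 * G.card * n = 4 * (G.card * n) := by ring
    omega
  exact le_of_mul_le_mul_right h7 (by omega)

theorem core {k K : Type*} [Field k] [DecidableEq k] [Field K] (φ : k →+* K) {h : k} {ν : K}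
    (hν : ∀ a, φ a ≠ ν)
    (hh : h ≠ 0) {T : ℤ} (hT : ∀ n : ℤ, h ^ n = 1 → |n| < T → n = 0) (M n R D w : ℕ)
    (hM : 8 * (M : ℤ) ≤ T) (hn : 1 ≤ n) (hnM : n ≤ M)
    (hD1 : 54 * M ^ 2 * n < (D + 2) * (D + 3)) (hD2 : 24 * D < n * R)
    (hw : M ^ 3 < w ^ 2) (hwD : 96 * w * D < M ^ 3) (hwT : 24 * (w : ℤ) < T) :
    M ^ 2 < 2 * (R + 1) * ((Finset.Icc 1 M ×ˢ Finset.Icc 1 M).image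
      fun q => h ^ q.1 + h ^ q.2).card := by
  classical
  by_contra! hcon
  obtain ⟨x0, hx0, Y, hY, hYc, hrep⟩ := popular M (R + 1) (fun q => h ^ q.1 + h ^ q.2)
    (by omega) hcon
  have hx0' := Finset.mem_Icc.mp hx0
  have key : ∀ a b : ℕ, h ^ a = h ^ b → a ≤ M → b ≤ M → a = b := by
    intro a b hab ha hb
    have := hT ((a : ℤ) - b) (by
      rw [zpow_sub₀ hh, zpow_natCast, zpow_natCast, hab, div_self (pow_ne_zero _ hh)])
      (by rw [abs_lt]; omega)
    omega
  -- auxiliary polynomial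
  let I := Finset.Ico (-(M : ℤ)) (2 * M)
  have hIc : I.card = 3 * M := by simp only [I, Int.card_Ico]; omega
  let Λ := (I ×ˢ Finset.Ico 0 (n : ℤ) ×ˢ I).image (l2 (φ h) ν)
  have hΛ : Λ.card ≤ 9 * M ^ 2 * n := by
    refine Finset.card_image_le.trans (le_of_eq ?_)
    rw [Finset.card_product, Finset.card_product, hIc, Int.card_Ico]
    simp only [sub_zero, Int.toNat_natCast]
    ring
  obtain ⟨F, hF0, hFD, hFΛ⟩ := exists_poly Λ D (by nlinarith)
  have hg : φ h ≠ 0 := by simpa using hh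
  have hTg : ∀ n : ℤ, φ h ^ n = 1 → |n| < T → n = 0 := by
    intro n hn
    refine hT n ?_
    apply φ.injective
    rw [map_zpow₀, hn, map_one]
  refine kernel hTg hg (ν := ν) (fun h0 => hν 0 (by rw [h0, map_zero])) M w D hM hw hwD hwT
    ((B0 M).filter fun q => n ≤ 24 * (adm Y x0 n q).card) (Finset.filter_subset _ _) ?_ F hF0 hFD ?_
  · -- the number of rich lines
    have h1 := Finset.mul_card_image_le_card_of_maps_to
      (s := (B0 M).filter fun q => n ≤ 24 * (adm Y x0 n q).card)
      (t := Finset.Ico 0 (M : ℤ) ×ˢ Finset.Ico 0 (M : ℤ)) (f := fun q => (q.1, q.2.2)) (by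
        intro q hq
        have := mem_B0.mp (Finset.mem_filter.mp hq).1
        simp only [Finset.mem_product, Finset.mem_Ico]
        exact ⟨this.1, this.2.2⟩) ((M + 3) / 4) (by
        rintro ⟨i, k'⟩ hik
        rw [Finset.mem_product, Finset.mem_Ico, Finset.mem_Ico] at hik
        have h2 := fiber_count Y x0 n M hn hnM hx0 hY hYc i k' hik.1 hik.2
        have h2' : (M + 3) / 4 ≤ ((Finset.Ico (-3 * (M : ℤ)) (3 * M)).filter
            fun j => n ≤ 24 * (adm Y x0 n (i, j, k')).card).card := by omega
        refine h2'.trans (Finset.card_le_card_of_injOn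
          (fun j => (i, j, k')) ?_ ?_)
        · intro j hj
          have hj' := Finset.mem_filter.mp hj
          have hj1 := Finset.mem_Ico.mp hj'.1
          rw [Finset.mem_coe, Finset.mem_filter, Finset.mem_filter, mem_B0]
          exact ⟨⟨⟨hik.1, hj1, hik.2⟩, hj'.2⟩, rfl⟩
        · intro j _ j' _ hjj
          simpa using hjj)
    rw [Finset.card_product, Int.card_Ico] at h1
    simp only [sub_zero, Int.toNat_natCast] at h1
    have h3 : M ≤ 4 * ((M + 3) / 4) := by omega
    calc M ^ 3 = M * (M * M) := by ring
      _ ≤ 4 * ((M + 3) / 4) * (M * M) := Nat.mul_le_mul_right _ h3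
      _ = 4 * ((M + 3) / 4 * (M * M)) := by ring
      _ ≤ _ := Nat.mul_le_mul_left _ h1
  · intro q hq
    rw [Finset.mem_filter, mem_B0] at hq
    let W : Finset (ℕ × ℕ × ℕ) := ((adm Y x0 n q) ×ˢ (Finset.Icc 1 M ×ˢ Finset.Icc 1 M)).filter
      fun r => h ^ x0 + h ^ r.1 = h ^ r.2.1 + h ^ r.2.2 ∧ r.2.1 ≠ x0
    have hWm : ∀ r ∈ W, r.1 ∈ adm Y x0 n q ∧ (1 ≤ r.1 ∧ r.1 ≤ M) ∧ (1 ≤ r.2.1 ∧ r.2.1 ≤ M) ∧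
        (1 ≤ r.2.2 ∧ r.2.2 ≤ M) ∧ h ^ x0 + h ^ r.1 = h ^ r.2.1 + h ^ r.2.2 ∧ r.2.1 ≠ x0 := by
      intro r hr
      have h1 := Finset.mem_filter.mp hr
      have h2 := Finset.mem_product.mp h1.1
      have h3 := Finset.mem_product.mp h2.2
      exact ⟨h2.1, Finset.mem_Icc.mp (hY (Finset.mem_filter.mp h2.1).1), Finset.mem_Icc.mp h3.1,
        Finset.mem_Icc.mp h3.2, h1.2⟩
    have hWc : R * (adm Y x0 n q).card ≤ W.card := by
      refine Finset.mul_card_image_le_card_of_maps_to (f := fun r => r.1) (fun r hr => (hWm r hr).1)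
        R ?_
      intro y hy
      have hyY := (Finset.mem_filter.mp hy).1
      have hyM := Finset.mem_Icc.mp (hY hyY)
      have h1 := hrep y hyY
      set P := (Finset.Icc 1 M ×ˢ Finset.Icc 1 M).filter
        fun q : ℕ × ℕ => h ^ q.1 + h ^ q.2 = h ^ x0 + h ^ y with hP
      have h2 : R ≤ (P.erase (x0, y)).card := by
        have := Finset.pred_card_le_card_erase (s := P) (a := (x0, y))
        omega
      refine h2.trans (Finset.card_le_card_of_injOn (fun r => (y, r.1, r.2)) ?_ ?_)
      · intro r hr
        have hr1 := Finset.mem_erase.mp hr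
        have hr2 := Finset.mem_filter.mp hr1.2
        rw [Finset.mem_coe, Finset.mem_filter, Finset.mem_filter, Finset.mem_product]
        refine ⟨⟨⟨hy, hr2.1⟩, hr2.2.symm, ?_⟩, rfl⟩
        intro h0
        simp only at h0
        apply hr1.1
        have h3 := hr2.2
        rw [h0] at h3
        have h4 := Finset.mem_product.mp hr2.1
        exact Prod.ext h0 (key _ _ (add_left_cancel h3) (Finset.mem_Icc.mp h4.2).2 hyM.2)
      · intro r _ r' _ hrr
        simp only [Prod.mk.injEq, true_and] at hrr
        exact Prod.ext hrr.1 hrr.2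
    refine vanish φ hν hh hT M D hM q x0 W ?_ ?_ F hFD ?_
    · intro r hr
      have := hWm r hr
      exact ⟨this.2.1.2, this.2.2.1.2, this.2.2.2.1.2, hx0'.2, this.2.2.2.2⟩
    · have h1 : n * R ≤ 24 * (adm Y x0 n q).card * R := Nat.mul_le_mul_right _ hq.2
      have h2 : 24 * (adm Y x0 n q).card * R = 24 * (R * (adm Y x0 n q).card) := by ring
      omega
    · intro r hr
      have a := hWm r hr
      have b := (Finset.mem_filter.mp a.1).2
      apply hFΛ
      apply Finset.mem_image_of_mem
      simp only [Finset.mem_product, Finset.mem_Ico, I]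
      omega

end SumPow

namespace SumPow

theorem nat_bound (p : ℕ) (hp : p.Prime) (h : (ZMod p)ˣ)
    (hgen : ∀ u : (ZMod p)ˣ, u ∈ Subgroup.zpowers h) (M : ℕ) (hM : 4000000 ≤ M)
    (hMp : 1000000 * M ^ 3 ≤ p ^ 2) :
    M ^ 2 < 2 * (400000 * (Nat.sqrt M + 1) + 1) *
      ((Finset.Icc 1 M ×ˢ Finset.Icc 1 M).image
        fun q => (h : ZMod p) ^ q.1 + (h : ZMod p) ^ q.2).card := by
  have : Fact p.Prime := ⟨hp⟩
  obtain ⟨ν, hν⟩ : ∃ ν : AlgebraicClosure (ZMod p),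
      ∀ a, algebraMap (ZMod p) (AlgebraicClosure (ZMod p)) a ≠ ν := by
    by_contra! hc
    have hs : Function.Surjective (algebraMap (ZMod p) (AlgebraicClosure (ZMod p))) := hc
    have hf := Finite.of_surjective _ hs
    have hi : Infinite (AlgebraicClosure (ZMod p)) := IsAlgClosed.instInfinite
    exact not_finite (AlgebraicClosure (ZMod p))
  have hT : ∀ n : ℤ, (h : ZMod p) ^ n = 1 → |n| < ((p - 1 : ℕ) : ℤ) → n = 0 := by
    intro n hn hlt
    have h1 : h ^ n = 1 := by
      apply Units.ext
      rw [Units.val_zpow_eq_zpow_val, hn, Units.val_one]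
    have h2 : orderOf h = p - 1 := by
      rw [orderOf_eq_card_of_forall_mem_zpowers hgen, Nat.card_eq_fintype_card,
        ZMod.card_units p]
    have h3 := orderOf_dvd_iff_zpow_eq_one.mpr h1
    rw [h2] at h3
    exact Int.eq_zero_of_abs_lt_dvd h3 hlt
  obtain ⟨n, hn⟩ : ∃ n, n = M / 2000000 := ⟨_, rfl⟩
  have hn1 : 2000000 * n ≤ M := by omega
  have hn2 : M ≤ 4000000 * n := by omega
  have hn3 : 1 ≤ n := by omega
  obtain ⟨D, hD⟩ : ∃ D, D = Nat.sqrt (54 * M ^ 2 * n) := ⟨_, rfl⟩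
  have hD1 : D ^ 2 ≤ 54 * M ^ 2 * n := by rw [hD]; exact Nat.sqrt_le' _
  have hD2 : 54 * M ^ 2 * n < (D + 1) ^ 2 := by rw [hD]; exact Nat.lt_succ_sqrt' _
  obtain ⟨s, hs⟩ : ∃ s, s = Nat.sqrt (M ^ 3) := ⟨_, rfl⟩
  have hs1 : s ^ 2 ≤ M ^ 3 := by rw [hs]; exact Nat.sqrt_le' _
  have hs2 : M ^ 3 < (s + 1) ^ 2 := by rw [hs]; exact Nat.lt_succ_sqrt' _
  have hs3 : 1 ≤ s := by
    by_contra h0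
    have h1 : s = 0 := by omega
    rw [h1] at hs2
    have h2 : 1 ≤ M ^ 3 := Nat.one_le_pow _ _ (by omega)
    norm_num at hs2
    omega
  have hs4 : (s + 1) ^ 2 ≤ 4 * M ^ 3 := by nlinarith
  obtain ⟨r, hr⟩ : ∃ r, r = Nat.sqrt M := ⟨_, rfl⟩
  have hr2 : M < (r + 1) ^ 2 := by rw [hr]; exact Nat.lt_succ_sqrt' _
  rw [← hr]
  have hp2 : 2 ≤ p := hp.two_le
  have hM3 : M ^ 2 ≤ M ^ 3 := Nat.pow_le_pow_right (by omega) (by norm_num)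
  have hM8 : 8 * M ≤ p - 1 := by
    have : 16 * M < p := by
      by_contra! hc
      have := Nat.pow_le_pow_left hc 2
      nlinarith
    omega
  have hw : 24 * (s + 1) < p - 1 := by
    have : 48 * (s + 1) < p := by
      by_contra! hc
      have := Nat.pow_le_pow_left hc 2
      nlinarith
    omega
  refine core (algebraMap (ZMod p) (AlgebraicClosure (ZMod p))) hν h.ne_zero hT M n
    (400000 * (r + 1)) D (s + 1) ?_ hn3 (by omega) ?_ ?_ hs2 ?_ ?_
  · exact_mod_cast hM8
  · nlinarith
  · by_contra! hc
    have h1 := Nat.pow_le_pow_left hc 2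
    have h2 : (n * (400000 * (r + 1))) ^ 2 = 160000000000 * n ^ 2 * (r + 1) ^ 2 := by ring
    have h3 : 160000000000 * n ^ 2 * M < 160000000000 * n ^ 2 * (r + 1) ^ 2 :=
      Nat.mul_lt_mul_of_pos_left hr2 (by positivity)
    have h4 : 40000 * n * M * M ≤ 40000 * n * M * (4000000 * n) := Nat.mul_le_mul_left _ hn2
    have h5 : 0 < M ^ 2 * n := by positivity
    nlinarith
  · by_contra! hc
    have h1 := Nat.pow_le_pow_left hc 2
    have h2 : (96 * (s + 1) * D) ^ 2 = 9216 * ((s + 1) ^ 2 * D ^ 2) := by ring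
    have h3 : (s + 1) ^ 2 * D ^ 2 ≤ 4 * M ^ 3 * (54 * M ^ 2 * n) := Nat.mul_le_mul hs4 hD1
    have h4 : M ^ 5 * (2000000 * n) ≤ M ^ 5 * M := Nat.mul_le_mul_left _ hn1
    have h5 : 0 < M ^ 5 * n := by positivity
    nlinarith
  · exact_mod_cast hw

end SumPow

theorem stmt_7 :
    ∃ c : ℝ, 0 < c ∧ ∀ (p : ℕ), p.Prime → 2 < p →
      ∀ h : (ZMod p)ˣ, (∀ u : (ZMod p)ˣ, u ∈ Subgroup.zpowers h) →
      ∀ N : ℕ, 1 ≤ N → (N : ℝ) ≤ (p : ℝ) ^ ((2 : ℝ) / 3) →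
      c * (N : ℝ) ^ ((3 : ℝ) / 2) ≤
        (((Finset.Icc 1 N ×ˢ Finset.Icc 1 N).image
          (fun q => (h : ZMod p) ^ q.1 + (h : ZMod p) ^ q.2)).card : ℝ) := by
  refine ⟨1 / 10 ^ 18, by positivity, ?_⟩
  intro p hp _ h hgen N hN hNp
  have hN0 : (0 : ℝ) ≤ N := by positivity
  have hpow : (N : ℝ) ^ ((3 : ℝ) / 2) = N * Real.sqrt N := by
    rw [show (3 : ℝ) / 2 = 1 + 1 / 2 by norm_num, Real.rpow_add (by exact_mod_cast hN),
      Real.rpow_one, ← Real.sqrt_eq_rpow]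
  rw [hpow]
  have hsq := Real.sq_sqrt hN0
  have hsq0 := Real.sqrt_nonneg (N : ℝ)
  set t := Real.sqrt N with ht
  by_cases hbig : N < 1000000000
  · have h1 : (1 : ℝ) ≤ (((Finset.Icc 1 N ×ˢ Finset.Icc 1 N).image
          (fun q => (h : ZMod p) ^ q.1 + (h : ZMod p) ^ q.2)).card : ℝ) := by
      have h0 : 0 < ((Finset.Icc 1 N ×ˢ Finset.Icc 1 N).image
          (fun q => (h : ZMod p) ^ q.1 + (h : ZMod p) ^ q.2)).card :=
        Finset.card_pos.mpr (Finset.Nonempty.image ⟨(1, 1), by simp [hN]⟩ _)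
      exact_mod_cast h0
    refine le_trans ?_ h1
    have h2 : (N : ℝ) ≤ 10 ^ 9 := by
      have : (N : ℝ) < 1000000000 := by exact_mod_cast hbig
      linarith
    have h3 : t ≤ 10 ^ 9 := by
      rw [ht, Real.sqrt_le_left (by positivity)]
      linarith
    have h4 : (N : ℝ) * t ≤ 10 ^ 9 * 10 ^ 9 := mul_le_mul h2 h3 hsq0 (by positivity)
    linarith
  · obtain ⟨M, hM⟩ : ∃ M, M = N / 100 := ⟨_, rfl⟩
    have hM1 : 100 * M ≤ N := by omega
    have hM2 : N ≤ 200 * M := by omega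
    have hN3 : N ^ 3 ≤ p ^ 2 := by
      have h1 : (N : ℝ) ^ 3 ≤ ((p : ℝ) ^ ((2 : ℝ) / 3)) ^ 3 := pow_le_pow_left₀ hN0 hNp 3
      rw [← Real.rpow_natCast, ← Real.rpow_natCast, ← Real.rpow_mul (by positivity)] at h1
      norm_num at h1
      exact_mod_cast h1
    have hMp : 1000000 * M ^ 3 ≤ p ^ 2 := by
      have := Nat.pow_le_pow_left hM1 3
      nlinarith
    have key := SumPow.nat_bound p hp h hgen M (by omega) hMp
    have hsub : ((Finset.Icc 1 M ×ˢ Finset.Icc 1 M).image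
        fun q => (h : ZMod p) ^ q.1 + (h : ZMod p) ^ q.2).card ≤
        ((Finset.Icc 1 N ×ˢ Finset.Icc 1 N).image
          (fun q => (h : ZMod p) ^ q.1 + (h : ZMod p) ^ q.2)).card := by
      apply Finset.card_le_card
      apply Finset.image_subset_image
      apply Finset.product_subset_product <;> apply Finset.Icc_subset_Icc_right <;> omega
    generalize ((Finset.Icc 1 N ×ˢ Finset.Icc 1 N).image
          (fun q => (h : ZMod p) ^ q.1 + (h : ZMod p) ^ q.2)).card = S at *
    have key2 : M ^ 2 < 2 * (400000 * (Nat.sqrt M + 1) + 1) * S :=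
      key.trans_le (Nat.mul_le_mul_left _ hsub)
    have hr : (Nat.sqrt M : ℝ) ≤ t := by
      rw [ht]
      apply Real.le_sqrt_of_sq_le
      have h1 : Nat.sqrt M ^ 2 ≤ N := (Nat.sqrt_le' M).trans (by omega)
      exact_mod_cast h1
    have ht1 : 1 ≤ t := by
      rw [ht, Real.one_le_sqrt]
      exact_mod_cast hN
    have key3 : (M : ℝ) ^ 2 < 2 * (400000 * ((Nat.sqrt M : ℝ) + 1) + 1) * S := by
      exact_mod_cast key2
    have hS0 : (0 : ℝ) ≤ S := by positivity
    have key4 : (M : ℝ) ^ 2 ≤ 2000000 * t * S := by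
      refine key3.le.trans (mul_le_mul_of_nonneg_right ?_ hS0)
      linarith
    have hM2' : (N : ℝ) ≤ 200 * M := by exact_mod_cast hM2
    have h5 : (N : ℝ) ^ 2 ≤ 40000 * M ^ 2 := by nlinarith
    have h6 : (N : ℝ) * t * t ≤ (80000000000 * S) * t := by
      have : (N : ℝ) * t * t = N ^ 2 := by rw [mul_assoc, ← sq, hsq]; ring
      rw [this]
      linarith
    have h7 := le_of_mul_le_mul_right h6 (by linarith)
    linarith
end
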